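/- Let n ≥ 2, let Ω ⊂ ℝⁿ be bounded and open, let q : ℝⁿ → ℂ be smooth with compact support contained in Ω, and let δ ∈ (−1, 0). Then there exist constants C > 0 and R > 0 such that for every ζ ∈ ℂⁿ with ζ·ζ = 0 and |ζ| ≥ R there exists a unique smooth function ψ_ζ : ℝⁿ → ℂ with ∫_{ℝⁿ} ⟨x⟩^{2δ}|ψ_ζ(x)|² dx < ∞ such that the function u(x) := e^{iζ·x}(1 + ψ_ζ(x)) satisfies Δu + qu = 0 on all of ℝⁿ; moreover (∫_{ℝⁿ} ⟨x⟩^{2δ}|ψ_ζ|² dx)^{1/2} ≤ (C/|ζ|) (∫_{ℝⁿ} ⟨x⟩^{2(δ+1)}|q|² dx)^{1/2}. -/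

import Mathlib

open scoped BigOperators
open MeasureTheory

/-- Partial derivative (in direction `i`) of a complex-valued function on `ℝⁿ`. -/
noncomputable def pdC {n : ℕ} (f : (Fin n → ℝ) → ℂ) (i : Fin n) (x : Fin n → ℝ) : ℂ :=
  fderiv ℝ f x (Pi.single i 1)

/-- Euclidean Laplacian of a complex-valued function on `ℝⁿ`. -/
noncomputable def lapC {n : ℕ} (f : (Fin n → ℝ) → ℂ) (x : Fin n → ℝ) : ℂ :=
  ∑ i, pdC (pdC f i) i x

/-- The CGO solution `e^{iζ·x}(1 + ψ(x))` associated with `ζ ∈ ℂⁿ` and remainder `ψ`. -/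
noncomputable def cgoSol {n : ℕ} (ζ : Fin n → ℂ) (ψ : (Fin n → ℝ) → ℂ)
    (x : Fin n → ℝ) : ℂ :=
  Complex.exp (Complex.I * ∑ i, ζ i * (x i : ℂ)) * (1 + ψ x)

namespace CGO

/-- kernel -/
noncomputable def KK (s r τ : ℝ) : ℝ :=
  if τ < 0 then
    (if r < s then -(Real.exp ((s + r) * τ) - Real.exp ((s - r) * τ)) / (2 * r)
      else -Real.exp ((s + r) * τ) / (2 * r))
  else (if r < s then 0 else -Real.exp ((s - r) * τ) / (2 * r))

lemma mul_exp_neg_le (x c : ℝ) (hc : 0 < c) : x * Real.exp (-(c * x)) ≤ 1 / c := by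
  have h1 : c * x ≤ Real.exp (c * x) := by linarith [Real.add_one_le_exp (c * x)]
  rw [Real.exp_neg, le_div_iff₀ hc]
  have h2 := Real.exp_pos (c * x)
  rw [← div_eq_mul_inv, div_mul_eq_mul_div, div_le_one h2]
  linarith

lemma KK_bound {s r : ℝ} (hs : 0 < s) (hr : 0 ≤ r) (τ : ℝ) :
    |KK s r τ| ≤ 4 / s * Real.exp (-(|s - r| * |τ| / 2)) := by
  unfold KK
  split_ifs with h1 h2 h2
  · -- main
    rw [abs_of_pos (by linarith : 0 < s - r), abs_of_neg h1]
    set x := -τ with hx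
    have hx0 : 0 < x := by linarith
    have e1 : Real.exp ((s + r) * τ) = Real.exp (-((s - r) * x)) * Real.exp (-(2 * r * x)) := by
      rw [← Real.exp_add]; congr 1; rw [hx]; ring
    have e2 : Real.exp ((s - r) * τ) = Real.exp (-((s - r) * x)) := by
      congr 1; rw [hx]; ring
    have hE := Real.exp_pos (-((s - r) * x))
    have hE2 : Real.exp (-(2 * r * x)) ≤ 1 := Real.exp_le_one_iff.2 (by nlinarith)
    have hE3 := Real.exp_pos (-(2 * r * x))
    have hle : Real.exp (-((s - r) * x)) ≤ Real.exp (-((s - r) * x / 2)) := by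
      apply Real.exp_le_exp.2; nlinarith
    rw [e1, e2]
    have : -(Real.exp (-((s - r) * x)) * Real.exp (-(2 * r * x)) - Real.exp (-((s - r) * x)))
        = Real.exp (-((s - r) * x)) * (1 - Real.exp (-(2 * r * x))) := by ring
    rw [this, abs_of_nonneg (by apply div_nonneg; apply mul_nonneg hE.le; linarith; linarith)]
    by_cases hr2 : s / 2 ≤ r
    · have hr0 : 0 < r := by linarith
      calc _ ≤ Real.exp (-((s - r) * x)) * 1 / (2 * r) := by gcongr; linarith
        _ ≤ Real.exp (-((s - r) * x)) * (4 / s) := by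
          rw [mul_one, div_eq_mul_inv]; gcongr
          rw [inv_le_comm₀ (by positivity) (by positivity)]
          rw [inv_div]; linarith
        _ ≤ _ := by rw [mul_comm]; gcongr
    · push Not at hr2
      rcases hr.eq_or_lt with h0 | h0
      · rw [← h0]; simp; positivity
      have h3 : (1 - Real.exp (-(2 * r * x))) / (2 * r) ≤ x := by
        rw [div_le_iff₀ (by positivity)]
        linarith [Real.add_one_le_exp (-(2 * r * x))]
      rw [mul_div_assoc]
      have h4 : Real.exp (-((s - r) * x)) = Real.exp (-((s - r) * x / 2)) * Real.exp (-((s - r) * x / 2)) := by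
        rw [← Real.exp_add]; congr 1; ring
      have h5 : Real.exp (-((s - r) * x / 2)) ≤ Real.exp (-(s / 4 * x)) := by
        apply Real.exp_le_exp.2; nlinarith
      have h6 := mul_exp_neg_le x (s / 4) (by positivity)
      have h7 := Real.exp_pos (-((s - r) * x / 2))
      calc Real.exp (-((s - r) * x)) * ((1 - Real.exp (-(2 * r * x))) / (2 * r))
          ≤ Real.exp (-((s - r) * x)) * x := by gcongr
        _ = Real.exp (-((s - r) * x / 2)) * (x * Real.exp (-((s - r) * x / 2))) := by rw [h4]; ring
        _ ≤ Real.exp (-((s - r) * x / 2)) * (x * Real.exp (-(s / 4 * x))) := by gcongr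
        _ ≤ Real.exp (-((s - r) * x / 2)) * (1 / (s / 4)) := by gcongr
        _ = _ := by field_simp
  · push Not at h2
    have hr0 : 0 < r := by linarith
    rw [neg_div, abs_neg, abs_of_pos (by positivity), abs_of_nonpos (by linarith : s - r ≤ 0), abs_of_neg h1, div_eq_mul_inv, mul_comm]
    gcongr
    · rw [inv_le_comm₀ (by positivity) (by positivity), inv_div]; linarith
    · nlinarith
  · rw [abs_zero]; positivity
  · push Not at h1 h2
    have hr0 : 0 < r := by linarith
    rw [neg_div, abs_neg, abs_of_pos (by positivity), abs_of_nonpos (by linarith : s - r ≤ 0), abs_of_nonneg h1, div_eq_mul_inv, mul_comm]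
    gcongr
    · rw [inv_le_comm₀ (by positivity) (by positivity), inv_div]; linarith
    · nlinarith

lemma KK_bound' {s r : ℝ} (hs : 0 < s) (hr : 0 ≤ r) (τ : ℝ) : |KK s r τ| ≤ 4 / s := by
  refine (KK_bound hs hr τ).trans ?_
  have : Real.exp (-(|s - r| * |τ| / 2)) ≤ 1 := Real.exp_le_one_iff.2 (by
    have := mul_nonneg (abs_nonneg (s - r)) (abs_nonneg τ); linarith)
  have h4 : 0 < 4 / s := by positivity
  nlinarith

lemma KK_sq_bound {s r : ℝ} (hs : 0 < s) (hr : 0 ≤ r) (τ : ℝ) :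
    (KK s r τ) ^ 2 ≤ 16 / s ^ 2 * Real.exp (-(|s - r| * |τ|)) := by
  rw [← sq_abs]
  calc |KK s r τ| ^ 2 ≤ (4 / s * Real.exp (-(|s - r| * |τ| / 2))) ^ 2 := by
        gcongr; exact KK_bound hs hr τ
    _ = 16 / s ^ 2 * (Real.exp (-(|s - r| * |τ| / 2)) * Real.exp (-(|s - r| * |τ| / 2))) := by ring
    _ = _ := by rw [← Real.exp_add]; congr 2; ring

/-- the weight -/
noncomputable def WW (s t u : ℝ) : ℝ :=
  2 * u / (s * Real.sqrt (s ^ 2 + u)) * (1 / (1 + (t * (u - s ^ 2) / s) ^ 2))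

lemma WW_nonneg {s t u : ℝ} (hs : 0 < s) (hu : 0 ≤ u) : 0 ≤ WW s t u := by
  unfold WW; positivity

lemma exp_le_WW {s t r : ℝ} (hs : 1 ≤ s) (ht : 0 < t) (hr : 0 ≤ r) :
    Real.exp (-(|s - r| * t)) ≤ 2 / t + 50 * WW s t (r ^ 2) := by
  have hs0 : 0 < s := by linarith
  have hW := WW_nonneg (t := t) hs0 (sq_nonneg r)
  by_cases h : s / 2 ≤ |s - r|
  · have hsr : 0 < |s - r| := by linarith
    have h1 : Real.exp (-(|s - r| * t)) ≤ 1 / (|s - r| * t) := by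
      rw [Real.exp_neg, ← one_div]
      apply one_div_le_one_div_of_le (by positivity)
      linarith [Real.add_one_le_exp (|s - r| * t)]
    have h2 : 1 / (|s - r| * t) ≤ 2 / t := by
      rw [div_le_div_iff₀ (by positivity) ht]; nlinarith
    linarith
  · push Not at h
    rw [abs_lt] at h
    set y := |s - r| * t with hy
    have hy0 : 0 ≤ y := by positivity
    have hq : (t * (r ^ 2 - s ^ 2) / s) ^ 2 ≤ 9 * y ^ 2 := by
      have e : (t * (r ^ 2 - s ^ 2) / s) ^ 2 = ((r + s) / s) ^ 2 * y ^ 2 := by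
        rw [hy, mul_pow, sq_abs]; field_simp; ring
      rw [e]
      gcongr
      have : (r + s) / s ≤ 3 := by rw [div_le_iff₀ hs0]; linarith
      have h0 : 0 ≤ (r + s) / s := by positivity
      nlinarith
    have hc : 2 / 5 ≤ 2 * r ^ 2 / (s * Real.sqrt (s ^ 2 + r ^ 2)) := by
      have h1 : Real.sqrt (s ^ 2 + r ^ 2) ≤ s + r := by
        rw [Real.sqrt_le_left (by positivity)]; nlinarith
      have h3 : Real.sqrt (s ^ 2 + r ^ 2) ≤ 5 / 2 * r := by
        rw [Real.sqrt_le_left (by linarith)]; nlinarith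
      have hsq : 0 < Real.sqrt (s ^ 2 + r ^ 2) := by positivity
      rw [le_div_iff₀ (by positivity)]
      nlinarith [mul_le_mul_of_nonneg_left h3 hs0.le]
    have he : Real.exp (-y) ≤ 1 / (1 + y ^ 2 / 2) := by
      rw [Real.exp_neg, ← one_div]
      apply one_div_le_one_div_of_le (by positivity)
      linarith [Real.quadratic_le_exp_of_nonneg hy0]
    have hf : 1 / (1 + 9 * y ^ 2) ≤ 1 / (1 + (t * (r ^ 2 - s ^ 2) / s) ^ 2) := by
      apply one_div_le_one_div_of_le (by positivity); linarith
    have hg : 1 / (1 + y ^ 2 / 2) ≤ 20 * (1 / (1 + 9 * y ^ 2)) := by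
      rw [mul_one_div, div_le_div_iff₀ (by positivity) (by positivity)]; nlinarith
    have : 2 / 5 * (1 / (1 + 9 * y ^ 2)) ≤ WW s t (r ^ 2) := by
      unfold WW; gcongr
    have h2 : 0 < 2 / t := by positivity
    linarith

lemma KK_measurable (s : ℝ) : Measurable (fun p : ℝ × ℝ => KK s p.1 p.2) := by
  unfold KK
  refine Measurable.ite (measurableSet_lt measurable_snd measurable_const) ?_ ?_
  · refine Measurable.ite (measurableSet_lt measurable_fst measurable_const) ?_ ?_ <;> fun_prop
  · refine Measurable.ite (measurableSet_lt measurable_fst measurable_const) ?_ ?_ <;> fun_prop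

end CGO

namespace CGO
open scoped FourierTransform SchwartzMap ENNReal ContDiff

/-- abbreviation -/
abbrev EE (n : ℕ) := EuclideanSpace ℝ (Fin n)

lemma plancherel_le {n : ℕ} {h : EE n → ℂ} (h1 : Integrable h) (h2 : MemLp h 2) :
    eLpNorm (𝓕 h) 2 volume = eLpNorm h 2 volume := by
  set H : Lp (α := EE n) ℂ 2 volume := h2.toLp h with hH
  have hc : Continuous (𝓕 h) := VectorFourier.fourierIntegral_continuous
    Real.continuous_fourierChar continuous_inner h1
  obtain ⟨FH, hFH⟩ : ∃ FH : Lp (α := EE n) ℂ 2 volume, FH = 𝓕 H := ⟨_, rfl⟩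
  have key : ∀ᵐ x ∂(volume : Measure (EE n)), FH x = 𝓕 h x := by
    refine ae_eq_of_integral_contDiff_smul_eq ?_ hc.locallyIntegrable ?_
    · exact (Lp.memLp _).locallyIntegrable (by norm_num)
    · intro g hg hgc
      have hgC : ContDiff ℝ ∞ (fun x => (g x : ℂ)) := Complex.ofRealCLM.contDiff.comp hg
      have hgcC : HasCompactSupport (fun x => (g x : ℂ)) := hgc.comp_left (g := Complex.ofReal) Complex.ofReal_zero
      set gS : 𝓢(EE n, ℂ) := hgcC.toSchwartzMap hgC with hgS
      have e1 : ∫ x, g x • FH x = Lp.toTemperedDistribution FH gS := by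
        rw [Lp.toTemperedDistribution_apply]
        rfl
      rw [e1, hFH, ← Lp.fourier_toTemperedDistribution_eq, TemperedDistribution.fourier_apply,
        Lp.toTemperedDistribution_apply]
      have e2 : ∫ x, (𝓕 gS) x • H x = ∫ x, (𝓕 gS) x • h x := by
        apply integral_congr_ae
        filter_upwards [h2.coeFn_toLp] with x hx
        rw [hH, hx]
      rw [e2]
      have := VectorFourier.integral_fourierIntegral_smul_eq_flip (L := innerₗ (EE n))
        Real.continuous_fourierChar continuous_inner (gS.integrable (μ := volume)) h1
      simpa using! this
  rw [← eLpNorm_congr_ae key, ← eLpNorm_congr_ae h2.coeFn_toLp]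
  have := Lp.norm_fourier_eq H
  rw [Lp.norm_def, Lp.norm_def, ENNReal.toReal_eq_toReal_iff' (Lp.eLpNorm_ne_top _) (Lp.eLpNorm_ne_top _)] at this
  rw [hFH]; exact this

lemma plancherel_inv_le {n : ℕ} {h : EE n → ℂ} (h1 : Integrable h) (h2 : MemLp h 2) :
    eLpNorm (𝓕⁻ h) 2 volume = eLpNorm h 2 volume := by
  rw [← plancherel_le h1 h2]
  have : 𝓕⁻ h = (𝓕 h) ∘ (fun x => -x) := by
    ext x; rw [Function.comp, Real.fourierInv_eq_fourier_neg]
  rw [this]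
  have hc : Continuous (𝓕 h) := VectorFourier.fourierIntegral_continuous
    Real.continuous_fourierChar continuous_inner h1
  exact eLpNorm_comp_measurePreserving hc.aestronglyMeasurable (Measure.measurePreserving_neg volume)

end CGO

namespace CGO
open scoped FourierTransform SchwartzMap ENNReal ContDiff

/-- shifted projection -/
noncomputable def eta {n : ℕ} (e a ξ : EE n) : EE n :=
  (2 * Real.pi) • ξ + a - (2 * Real.pi * inner ℝ e ξ) • e

lemma eta_perp {n : ℕ} {e a : EE n} (he : ‖e‖ = 1) (hea : inner ℝ e a = 0) (ξ : EE n) :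
    inner ℝ e (eta e a ξ) = 0 := by
  unfold eta
  rw [inner_sub_right, inner_add_right, inner_smul_right, inner_smul_right, hea,
    real_inner_self_eq_norm_sq, he]
  ring

lemma eta_line {n : ℕ} (e a ξ v : EE n) (t : ℝ) :
    eta e a (ξ + t • v) = eta e a ξ + t • ((2 * Real.pi) • v - (2 * Real.pi * inner ℝ e v) • e) := by
  unfold eta
  rw [inner_add_right, inner_smul_right]
  module

lemma eta_norm_le {n : ℕ} {e a : EE n} (he : ‖e‖ = 1) (ξ : EE n) :
    ‖eta e a ξ‖ ≤ (4 * Real.pi + ‖a‖) * (1 + ‖ξ‖) := by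
  unfold eta
  have h0 := Real.pi_pos
  have h1 : ‖(2 * Real.pi * inner ℝ e ξ) • e‖ ≤ 2 * Real.pi * ‖ξ‖ := by
    rw [norm_smul, he, mul_one, norm_mul, Real.norm_of_nonneg (by positivity)]
    gcongr
    simpa [he] using norm_inner_le_norm (𝕜 := ℝ) e ξ
  have h2 : ‖(2 * Real.pi) • ξ‖ = 2 * Real.pi * ‖ξ‖ := by
    rw [norm_smul, Real.norm_of_nonneg (by positivity)]
  have h3 := norm_sub_le ((2 * Real.pi) • ξ + a) ((2 * Real.pi * inner ℝ e ξ) • e)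
  have h4 := norm_add_le ((2 * Real.pi) • ξ) a
  nlinarith [norm_nonneg a, norm_nonneg ξ, mul_nonneg (norm_nonneg a) (norm_nonneg ξ)]

@[fun_prop]
lemma eta_cont {n : ℕ} (e a : EE n) : Continuous (eta e a) := by
  unfold eta; fun_prop

/-- profile -/
noncomputable def gA (s t u : ℝ) : ℝ := Real.arctan (t * (u - s ^ 2) / s) + Real.pi / 2
/-- profile -/
noncomputable def gB (s u : ℝ) : ℝ := (Real.sqrt (s ^ 2 + u))⁻¹
/-- derivative of the profile -/
noncomputable def gD (s t u : ℝ) : ℝ :=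
  (1 / (1 + (t * (u - s ^ 2) / s) ^ 2) * (t / s)) * gB s u + gA s t u * (-(gB s u / (2 * (s ^ 2 + u))))

lemma gA_pos (s t u : ℝ) : 0 < gA s t u := by
  unfold gA; linarith [Real.neg_pi_div_two_lt_arctan (t * (u - s ^ 2) / s)]
lemma gA_lt (s t u : ℝ) : gA s t u < Real.pi := by
  unfold gA; linarith [Real.arctan_lt_pi_div_two (t * (u - s ^ 2) / s)]
lemma gB_pos {s u : ℝ} (hs : 0 < s) (hu : 0 ≤ u) : 0 < gB s u := by
  unfold gB; positivity

lemma g_hasDeriv {s t u : ℝ} (hs : 0 < s) (hu : 0 ≤ u) :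
    HasDerivAt (fun u => gA s t u * gB s u) (gD s t u) u := by
  have hp : 0 < s ^ 2 + u := by positivity
  have h1 : HasDerivAt (gA s t) (1 / (1 + (t * (u - s ^ 2) / s) ^ 2) * (t / s)) u := by
    have : HasDerivAt (fun u : ℝ => t * (u - s ^ 2) / s) (t / s) u := by
      have := (((hasDerivAt_id u).sub_const (s ^ 2)).const_mul t).div_const s
      simpa using this
    exact this.arctan.add_const (Real.pi / 2)
  have h2 : HasDerivAt (gB s) (-(gB s u / (2 * (s ^ 2 + u)))) u := by
    have h : HasDerivAt (fun u : ℝ => s ^ 2 + u) 1 u := (hasDerivAt_id u).const_add (s ^ 2)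
    have h3 := (h.sqrt hp.ne').inv (by positivity : Real.sqrt (s ^ 2 + u) ≠ 0)
    refine h3.congr_deriv ?_
    unfold gB
    rw [Real.sq_sqrt hp.le]
    field_simp
  exact h1.mul h2

lemma g_bound {s t u : ℝ} (hs : 0 < s) (hu : 0 ≤ u) :
    Real.sqrt u * (gA s t u * gB s u) ≤ Real.pi := by
  have h1 : Real.sqrt u * gB s u ≤ 1 := by
    unfold gB
    rw [← div_eq_mul_inv, div_le_one (by positivity)]
    apply Real.sqrt_le_sqrt; nlinarith
  have := gA_pos s t u
  have := gA_lt s t u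
  have h3 : 0 ≤ Real.sqrt u * gB s u := mul_nonneg (Real.sqrt_nonneg _) (gB_pos hs hu).le
  nlinarith

lemma g_main {s t u c : ℝ} (hs : 0 < s) (hu : 0 ≤ u) (hc : 1 ≤ c) :
    2 * Real.pi * (t * WW s t u) ≤
      2 * Real.pi * c * (gA s t u * gB s u) + 4 * Real.pi * u * gD s t u := by
  have hA := gA_pos s t u
  have hB := gB_pos hs hu
  have hp : 0 < s ^ 2 + u := by positivity
  have e1 : t * WW s t u = 2 * u * ((1 / (1 + (t * (u - s ^ 2) / s) ^ 2) * (t / s)) * gB s u) := by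
    unfold WW gB
    field_simp
  have e2 : u * (gA s t u * (gB s u / (2 * (s ^ 2 + u)))) ≤ gA s t u * gB s u / 2 := by
    have : u / (s ^ 2 + u) ≤ 1 := by rw [div_le_one hp]; nlinarith
    calc u * (gA s t u * (gB s u / (2 * (s ^ 2 + u)))) = gA s t u * gB s u / 2 * (u / (s ^ 2 + u)) := by field_simp
      _ ≤ gA s t u * gB s u / 2 * 1 := by gcongr
      _ = _ := by ring
  have hAB : 0 < gA s t u * gB s u := by positivity
  have hpi := Real.pi_pos
  rw [e1]
  have : gD s t u = (1 / (1 + (t * (u - s ^ 2) / s) ^ 2) * (t / s)) * gB s u - gA s t u * (gB s u / (2 * (s ^ 2 + u))) := by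
    unfold gD; ring
  rw [this]
  have h5 : gA s t u * gB s u ≤ c * (gA s t u * gB s u) := by nlinarith
  nlinarith [mul_le_mul_of_nonneg_left e2 hpi.le, mul_le_mul_of_nonneg_left h5 hpi.le]

lemma gD_bound {s t u : ℝ} (hs : 0 < s) (ht : 0 < t) (hu : 0 ≤ u) :
    |gD s t u| ≤ t / s ^ 2 + 4 / s ^ 3 := by
  have hA := gA_pos s t u
  have hA' := gA_lt s t u
  have hB := gB_pos hs hu
  have hp : 0 < s ^ 2 + u := by positivity
  have hB' : gB s u ≤ 1 / s := by
    unfold gB; rw [← one_div]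
    apply one_div_le_one_div_of_le hs
    apply Real.le_sqrt_of_sq_le; linarith
  unfold gD
  have h1 : 1 / (1 + (t * (u - s ^ 2) / s) ^ 2) ≤ 1 := by
    rw [div_le_one (by positivity)]; nlinarith [sq_nonneg (t * (u - s ^ 2) / s)]
  refine (abs_add_le _ _).trans ?_
  gcongr
  · rw [abs_of_nonneg (by positivity)]
    calc _ ≤ 1 * (t / s) * (1 / s) := by gcongr
      _ = _ := by field_simp
  · rw [mul_neg, abs_neg, abs_of_nonneg (by positivity)]
    calc _ ≤ 4 * ((1 / s) / (2 * (s ^ 2 + 0))) := by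
          gcongr; linarith [Real.pi_le_four]
      _ ≤ _ := by rw [add_zero]; field_simp; norm_num

lemma schwartz_int {n : ℕ} {F : Type*} [NormedAddCommGroup F] [NormedSpace ℝ F]
    (φ : 𝓢(EE n, F)) (k : ℕ) :
    Integrable (fun ξ : EE n => (1 + ‖ξ‖) ^ k * ‖φ ξ‖) := by
  have h1 : Integrable (fun ξ : EE n => 2 ^ (k-1) * (‖ξ‖ ^ 0 * ‖φ ξ‖ + ‖ξ‖ ^ k * ‖φ ξ‖)) :=
    ((φ.integrable_pow_mul volume 0).add (φ.integrable_pow_mul volume k)).const_mul _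
  refine h1.mono' ?_ (Filter.Eventually.of_forall fun ξ => ?_)
  · exact (by fun_prop : Continuous fun ξ : EE n => (1 + ‖ξ‖) ^ k * ‖φ ξ‖).aestronglyMeasurable
  · rw [Real.norm_of_nonneg (by positivity), ← add_mul, ← mul_assoc]
    gcongr
    simpa using add_pow_le (zero_le_one) (norm_nonneg ξ) k

lemma schwartz_bdd {n : ℕ} {F : Type*} [NormedAddCommGroup F] [NormedSpace ℝ F]
    (φ : 𝓢(EE n, F)) : ∃ M, 0 < M ∧ ∀ ξ, ‖φ ξ‖ ≤ M := by
  refine ⟨SchwartzMap.seminorm ℝ 0 0 φ + 1, by positivity, fun ξ => ?_⟩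
  linarith [SchwartzMap.norm_le_seminorm ℝ φ ξ]

lemma int_poly {n : ℕ} {F F' : Type*} [NormedAddCommGroup F] [NormedSpace ℝ F]
    [NormedAddCommGroup F'] [NormedSpace ℝ F']
    (φ : 𝓢(EE n, F)) (ψ : 𝓢(EE n, F')) {f : EE n → ℝ} (hf : Continuous f) (C : ℝ) (k : ℕ)
    (h : ∀ ξ, |f ξ| ≤ C * (1 + ‖ξ‖) ^ k * (‖φ ξ‖ * ‖ψ ξ‖)) : Integrable f := by
  obtain ⟨M, hM0, hM⟩ := schwartz_bdd ψ
  have h1 : Integrable (fun ξ : EE n => |C| * M * ((1 + ‖ξ‖) ^ k * ‖φ ξ‖)) :=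
    (schwartz_int φ k).const_mul _
  refine h1.mono' hf.aestronglyMeasurable (Filter.Eventually.of_forall fun ξ => ?_)
  rw [Real.norm_eq_abs]
  refine (h ξ).trans ?_
  calc C * (1 + ‖ξ‖) ^ k * (‖φ ξ‖ * ‖ψ ξ‖) ≤ |C| * (1 + ‖ξ‖) ^ k * (‖φ ξ‖ * M) := by
        gcongr; exact le_abs_self C; exact hM ξ
    _ = _ := by ring

end CGO

namespace CGO
open scoped FourierTransform SchwartzMap ENNReal ContDiff

/-- integrand derivative in the trace identity -/
noncomputable def trD {n : ℕ} (e a : EE n) (s t : ℝ) (φ : 𝓢(EE n, ℂ)) (v ξ : EE n) : ℝ :=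
  2 * Real.pi * (‖v‖ ^ 2 - inner ℝ e v ^ 2) *
      (gA s t (‖eta e a ξ‖ ^ 2) * gB s (‖eta e a ξ‖ ^ 2)) * ‖φ ξ‖ ^ 2
    + 4 * Real.pi * inner ℝ v (eta e a ξ) ^ 2 * gD s t (‖eta e a ξ‖ ^ 2) * ‖φ ξ‖ ^ 2
    + 2 * (gA s t (‖eta e a ξ‖ ^ 2) * gB s (‖eta e a ξ‖ ^ 2)) *
      (inner ℝ v (eta e a ξ) * inner ℝ (φ ξ) (fderiv ℝ φ ξ v))

lemma tr_line {n : ℕ} {e a : EE n} (he : ‖e‖ = 1) (hea : inner ℝ e a = 0) {s t : ℝ} (hs : 0 < s)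
    (φ : 𝓢(EE n, ℂ)) (v ξ : EE n) :
    HasLineDerivAt ℝ (fun ξ => inner ℝ v (eta e a ξ) *
      (gA s t (‖eta e a ξ‖ ^ 2) * gB s (‖eta e a ξ‖ ^ 2)) * ‖φ ξ‖ ^ 2) (trD e a s t φ v ξ) ξ v := by
  unfold HasLineDerivAt
  set L : EE n := (2 * Real.pi) • v - (2 * Real.pi * inner ℝ e v) • e with hL
  have h1 : HasDerivAt (fun t : ℝ => eta e a (ξ + t • v)) L 0 := by
    simp_rw [eta_line]
    have : HasDerivAt (fun t : ℝ => t • L) ((1:ℝ) • L) 0 := (hasDerivAt_id (0:ℝ)).smul_const L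
    rw [one_smul] at this
    exact this.const_add _
  have h2 : HasDerivAt (fun t : ℝ => φ (ξ + t • v)) (fderiv ℝ φ ξ v) 0 :=
    (φ.differentiableAt (x := ξ)).hasFDerivAt.hasLineDerivAt v
  have h3 : HasDerivAt (fun t : ℝ => inner ℝ v (eta e a (ξ + t • v))) (inner ℝ v L) 0 := by
    have := (hasDerivAt_const (0:ℝ) v).inner ℝ h1
    simpa using this
  have h4 := h1.norm_sq
  have h5 := h2.norm_sq
  simp only [zero_smul, add_zero] at h4 h5
  have h6 : HasDerivAt (fun t' : ℝ => gA s t (‖eta e a (ξ + t' • v)‖ ^ 2) * gB s (‖eta e a (ξ + t' • v)‖ ^ 2))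
      (gD s t (‖eta e a ξ‖ ^ 2) * (2 * inner ℝ (eta e a ξ) L)) 0 := by
    have := g_hasDeriv (t := t) hs (sq_nonneg ‖eta e a ξ‖)
    exact HasDerivAt.comp (h₂ := fun u => gA s t u * gB s u) (0:ℝ) (by simpa using this) h4
  have h7 := (h3.mul h6).mul h5
  refine h7.congr_deriv ?_
  have e1 : inner ℝ (eta e a ξ) L = 2 * Real.pi * inner ℝ v (eta e a ξ) := by
    rw [hL, inner_sub_right, inner_smul_right, inner_smul_right, real_inner_comm e, eta_perp he hea,
      real_inner_comm]; ring
  have e2 : inner ℝ v L = 2 * Real.pi * (‖v‖ ^ 2 - inner ℝ e v ^ 2) := by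
    rw [hL, inner_sub_right, inner_smul_right, inner_smul_right, real_inner_self_eq_norm_sq,
      real_inner_comm e v]; ring
  rw [e1, e2]
  simp only [zero_smul, add_zero, Pi.mul_apply]
  unfold trD
  ring

lemma gA_cont (s t : ℝ) : Continuous (gA s t) := by
  unfold gA; fun_prop
lemma gB_cont {n : ℕ} (e a : EE n) {s : ℝ} (hs : 0 < s) : Continuous fun ξ => gB s (‖eta e a ξ‖ ^ 2) := by
  unfold gB
  refine Continuous.inv₀ (by fun_prop) fun ξ => ?_
  positivity
lemma gD_cont {n : ℕ} (e a : EE n) {s t : ℝ} (hs : 0 < s) : Continuous fun ξ => gD s t (‖eta e a ξ‖ ^ 2) := by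
  unfold gD
  have h1 := gB_cont e a hs
  have h2 : Continuous fun ξ => gA s t (‖eta e a ξ‖ ^ 2) := (gA_cont s t).comp (by fun_prop)
  have h3 : Continuous fun ξ : EE n => (1 / (1 + (t * (‖eta e a ξ‖ ^ 2 - s ^ 2) / s) ^ 2) * (t / s)) := by
    refine Continuous.mul (Continuous.div continuous_const (by fun_prop) fun ξ => ?_) continuous_const
    positivity
  refine (h3.mul h1).add (h2.mul (Continuous.neg (h1.div (by fun_prop) fun ξ => ?_)))
  positivity

lemma gAB_le {s t u : ℝ} (hs : 0 < s) (hu : 0 ≤ u) : gA s t u * gB s u ≤ 4 / s := by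
  have hB' : gB s u ≤ 1 / s := by
    unfold gB; rw [← one_div]
    apply one_div_le_one_div_of_le hs
    apply Real.le_sqrt_of_sq_le; linarith
  calc _ ≤ 4 * (1 / s) := by
        gcongr
        · exact (gB_pos hs hu).le
        · linarith [gA_lt s t u, Real.pi_le_four]
    _ = _ := by ring

lemma tr_int {n : ℕ} {e a : EE n} (he : ‖e‖ = 1) {s t : ℝ} (hs : 0 < s) (ht : 0 < t)
    (φ : 𝓢(EE n, ℂ)) (v : EE n) :
    Integrable (trD e a s t φ v) := by
  have c1 : Continuous fun ξ => gA s t (‖eta e a ξ‖ ^ 2) := (gA_cont s t).comp (by fun_prop)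
  have c2 := gB_cont e a hs
  have c3 := gD_cont e a (t := t) hs
  have c4 : Continuous fun ξ => fderiv ℝ φ ξ := (SchwartzMap.fderivCLM ℝ (EE n) ℂ φ).continuous
  have c5 : Continuous fun ξ => fderiv ℝ φ ξ v := c4.clm_apply continuous_const
  have c6 : Continuous fun ξ => φ ξ := φ.continuous
  have hb : ∀ ξ, |inner ℝ v (eta e a ξ)| ≤ ‖v‖ * ((4 * Real.pi + ‖a‖) * (1 + ‖ξ‖)) := fun ξ =>
    (abs_real_inner_le_norm _ _).trans (by gcongr; exact eta_norm_le he ξ)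
  have hg0 : ∀ ξ, 0 ≤ gA s t (‖eta e a ξ‖ ^ 2) * gB s (‖eta e a ξ‖ ^ 2) := fun ξ =>
    mul_nonneg (gA_pos _ _ _).le (gB_pos hs (sq_nonneg _)).le
  refine Integrable.add (Integrable.add ?_ ?_) ?_
  · refine int_poly φ φ (by fun_prop) (2 * Real.pi * |‖v‖ ^ 2 - inner ℝ e v ^ 2| * (4 / s)) 0 fun ξ => ?_
    rw [abs_mul, abs_mul, abs_mul, abs_of_nonneg (by positivity : 0 ≤ 2 * Real.pi),
      abs_of_nonneg (hg0 ξ), abs_of_nonneg (sq_nonneg ‖φ ξ‖), pow_zero, mul_one, sq ‖φ ξ‖]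
    gcongr
    exact gAB_le hs (sq_nonneg _)
  · refine int_poly φ φ (by fun_prop) (4 * Real.pi * (‖v‖ * (4 * Real.pi + ‖a‖)) ^ 2 * (t / s ^ 2 + 4 / s ^ 3)) 2 fun ξ => ?_
    rw [abs_mul, abs_mul, abs_mul, abs_of_nonneg (by positivity : 0 ≤ 4 * Real.pi),
      abs_of_nonneg (sq_nonneg ‖φ ξ‖), abs_pow]
    calc _ ≤ 4 * Real.pi * (‖v‖ * ((4 * Real.pi + ‖a‖) * (1 + ‖ξ‖))) ^ 2 * (t / s ^ 2 + 4 / s ^ 3) * ‖φ ξ‖ ^ 2 := by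
          gcongr
          · exact hb ξ
          · exact gD_bound hs ht (sq_nonneg _)
      _ = _ := by ring
  · refine int_poly φ (SchwartzMap.fderivCLM ℝ (EE n) ℂ φ) (by fun_prop)
      (2 * (4 / s) * ((‖v‖ * (4 * Real.pi + ‖a‖)) * ‖v‖)) 1 fun ξ => ?_
    rw [abs_mul, abs_mul 2, abs_of_nonneg (hg0 ξ), abs_mul, SchwartzMap.fderivCLM_apply, abs_two]
    calc _ ≤ 2 * (4 / s) * ((‖v‖ * ((4 * Real.pi + ‖a‖) * (1 + ‖ξ‖))) * (‖φ ξ‖ * (‖fderiv ℝ φ ξ‖ * ‖v‖))) := by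
          gcongr
          · exact gAB_le hs (sq_nonneg _)
          · exact hb ξ
          · refine (abs_real_inner_le_norm _ _).trans ?_
            gcongr
            exact ContinuousLinearMap.le_opNorm _ _
      _ = _ := by ring

lemma tr_zero {n : ℕ} {e a : EE n} (he : ‖e‖ = 1) (hea : inner ℝ e a = 0) {s t : ℝ} (hs : 0 < s) (ht : 0 < t)
    (φ : 𝓢(EE n, ℂ)) (v : EE n) :
    ∫ ξ, trD e a s t φ v ξ = 0 := by
  have c1 : Continuous fun ξ => gA s t (‖eta e a ξ‖ ^ 2) := (gA_cont s t).comp (by fun_prop)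
  have c2 := gB_cont e a hs
  have hb : ∀ ξ, |inner ℝ v (eta e a ξ)| ≤ ‖v‖ * ((4 * Real.pi + ‖a‖) * (1 + ‖ξ‖)) := fun ξ =>
    (abs_real_inner_le_norm _ _).trans (by gcongr; exact eta_norm_le he ξ)
  have hg0 : ∀ ξ, 0 ≤ gA s t (‖eta e a ξ‖ ^ 2) * gB s (‖eta e a ξ‖ ^ 2) := fun ξ =>
    mul_nonneg (gA_pos _ _ _).le (gB_pos hs (sq_nonneg _)).le
  have c6 : Continuous fun ξ => φ ξ := φ.continuous
  have := integral_bilinear_hasLineDerivAt_right_eq_neg_left_of_integrable (μ := (volume : Measure (EE n)))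
    (f := fun _ : EE n => (1:ℝ)) (f' := fun _ => 0)
    (g := fun ξ => inner ℝ v (eta e a ξ) *
      (gA s t (‖eta e a ξ‖ ^ 2) * gB s (‖eta e a ξ‖ ^ 2)) * ‖φ ξ‖ ^ 2)
    (g' := trD e a s t φ v) (v := v) (B := ContinuousLinearMap.mul ℝ ℝ) (by simp)
    (by simpa using tr_int he hs ht φ v) ?_
    (fun x _ => by simpa [HasLineDerivAt] using hasDerivAt_const (0:ℝ) (1:ℝ))
    (fun x _ => tr_line he hea hs φ v x)
  · simpa using this
  · simp only [ContinuousLinearMap.mul_apply', one_mul]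
    refine int_poly φ φ (by fun_prop) ((‖v‖ * (4 * Real.pi + ‖a‖)) * (4 / s)) 1 fun ξ => ?_
    rw [abs_mul, abs_mul, abs_of_nonneg (hg0 ξ), abs_of_nonneg (sq_nonneg ‖φ ξ‖)]
    calc _ ≤ (‖v‖ * ((4 * Real.pi + ‖a‖) * (1 + ‖ξ‖))) * (4 / s) * ‖φ ξ‖ ^ 2 := by
          gcongr
          · exact hg0 ξ
          · exact hb ξ
          · exact gAB_le hs (sq_nonneg _)
      _ = _ := by ring

lemma WW_cont {n : ℕ} (e a : EE n) {s t : ℝ} (hs : 0 < s) : Continuous fun ξ => WW s t (‖eta e a ξ‖ ^ 2) := by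
  unfold WW
  refine (Continuous.div (by fun_prop) (by fun_prop) fun ξ => by positivity).mul
    (Continuous.div (by fun_prop) (by fun_prop) fun ξ => by positivity)

lemma WW_int {n : ℕ} {e a : EE n} (he : ‖e‖ = 1) {s t : ℝ} (hs : 0 < s) 
    (φ : 𝓢(EE n, ℂ)) : Integrable fun ξ => t * WW s t (‖eta e a ξ‖ ^ 2) * ‖φ ξ‖ ^ 2 := by
  have c1 := WW_cont e a (t := t) hs
  have c6 : Continuous fun ξ => φ ξ := φ.continuous
  refine int_poly φ φ (by fun_prop) (|t| * (2 * (4 * Real.pi + ‖a‖) ^ 2 / (s * s))) 2 fun ξ => ?_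
  rw [abs_mul, abs_mul, abs_of_nonneg (WW_nonneg hs (sq_nonneg _)), abs_of_nonneg (sq_nonneg ‖φ ξ‖)]
  calc _ ≤ |t| * (2 * ((4 * Real.pi + ‖a‖) * (1 + ‖ξ‖)) ^ 2 / (s * s) * 1) * ‖φ ξ‖ ^ 2 := by
        unfold WW
        gcongr
        · exact eta_norm_le he ξ
        · apply Real.le_sqrt_of_sq_le; nlinarith [sq_nonneg ‖eta e a ξ‖]
        · rw [div_le_one (by positivity)]; nlinarith [sq_nonneg (t * (‖eta e a ξ‖ ^ 2 - s ^ 2) / s)]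
    _ = _ := by ring

lemma trace {n : ℕ} (hn : 2 ≤ n) {e a : EE n} (he : ‖e‖ = 1) (hea : inner ℝ e a = 0) {s t : ℝ}
    (hs : 0 < s) (ht : 0 < t) (φ : 𝓢(EE n, ℂ)) :
    ∫ ξ, t * WW s t (‖eta e a ξ‖ ^ 2) * ‖φ ξ‖ ^ 2 ≤ ∫ ξ, ‖φ ξ‖ * ‖fderiv ℝ φ ξ‖ := by
  let b := EuclideanSpace.basisFun (Fin n) ℝ
  have h0 : ∫ ξ, ∑ j, trD e a s t φ (b j) ξ = 0 := by
    rw [integral_finsetSum _ fun j _ => tr_int he hs ht φ (b j)]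
    simp [tr_zero he hea hs ht]
  have h1 : Integrable fun ξ => ∑ j, trD e a s t φ (b j) ξ :=
    integrable_finsetSum _ fun j _ => tr_int he hs ht φ (b j)
  have h2 : Integrable fun ξ => ‖φ ξ‖ * ‖fderiv ℝ φ ξ‖ := by
    have c4 : Continuous fun ξ => fderiv ℝ φ ξ := (SchwartzMap.fderivCLM ℝ (EE n) ℂ φ).continuous
    have c6 : Continuous fun ξ => φ ξ := φ.continuous
    refine int_poly φ (SchwartzMap.fderivCLM ℝ (EE n) ℂ φ) (by fun_prop) 1 0 fun ξ => ?_
    rw [abs_of_nonneg (by positivity)]; simp [SchwartzMap.fderivCLM_apply]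
  have hpi := Real.pi_pos
  have h3 : ∀ ξ, 2 * Real.pi * (t * WW s t (‖eta e a ξ‖ ^ 2) * ‖φ ξ‖ ^ 2) - 2 * Real.pi * (‖φ ξ‖ * ‖fderiv ℝ φ ξ‖)
      ≤ ∑ j, trD e a s t φ (b j) ξ := by
    intro ξ
    set η := eta e a ξ
    set g := gA s t (‖η‖ ^ 2) * gB s (‖η‖ ^ 2) with hg
    have hg0 : 0 ≤ g := mul_nonneg (gA_pos _ _ _).le (gB_pos hs (sq_nonneg _)).le
    have e1 : ∑ j, (‖b j‖ ^ 2 - inner ℝ e (b j) ^ 2) = n - 1 := by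
      rw [Finset.sum_sub_distrib, b.sum_sq_inner_left, he]
      simp
    have e2 : ∑ j, inner ℝ (b j) η ^ 2 = ‖η‖ ^ 2 := b.sum_sq_inner_right η
    have e3 : ∑ j, inner ℝ (b j) η * inner ℝ (φ ξ) (fderiv ℝ φ ξ (b j)) = inner ℝ (φ ξ) (fderiv ℝ φ ξ η) := by
      conv_rhs => rw [← b.sum_repr' η]
      rw [map_sum, inner_sum]
      refine Finset.sum_congr rfl fun j _ => ?_
      rw [map_smul, real_inner_smul_right]
    have e4 : ∑ j, trD e a s t φ (b j) ξ = 2 * Real.pi * (n - 1) * g * ‖φ ξ‖ ^ 2 +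
        4 * Real.pi * ‖η‖ ^ 2 * gD s t (‖η‖ ^ 2) * ‖φ ξ‖ ^ 2 + 2 * g * inner ℝ (φ ξ) (fderiv ℝ φ ξ η) := by
      have e5 := congrArg (fun z => 4 * Real.pi * z * gD s t (‖η‖ ^ 2) * ‖φ ξ‖ ^ 2) e2
      rw [← e1, ← e3, ← e5]
      unfold trD
      rw [Finset.sum_add_distrib, Finset.sum_add_distrib]
      simp only [Finset.mul_sum, Finset.sum_mul]
      rfl
    rw [e4]
    have hn' : (1:ℝ) ≤ n - 1 := by
      have : (2:ℝ) ≤ n := by exact_mod_cast hn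
      linarith
    have h5 := mul_le_mul_of_nonneg_right (g_main (t := t) hs (sq_nonneg ‖η‖) hn') (sq_nonneg ‖φ ξ‖)
    have h6 := g_bound (t := t) hs (sq_nonneg ‖η‖)
    rw [Real.sqrt_sq (norm_nonneg _), ← hg] at h6
    have h7 : -(‖φ ξ‖ * (‖fderiv ℝ φ ξ‖ * ‖η‖)) ≤ inner ℝ (φ ξ) (fderiv ℝ φ ξ η) := by
      refine (neg_le_neg ?_).trans (neg_abs_le _)
      refine (abs_real_inner_le_norm _ _).trans ?_
      gcongr
      exact ContinuousLinearMap.le_opNorm _ _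
    have h8 := mul_le_mul_of_nonneg_left h7 hg0
    have h9 := mul_le_mul_of_nonneg_right h6 (by positivity : 0 ≤ ‖φ ξ‖ * ‖fderiv ℝ φ ξ‖)
    rw [← hg] at h5
    nlinarith
  have h4 := integral_mono (((WW_int he hs φ).const_mul (2 * Real.pi)).sub (h2.const_mul (2 * Real.pi))) h1 h3
  rw [h0] at h4
  simp only [Pi.sub_apply] at h4
  rw [integral_sub ((WW_int he hs φ).const_mul (2 * Real.pi)) (h2.const_mul (2 * Real.pi)),
    integral_const_mul, integral_const_mul] at h4
  nlinarith

end CGO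

namespace CGO
open scoped FourierTransform SchwartzMap ENNReal ContDiff

lemma KKeta_meas {n : ℕ} (e a : EE n) (s τ : ℝ) : Measurable fun ξ : EE n => KK s ‖eta e a ξ‖ τ := by
  have h : Measurable fun ξ : EE n => ((‖eta e a ξ‖, τ) : ℝ × ℝ) :=
    (eta_cont e a).norm.measurable.prodMk measurable_const
  exact (KK_measurable s).comp h

lemma sq_int {n : ℕ} {F : Type*} [NormedAddCommGroup F] [NormedSpace ℝ F] (φ : 𝓢(EE n, F)) :
    Integrable fun ξ => ‖φ ξ‖ ^ 2 := by
  have c6 : Continuous fun ξ => φ ξ := φ.continuous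
  refine int_poly φ φ (by fun_prop) 1 0 fun ξ => ?_
  rw [abs_of_nonneg (sq_nonneg _)]; simp [sq]

lemma KK2_int {n : ℕ} (e a : EE n) {s : ℝ} (hs : 0 < s) (τ : ℝ) (φ : 𝓢(EE n, ℂ)) :
    Integrable fun ξ => KK s ‖eta e a ξ‖ τ ^ 2 * ‖φ ξ‖ ^ 2 := by
  refine (sq_int φ).bdd_mul (c := (4 / s) ^ 2) ((KKeta_meas e a s τ).pow_const 2).aestronglyMeasurable ?_
  refine Filter.Eventually.of_forall fun ξ => ?_
  rw [norm_pow]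
  gcongr
  exact KK_bound' hs (norm_nonneg _) τ

lemma mul_fd_int {n : ℕ} (φ : 𝓢(EE n, ℂ)) : Integrable fun ξ => ‖φ ξ‖ * ‖fderiv ℝ φ ξ‖ := by
  have c4 : Continuous fun ξ => fderiv ℝ φ ξ := (SchwartzMap.fderivCLM ℝ (EE n) ℂ φ).continuous
  have c6 : Continuous fun ξ => φ ξ := φ.continuous
  refine int_poly φ (SchwartzMap.fderivCLM ℝ (EE n) ℂ φ) (by fun_prop) 1 0 fun ξ => ?_
  rw [abs_of_nonneg (by positivity)]; simp [SchwartzMap.fderivCLM_apply]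

/-- norm used on the Fourier side -/
noncomputable def NN {n : ℕ} (φ : 𝓢(EE n, ℂ)) : ℝ :=
  (∫ ξ, ‖φ ξ‖ ^ 2) + ∫ ξ, ‖φ ξ‖ * ‖fderiv ℝ φ ξ‖

lemma KK_L2 {n : ℕ} (hn : 2 ≤ n) {e a : EE n} (he : ‖e‖ = 1) (hea : inner ℝ e a = 0) {s : ℝ}
    (hs : 1 ≤ s) (τ : ℝ) (φ : 𝓢(EE n, ℂ)) :
    ∫ ξ, KK s ‖eta e a ξ‖ τ ^ 2 * ‖φ ξ‖ ^ 2 ≤ 1600 / (s ^ 2 * (1 + |τ|)) * NN φ := by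
  have hs0 : 0 < s := by linarith
  have hA : 0 ≤ ∫ ξ, ‖φ ξ‖ ^ 2 := integral_nonneg fun ξ => by positivity
  have hB : 0 ≤ ∫ ξ, ‖φ ξ‖ * ‖fderiv ℝ φ ξ‖ := integral_nonneg fun ξ => by positivity
  by_cases hτ : |τ| ≤ 1
  · have h1 : ∫ ξ, KK s ‖eta e a ξ‖ τ ^ 2 * ‖φ ξ‖ ^ 2 ≤ ∫ ξ, (4 / s) ^ 2 * ‖φ ξ‖ ^ 2 := by
      refine integral_mono (KK2_int e a hs0 τ φ) ((sq_int φ).const_mul _) fun ξ => ?_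
      have := KK_bound' hs0 (norm_nonneg (eta e a ξ)) τ
      have h2 : KK s ‖eta e a ξ‖ τ ^ 2 ≤ (4 / s) ^ 2 := by
        rw [← sq_abs]; gcongr
      simp only
      gcongr
    rw [integral_const_mul] at h1
    refine h1.trans ?_
    unfold NN
    have h3 : (4 / s) ^ 2 ≤ 1600 / (s ^ 2 * (1 + |τ|)) := by
      rw [div_pow, div_le_div_iff₀ (by positivity) (by positivity)]
      nlinarith [abs_nonneg τ, sq_nonneg s]
    calc _ ≤ 1600 / (s ^ 2 * (1 + |τ|)) * ∫ ξ, ‖φ ξ‖ ^ 2 := by gcongr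
      _ ≤ _ := by gcongr; linarith
  · push Not at hτ
    have ht : 0 < |τ| := by linarith
    have h1 : ∫ ξ, KK s ‖eta e a ξ‖ τ ^ 2 * ‖φ ξ‖ ^ 2 ≤
        ∫ ξ, (32 / (s ^ 2 * |τ|) * ‖φ ξ‖ ^ 2 + 800 / (s ^ 2 * |τ|) * (|τ| * WW s |τ| (‖eta e a ξ‖ ^ 2) * ‖φ ξ‖ ^ 2)) := by
      refine integral_mono (KK2_int e a hs0 τ φ) (((sq_int φ).const_mul _).add ((WW_int he hs0 φ).const_mul _)) fun ξ => ?_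
      have h2 := KK_sq_bound hs0 (norm_nonneg (eta e a ξ)) τ
      have h3 := exp_le_WW hs ht (norm_nonneg (eta e a ξ))
      simp only
      calc _ ≤ 16 / s ^ 2 * (2 / |τ| + 50 * WW s |τ| (‖eta e a ξ‖ ^ 2)) * ‖φ ξ‖ ^ 2 := by
            gcongr
            refine h2.trans ?_
            gcongr
        _ = _ := by field_simp; ring
    rw [integral_add ((sq_int φ).const_mul _) ((WW_int he hs0 φ).const_mul _), integral_const_mul, integral_const_mul] at h1
    have h4 := trace hn he hea hs0 ht φ
    have h5 : 800 / (s ^ 2 * |τ|) ≤ 1600 / (s ^ 2 * (1 + |τ|)) := by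
      rw [div_le_div_iff₀ (by positivity) (by positivity)]
      have := mul_le_mul_of_nonneg_left hτ.le (sq_nonneg s)
      nlinarith
    have h6 : 32 / (s ^ 2 * |τ|) ≤ 800 / (s ^ 2 * |τ|) := by gcongr; norm_num
    refine h1.trans ?_
    unfold NN
    rw [mul_add]
    exact add_le_add (mul_le_mul_of_nonneg_right (h6.trans h5) hA) (mul_le_mul h5 h4 (integral_nonneg fun ξ => mul_nonneg (mul_nonneg ht.le (WW_nonneg hs0 (sq_nonneg _))) (sq_nonneg _)) (by positivity))

lemma fd_sq_int {n : ℕ} (φ : 𝓢(EE n, ℂ)) : Integrable fun ξ => ‖fderiv ℝ φ ξ‖ ^ 2 := by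
  simpa [SchwartzMap.fderivCLM_apply] using sq_int (SchwartzMap.fderivCLM ℝ (EE n) ℂ φ)

lemma NN_le {n : ℕ} (φ : 𝓢(EE n, ℂ)) : NN φ ≤ 2 * (∫ ξ, ‖φ ξ‖ ^ 2) + ∫ ξ, ‖fderiv ℝ φ ξ‖ ^ 2 := by
  unfold NN
  have h : ∫ ξ, ‖φ ξ‖ * ‖fderiv ℝ φ ξ‖ ≤ ∫ ξ, (‖φ ξ‖ ^ 2 + ‖fderiv ℝ φ ξ‖ ^ 2) :=
    integral_mono (mul_fd_int φ) ((sq_int φ).add (fd_sq_int φ)) fun ξ => by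
      simp only; nlinarith [sq_nonneg (‖φ ξ‖ - ‖fderiv ℝ φ ξ‖), sq_nonneg (‖φ ξ‖), sq_nonneg (‖fderiv ℝ φ ξ‖)]
  rw [integral_add (sq_int φ) (fd_sq_int φ)] at h
  linarith

end CGO

namespace CGO
open scoped FourierTransform SchwartzMap ENNReal ContDiff LineDeriv

/-- basis vector -/
noncomputable abbrev bb {n : ℕ} (j : Fin n) : EE n := EuclideanSpace.single j (1:ℝ)

lemma ftg_inner {n : ℕ} (m : EE n) : (fun x : EE n => inner ℝ x m).HasTemperateGrowth :=
  ((innerSL ℝ).flip m).hasTemperateGrowth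

/-- Fourier transform -/
noncomputable abbrev FF {n : ℕ} (f : 𝓢(EE n, ℂ)) : 𝓢(EE n, ℂ) := 𝓕 f

lemma fourier_ld {n : ℕ} (f : 𝓢(EE n, ℂ)) (m ξ : EE n) :
    (FF (∂_{m} f)) ξ = 2 * Real.pi * Complex.I * (inner ℝ ξ m : ℝ) * (FF f) ξ := by
  rw [FF, SchwartzMap.fourier_lineDerivOp_eq, smul_apply, SchwartzMap.smulLeftCLM_apply_apply (ftg_inner m)]
  simp only [smul_eq_mul, Complex.real_smul]
  ring

/-- multiplication by a coordinate -/
noncomputable def mm {n : ℕ} (m : EE n) (f : 𝓢(EE n, ℂ)) : 𝓢(EE n, ℂ) :=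
  SchwartzMap.smulLeftCLM ℂ (fun x : EE n => inner ℝ x m) f

lemma mm_apply {n : ℕ} (m : EE n) (f : 𝓢(EE n, ℂ)) (x : EE n) : mm m f x = (inner ℝ x m : ℝ) * f x := by
  rw [mm, SchwartzMap.smulLeftCLM_apply_apply (ftg_inner m), Complex.real_smul]

lemma ld_fourier {n : ℕ} (f : 𝓢(EE n, ℂ)) (m ξ : EE n) :
    fderiv ℝ (FF f) ξ m = -(2 * Real.pi * Complex.I) * (FF (mm m f)) ξ := by
  rw [FF, ← SchwartzMap.lineDerivOp_apply_eq_fderiv, SchwartzMap.lineDerivOp_fourier_eq,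
    FourierTransform.fourier_smul]
  rfl

/-- exponential kernel -/
noncomputable def ex {n : ℕ} (ξ x : EE n) : ℂ := Complex.exp ((2 * Real.pi * inner ℝ ξ x : ℝ) * Complex.I)

lemma ex_norm {n : ℕ} (ξ x : EE n) : ‖ex ξ x‖ = 1 := Complex.norm_exp_ofReal_mul_I _

@[fun_prop]
lemma ex_cont {n : ℕ} : Continuous fun p : EE n × EE n => ex p.1 p.2 := by unfold ex; fun_prop

/-- the multiplier operator -/
noncomputable def TT {n : ℕ} (e a : EE n) (s τ : ℝ) (φ : EE n → ℂ) (x : EE n) : ℂ :=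
  ∫ ξ, ex ξ x * ((KK s ‖eta e a ξ‖ τ : ℂ) * φ ξ)

lemma TT_eq {n : ℕ} (e a : EE n) (s τ : ℝ) (φ : EE n → ℂ) :
    TT e a s τ φ = 𝓕⁻ (fun ξ => (KK s ‖eta e a ξ‖ τ : ℂ) * φ ξ) := by
  ext x
  rw [Real.fourierInv_eq']
  rfl

lemma KKeta_measC {n : ℕ} (e a : EE n) (s τ : ℝ) : Measurable fun ξ : EE n => (KK s ‖eta e a ξ‖ τ : ℂ) :=
  Complex.measurable_ofReal.comp (KKeta_meas e a s τ)

lemma KK_normC {n : ℕ} (e a : EE n) {s : ℝ} (hs : 0 < s) (τ : ℝ) (ξ : EE n) :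
    ‖(KK s ‖eta e a ξ‖ τ : ℂ)‖ ≤ 4 / s := by
  rw [Complex.norm_real]; exact KK_bound' hs (norm_nonneg _) τ

lemma KKφ_int {n : ℕ} (e a : EE n) {s : ℝ} (hs : 0 < s) (τ : ℝ) {φ : EE n → ℂ} (hφ : Integrable φ) :
    Integrable fun ξ => (KK s ‖eta e a ξ‖ τ : ℂ) * φ ξ :=
  hφ.bdd_mul (c := 4 / s) (KKeta_measC e a s τ).aestronglyMeasurable
    (Filter.Eventually.of_forall fun ξ => KK_normC e a hs τ ξ)

lemma exKKφ_int {n : ℕ} (e a : EE n) {s : ℝ} (hs : 0 < s) (τ : ℝ) {φ : EE n → ℂ} (hφ : Integrable φ) (x : EE n) :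
    Integrable fun ξ => ex ξ x * ((KK s ‖eta e a ξ‖ τ : ℂ) * φ ξ) :=
  (KKφ_int e a hs τ hφ).bdd_mul (c := 1) (by fun_prop : Continuous fun ξ : EE n => ex ξ x).aestronglyMeasurable
    (Filter.Eventually.of_forall fun ξ => (ex_norm ξ x).le)

lemma TT_bound {n : ℕ} (e a : EE n) {s : ℝ} (hs : 0 < s) (τ : ℝ) {φ : EE n → ℂ} (hφ : Integrable φ) (x : EE n) :
    ‖TT e a s τ φ x‖ ≤ 4 / s * ∫ ξ, ‖φ ξ‖ := by
  unfold TT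
  rw [← integral_const_mul]
  refine norm_integral_le_of_norm_le (hφ.norm.const_mul _) (Filter.Eventually.of_forall fun ξ => ?_)
  rw [norm_mul, norm_mul, ex_norm, one_mul]
  gcongr
  exact KK_normC e a hs τ ξ

lemma TT_meas {n : ℕ} (e a : EE n) (s : ℝ) {φ : EE n → ℂ} (hφ : Measurable φ) :
    StronglyMeasurable fun p : EE n × ℝ => TT e a s p.2 φ (p.1 - p.2 • e) := by
  unfold TT
  refine StronglyMeasurable.integral_prod_right' (f := fun p : (EE n × ℝ) × EE n =>
    ex p.2 (p.1.1 - p.1.2 • e) * ((KK s ‖eta e a p.2‖ p.1.2 : ℂ) * φ p.2)) ?_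
  refine Measurable.stronglyMeasurable ?_
  have h1 : Measurable fun p : (EE n × ℝ) × EE n => ex p.2 (p.1.1 - p.1.2 • e) :=
    (by fun_prop : Continuous fun p : (EE n × ℝ) × EE n => ex p.2 (p.1.1 - p.1.2 • e)).measurable
  have h2 : Measurable fun p : (EE n × ℝ) × EE n => (KK s ‖eta e a p.2‖ p.1.2 : ℂ) := by
    refine Complex.measurable_ofReal.comp ((KK_measurable s).comp (?_ : Measurable fun p : (EE n × ℝ) × EE n => ((‖eta e a p.2‖, p.1.2) : ℝ × ℝ)))
    exact (by fun_prop : Continuous fun p : (EE n × ℝ) × EE n => ((‖eta e a p.2‖, p.1.2) : ℝ × ℝ)).measurable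
  exact h1.mul (h2.mul (hφ.comp measurable_snd))

lemma sint {n : ℕ} (φ : 𝓢(EE n, ℂ)) : Integrable (fun ξ => φ ξ) (volume : Measure (EE n)) := φ.integrable

lemma TT_mm {n : ℕ} {e a : EE n} (he : ‖e‖ = 1) {s : ℝ} (hs : 0 < s) (τ : ℝ)
    (f : 𝓢(EE n, ℂ)) (x : EE n) :
    TT e a s τ (FF (mm e f)) x = (inner ℝ x e : ℝ) * TT e a s τ (FF f) x := by
  set φ : 𝓢(EE n, ℂ) := FF f with hφ
  have hconst : ∀ ξ (t : ℝ), KK s ‖eta e a (ξ + t • e)‖ τ = KK s ‖eta e a ξ‖ τ := fun ξ t => by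
    rw [eta_line, real_inner_self_eq_norm_sq, he]; simp
  have I1 : Integrable fun ξ => ex ξ x * ((KK s ‖eta e a ξ‖ τ : ℂ) * φ ξ) := exKKφ_int e a hs τ (sint φ) x
  have I2 : Integrable fun ξ => ex ξ x * ((KK s ‖eta e a ξ‖ τ : ℂ) * fderiv ℝ φ ξ e) :=
    exKKφ_int e a hs τ (sint (∂_{e} φ)) x
  have key := integral_bilinear_hasLineDerivAt_right_eq_neg_left_of_integrable (μ := (volume : Measure (EE n)))
    (f := fun ξ => ex ξ x * (KK s ‖eta e a ξ‖ τ : ℂ))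
    (f' := fun ξ => (2 * Real.pi * inner ℝ e x : ℝ) * Complex.I * (ex ξ x * (KK s ‖eta e a ξ‖ τ : ℂ)))
    (g := φ) (g' := fun ξ => fderiv ℝ φ ξ e) (v := e) (B := ContinuousLinearMap.mul ℝ ℂ)
    (by
      simp only [ContinuousLinearMap.mul_apply']
      refine (I1.const_mul ((2 * Real.pi * inner ℝ e x : ℝ) * Complex.I)).congr (Filter.Eventually.of_forall fun ξ => ?_)
      simp only; ring)
    (by
      simp only [ContinuousLinearMap.mul_apply']
      refine I2.congr (Filter.Eventually.of_forall fun ξ => ?_)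
      simp only; ring)
    (by
      simp only [ContinuousLinearMap.mul_apply']
      refine I1.congr (Filter.Eventually.of_forall fun ξ => ?_)
      simp only; ring)
    (fun ξ _ => by
      unfold HasLineDerivAt
      simp only [hconst]
      have h1 : HasDerivAt (fun t : ℝ => ((2 * Real.pi * inner ℝ (ξ + t • e) x : ℝ) : ℂ) * Complex.I)
          ((2 * Real.pi * inner ℝ e x : ℝ) * Complex.I) 0 := by
        have h2 : HasDerivAt (fun t : ℝ => 2 * Real.pi * inner ℝ (ξ + t • e) x) (2 * Real.pi * inner ℝ e x) 0 := by
          simp_rw [inner_add_left, real_inner_smul_left]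
          have := (((hasDerivAt_id (0:ℝ)).mul_const (inner ℝ e x)).const_add (inner ℝ ξ x)).const_mul (2 * Real.pi)
          simpa using this
        exact h2.ofReal_comp.mul_const _
      have h3 := h1.cexp.mul_const (KK s ‖eta e a ξ‖ τ : ℂ)
      refine h3.congr_deriv ?_
      simp only [zero_smul, add_zero, ex]
      ring)
    (fun ξ _ => (φ.differentiableAt (x := ξ)).hasFDerivAt.hasLineDerivAt e)
  simp only [ContinuousLinearMap.mul_apply'] at key
  have k1 : ∫ ξ, ex ξ x * (KK s ‖eta e a ξ‖ τ : ℂ) * fderiv ℝ φ ξ e = -(2 * Real.pi * Complex.I) * TT e a s τ (FF (mm e f)) x := by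
    unfold TT
    rw [← integral_const_mul]
    refine integral_congr_ae (Filter.Eventually.of_forall fun ξ => ?_)
    simp only
    rw [hφ, ld_fourier]; ring
  have k2 : ∫ ξ, (2 * Real.pi * inner ℝ e x : ℝ) * Complex.I * (ex ξ x * (KK s ‖eta e a ξ‖ τ : ℂ)) * φ ξ =
      (2 * Real.pi * inner ℝ e x : ℝ) * Complex.I * TT e a s τ φ x := by
    unfold TT
    rw [← integral_const_mul]
    refine integral_congr_ae (Filter.Eventually.of_forall fun ξ => ?_)
    simp only
    ring
  rw [k1, k2] at key
  have hne : (2 * Real.pi * Complex.I : ℂ) ≠ 0 := Complex.two_pi_I_ne_zero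
  apply mul_left_cancel₀ hne
  rw [real_inner_comm]
  push_cast at key ⊢
  linear_combination -key

/-- weight multiplication `(1 + x₁²) f` -/
noncomputable def MM {n : ℕ} (e : EE n) (f : 𝓢(EE n, ℂ)) : 𝓢(EE n, ℂ) := f + mm e (mm e f)

lemma MM_apply {n : ℕ} (e : EE n) (f : 𝓢(EE n, ℂ)) (x : EE n) : MM e f x = (1 + (inner ℝ x e : ℝ) ^ 2 : ℝ) * f x := by
  rw [MM, add_apply, mm_apply, mm_apply]; push_cast; ring

lemma TT_add {n : ℕ} (e a : EE n) {s : ℝ} (hs : 0 < s) (τ : ℝ) {φ ψ : EE n → ℂ} (hφ : Integrable φ) (hψ : Integrable ψ)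
    (x : EE n) : TT e a s τ (fun ξ => φ ξ + ψ ξ) x = TT e a s τ φ x + TT e a s τ ψ x := by
  unfold TT
  rw [← integral_add (exKKφ_int e a hs τ hφ x) (exKKφ_int e a hs τ hψ x)]
  congr 1; ext ξ; ring

lemma TT_smul {n : ℕ} (e a : EE n) (s : ℝ) (τ : ℝ) (c : ℂ) (φ : EE n → ℂ)
    (x : EE n) : TT e a s τ (fun ξ => c * φ ξ) x = c * TT e a s τ φ x := by
  unfold TT
  rw [← integral_const_mul]
  congr 1; ext ξ; ring

lemma TT_MM {n : ℕ} {e a : EE n} (he : ‖e‖ = 1) {s : ℝ} (hs : 0 < s) (τ : ℝ)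
    (f : 𝓢(EE n, ℂ)) (x : EE n) :
    TT e a s τ (FF (MM e f)) x = (1 + (inner ℝ x e : ℝ) ^ 2 : ℝ) * TT e a s τ (FF f) x := by
  have : ⇑(FF (MM e f)) = fun ξ => (FF f) ξ + (FF (mm e (mm e f))) ξ := by
    rw [MM, FF, FourierTransform.fourier_add]; rfl
  rw [this, TT_add e a hs τ (sint (FF f)) (sint (FF (mm e (mm e f)))), TT_mm he hs, TT_mm he hs]
  push_cast; ring

lemma TT_decay {n : ℕ} {e a : EE n} (he : ‖e‖ = 1) {s : ℝ} (hs : 0 < s) (τ : ℝ)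
    (f : 𝓢(EE n, ℂ)) (x : EE n) :
    ‖TT e a s τ (FF f) x‖ ≤ (4 / s * ∫ ξ, ‖(FF (MM e f)) ξ‖) * (1 + (inner ℝ x e : ℝ) ^ 2)⁻¹ := by
  have h := TT_bound e a hs τ (sint (FF (MM e f))) x
  rw [TT_MM he hs, norm_mul, Complex.norm_real, Real.norm_of_nonneg (by positivity)] at h
  rw [← div_eq_mul_inv, le_div_iff₀ (by positivity)]
  linarith

end CGO

namespace CGO
open scoped FourierTransform SchwartzMap ENNReal ContDiff LineDeriv

/-- partial derivative -/
noncomputable abbrev pd {n : ℕ} (j : Fin n) (f : 𝓢(EE n, ℂ)) : 𝓢(EE n, ℂ) := ∂_{(bb j : EE n)} f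

/-- assemble a differential from partial derivatives -/
noncomputable def DD {n : ℕ} : (Fin n → ℂ) →L[ℝ] (EE n →L[ℝ] ℂ) :=
  ∑ j, (ContinuousLinearMap.smulRightL ℝ (EE n) ℂ (EuclideanSpace.proj j)).comp (ContinuousLinearMap.proj j)

lemma DD_apply {n : ℕ} (z : Fin n → ℂ) (v : EE n) : DD z v = ∑ j, (v j : ℂ) * z j := by
  simp [DD]

lemma DD_norm {n : ℕ} (z : Fin n → ℂ) : ‖DD z‖ ≤ ∑ j, ‖z j‖ := by
  refine ContinuousLinearMap.opNorm_le_bound _ (by positivity) fun v => ?_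
  rw [DD_apply, Finset.sum_mul]
  refine (norm_sum_le _ _).trans (Finset.sum_le_sum fun j _ => ?_)
  rw [norm_mul, Complex.norm_real, mul_comm]
  gcongr
  exact PiLp.norm_apply_le v j

lemma DD_bb {n : ℕ} (z : Fin n → ℂ) (j : Fin n) : DD z (bb j) = z j := by
  rw [DD_apply, Finset.sum_eq_single j]
  · simp
  · intro i _ hi; simp [hi]
  · simp

lemma DD_integral {n : ℕ} {α : Type*} [MeasurableSpace α] {μ : Measure α} (z : α → Fin n → ℂ)
    (hz : ∀ j, Integrable (fun t => z t j) μ) : ∫ t, DD (z t) ∂μ = DD fun j => ∫ t, z t j ∂μ := by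
  have h1 : Integrable z μ := Integrable.of_eval hz
  rw [ContinuousLinearMap.integral_comp_comm _ h1]
  congr 1
  ext j
  exact (ContinuousLinearMap.integral_comp_comm (ContinuousLinearMap.proj (R := ℝ) (φ := fun _ : Fin n => ℂ) j) h1).symm

lemma ex_fderiv {n : ℕ} (ξ x : EE n) :
    HasFDerivAt (fun x => ex ξ x) (DD fun j => ex ξ x * (2 * Real.pi * Complex.I * (inner ℝ ξ (bb j) : ℝ))) x := by
  have h1 : HasFDerivAt (fun x : EE n => inner ℝ ξ x) (innerSL ℝ ξ) x := (innerSL ℝ ξ).hasFDerivAt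
  have h2 : HasFDerivAt (fun x : EE n => 2 * Real.pi * inner ℝ ξ x) ((2 * Real.pi) • innerSL ℝ ξ) x := h1.const_mul _
  have h3 : HasFDerivAt (fun x : EE n => ((2 * Real.pi * inner ℝ ξ x : ℝ) : ℂ)) (Complex.ofRealCLM.comp ((2 * Real.pi) • innerSL ℝ ξ)) x :=
    Complex.ofRealCLM.hasFDerivAt.comp x h2
  have h4 := (h3.mul_const Complex.I).cexp
  refine h4.congr_fderiv ?_
  ext v
  rw [DD_apply]
  simp only [smul_apply, ContinuousLinearMap.comp_apply, Complex.ofRealCLM_apply, innerSL_apply_apply]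
  have : inner ℝ ξ v = ∑ j, v j * inner ℝ ξ (bb j) := by
    simp [PiLp.inner_apply]
  rw [this]
  simp only [smul_eq_mul, ex]
  push_cast
  rw [Finset.mul_sum, Finset.mul_sum, Finset.mul_sum]
  refine Finset.sum_congr rfl fun j _ => ?_
  ring

lemma TT_fderiv {n : ℕ} (e a : EE n) {s : ℝ} (hs : 0 < s) (τ : ℝ) (f : 𝓢(EE n, ℂ)) (x : EE n) :
    HasFDerivAt (TT e a s τ (FF f)) (DD fun j => TT e a s τ (FF (pd j f)) x) x := by
  have hI : ∀ j, Integrable fun ξ => ex ξ x * ((KK s ‖eta e a ξ‖ τ : ℂ) * FF (pd j f) ξ) := fun j =>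
    exKKφ_int e a hs τ (sint _) x
  have e1 := DD_integral (μ := (volume : Measure (EE n))) (fun ξ j => ex ξ x * ((KK s ‖eta e a ξ‖ τ : ℂ) * FF (pd j f) ξ)) hI
  have e2 : (DD fun j => TT e a s τ (FF (pd j f)) x) = ∫ ξ, DD (fun j => ex ξ x * ((KK s ‖eta e a ξ‖ τ : ℂ) * FF (pd j f) ξ)) := by
    rw [e1]; rfl
  rw [e2]
  refine hasFDerivAt_integral_of_dominated_of_fderiv_le (s := Set.univ)
    (F := fun x ξ => ex ξ x * ((KK s ‖eta e a ξ‖ τ : ℂ) * FF f ξ))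
    (F' := fun x ξ => DD (fun j => ex ξ x * ((KK s ‖eta e a ξ‖ τ : ℂ) * FF (pd j f) ξ)))
    (bound := fun ξ => ∑ j, 4 / s * ‖FF (pd j f) ξ‖) Filter.univ_mem
    (Filter.Eventually.of_forall fun x => (exKKφ_int e a hs τ (sint (FF f)) x).aestronglyMeasurable)
    (exKKφ_int e a hs τ (sint (FF f)) x)
    (DD.continuous.comp_aestronglyMeasurable (Integrable.of_eval hI).aestronglyMeasurable)
    (Filter.Eventually.of_forall fun ξ x _ => ?_)
    (integrable_finsetSum _ fun j _ => ((sint (FF (pd j f))).norm.const_mul _))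
    (Filter.Eventually.of_forall fun ξ x _ => ?_)
  · refine (DD_norm _).trans (Finset.sum_le_sum fun j _ => ?_)
    rw [norm_mul, norm_mul, ex_norm, one_mul]
    gcongr
    exact KK_normC e a hs τ ξ
  · refine ((ex_fderiv ξ x).mul_const _).congr_fderiv ?_
    ext v
    rw [smul_apply, DD_apply, DD_apply, Finset.smul_sum]
    refine Finset.sum_congr rfl fun j _ => ?_
    rw [fourier_ld, smul_eq_mul]
    ring

/-- The solution operator. -/
noncomputable def GG {n : ℕ} (e a : EE n) (s : ℝ) (f : 𝓢(EE n, ℂ)) (x : EE n) : ℂ :=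
  ∫ τ : ℝ, TT e a s τ (FF f) (x - τ • e)

lemma inner_shift {n : ℕ} {e : EE n} (he : ‖e‖ = 1) (x : EE n) (τ : ℝ) :
    inner ℝ (x - τ • e) e = inner ℝ x e - τ := by
  rw [inner_sub_left, real_inner_smul_left, real_inner_self_eq_norm_sq, he]; ring

lemma TT_decay' {n : ℕ} {e a : EE n} (he : ‖e‖ = 1) {s : ℝ} (hs : 0 < s) (τ : ℝ)
    (f : 𝓢(EE n, ℂ)) (x : EE n) :
    ‖TT e a s τ (FF f) (x - τ • e)‖ ≤ (4 / s * ∫ ξ, ‖(FF (MM e f)) ξ‖) * (1 + (inner ℝ x e - τ) ^ 2)⁻¹ := by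
  have := TT_decay (a := a) he hs τ f (x - τ • e)
  rwa [inner_shift he] at this

lemma dec_int (c : ℝ) : Integrable fun τ : ℝ => (1 + (c - τ) ^ 2)⁻¹ :=
  integrable_inv_one_add_sq.comp_sub_left c

lemma TTx_meas {n : ℕ} (e a : EE n) (s : ℝ) (f : 𝓢(EE n, ℂ)) (x : EE n) :
    StronglyMeasurable fun τ : ℝ => TT e a s τ (FF f) (x - τ • e) :=
  StronglyMeasurable.comp_measurable (g := fun τ : ℝ => ((x, τ) : EE n × ℝ))
    (TT_meas e a s (φ := fun ξ => FF f ξ) (FF f).continuous.measurable) measurable_prodMk_left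

lemma GG_int {n : ℕ} {e a : EE n} (he : ‖e‖ = 1) {s : ℝ} (hs : 0 < s) (f : 𝓢(EE n, ℂ)) (x : EE n) :
    Integrable fun τ : ℝ => TT e a s τ (FF f) (x - τ • e) :=
  ((dec_int (inner ℝ x e)).const_mul _).mono' (TTx_meas e a s f x).aestronglyMeasurable
    (Filter.Eventually.of_forall fun τ => TT_decay' he hs τ f x)

lemma GG_meas {n : ℕ} (e a : EE n) (s : ℝ) (f : 𝓢(EE n, ℂ)) : StronglyMeasurable (GG e a s f) :=
  StronglyMeasurable.integral_prod_right' (f := fun p : EE n × ℝ => TT e a s p.2 (FF f) (p.1 - p.2 • e))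
    (TT_meas e a s (FF f).continuous.measurable)

lemma GG_fderiv {n : ℕ} {e a : EE n} (he : ‖e‖ = 1) {s : ℝ} (hs : 0 < s) (f : 𝓢(EE n, ℂ)) (x : EE n) :
    HasFDerivAt (GG e a s f) (DD fun j => GG e a s (pd j f) x) x := by
  have hI : ∀ j, Integrable fun τ : ℝ => TT e a s τ (FF (pd j f)) (x - τ • e) := fun j => GG_int he hs _ x
  have e1 := DD_integral (μ := (volume : Measure ℝ)) (fun (τ : ℝ) j => TT e a s τ (FF (pd j f)) (x - τ • e)) hI
  have e2 : (DD fun j => GG e a s (pd j f) x) = ∫ τ : ℝ, DD (fun j => TT e a s τ (FF (pd j f)) (x - τ • e)) := by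
    rw [e1]; rfl
  rw [e2]
  refine hasFDerivAt_integral_of_dominated_of_fderiv_le (s := Metric.ball x 1)
    (F := fun x τ => TT e a s τ (FF f) (x - τ • e))
    (F' := fun x τ => DD (fun j => TT e a s τ (FF (pd j f)) (x - τ • e)))
    (bound := fun τ => ∑ j, (4 / s * ∫ ξ, ‖(FF (MM e (pd j f))) ξ‖) * (3 * (1 + (inner ℝ x e - τ) ^ 2)⁻¹))
    (Metric.ball_mem_nhds x one_pos)
    (Filter.Eventually.of_forall fun x => (GG_int he hs f x).aestronglyMeasurable)
    (GG_int he hs f x)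
    (DD.continuous.comp_aestronglyMeasurable (Integrable.of_eval hI).aestronglyMeasurable)
    (Filter.Eventually.of_forall fun τ y hy => ?_)
    (integrable_finsetSum _ fun j _ => (((dec_int _).const_mul _).const_mul _))
    (Filter.Eventually.of_forall fun τ y _ => ?_)
  · refine (DD_norm _).trans (Finset.sum_le_sum fun j _ => (TT_decay' he hs τ _ y).trans ?_)
    have hA : 0 ≤ ∫ ξ, ‖(FF (MM e (pd j f))) ξ‖ := integral_nonneg fun ξ => by positivity
    gcongr
    have h1 : |inner ℝ y e - inner ℝ x e| ≤ 1 := by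
      rw [← inner_sub_left]
      refine (abs_real_inner_le_norm _ _).trans ?_
      rw [he, mul_one, ← dist_eq_norm]
      exact (Metric.mem_ball.1 hy).le
    rw [← div_eq_mul_inv, inv_eq_one_div, div_le_div_iff₀ (by positivity) (by positivity)]
    have h2 : (inner ℝ y e - inner ℝ x e) ^ 2 ≤ 1 := by rw [← sq_abs]; exact pow_le_one₀ (abs_nonneg _) h1
    nlinarith [sq_nonneg ((inner ℝ y e - τ) + (inner ℝ y e - inner ℝ x e)), sq_nonneg (inner ℝ y e - τ)]
  · exact (TT_fderiv e a hs τ f (y - τ • e)).comp y ((hasFDerivAt_id y).sub_const (τ • e))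

lemma GG_fderiv_apply {n : ℕ} {e a : EE n} (he : ‖e‖ = 1) {s : ℝ} (hs : 0 < s) (f : 𝓢(EE n, ℂ)) (x : EE n) (j : Fin n) :
    fderiv ℝ (GG e a s f) x (bb j) = GG e a s (pd j f) x := by
  rw [(GG_fderiv he hs f x).fderiv, DD_bb]

lemma GG_contDiff_nat {n : ℕ} {e a : EE n} (he : ‖e‖ = 1) {s : ℝ} (hs : 0 < s) (k : ℕ) :
    ∀ f : 𝓢(EE n, ℂ), ContDiff ℝ k (GG e a s f) := by
  induction k with
  | zero =>
    intro f
    rw [Nat.cast_zero, contDiff_zero, continuous_iff_continuousAt]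
    exact fun x => (GG_fderiv he hs f x).continuousAt
  | succ k ih =>
    intro f
    rw [Nat.cast_succ, contDiff_succ_iff_fderiv]
    refine ⟨fun x => (GG_fderiv he hs f x).differentiableAt, by simp, ?_⟩
    have : fderiv ℝ (GG e a s f) = fun x => DD fun j => GG e a s (pd j f) x := by
      ext1 x; exact (GG_fderiv he hs f x).fderiv
    rw [this]
    exact DD.contDiff.comp (contDiff_pi.2 fun j => ih _)

lemma GG_contDiff {n : ℕ} {e a : EE n} (he : ‖e‖ = 1) {s : ℝ} (hs : 0 < s) (f : 𝓢(EE n, ℂ)) :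
    ContDiff ℝ ∞ (GG e a s f) := contDiff_infty.2 fun k => GG_contDiff_nat he hs k f

lemma GG_add {n : ℕ} {e a : EE n} (he : ‖e‖ = 1) {s : ℝ} (hs : 0 < s) (f g : 𝓢(EE n, ℂ)) (x : EE n) :
    GG e a s (f + g) x = GG e a s f x + GG e a s g x := by
  unfold GG
  rw [← integral_add (GG_int he hs f x) (GG_int he hs g x)]
  congr 1; ext τ
  have : ⇑(FF (f + g)) = fun ξ => (FF f) ξ + (FF g) ξ := by
    rw [FF, FourierTransform.fourier_add]; rfl
  rw [this, TT_add e a hs τ (sint (FF f)) (sint (FF g))]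

lemma GG_smul {n : ℕ} (e a : EE n) (s : ℝ) (c : ℂ) (f : 𝓢(EE n, ℂ)) (x : EE n) :
    GG e a s (c • f) x = c * GG e a s f x := by
  unfold GG
  rw [← integral_const_mul]
  congr 1; ext τ
  have : ⇑(FF (c • f)) = fun ξ => c * (FF f) ξ := by
    rw [FF, FourierTransform.fourier_smul]; rfl
  rw [this, TT_smul]

lemma GG_zero {n : ℕ} (e a : EE n) (s : ℝ) (x : EE n) : GG e a s 0 x = 0 := by
  have := GG_smul e a s 0 0 x
  simpa using this

lemma GG_sum {n : ℕ} {e a : EE n} (he : ‖e‖ = 1) {s : ℝ} (hs : 0 < s) {ι : Type*} (S : Finset ι)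
    (f : ι → 𝓢(EE n, ℂ)) (x : EE n) :
    GG e a s (∑ i ∈ S, f i) x = ∑ i ∈ S, GG e a s (f i) x := by
  classical
  induction S using Finset.induction_on with
  | empty => simp [GG_zero]
  | insert i S hi ih => rw [Finset.sum_insert hi, Finset.sum_insert hi, GG_add he hs, ih]

end CGO

namespace CGO
open scoped FourierTransform SchwartzMap ENNReal ContDiff LineDeriv

lemma eL2 {α : Type*} [MeasurableSpace α] (μ : Measure α) (f : α → ℂ) :
    ∫⁻ x, ‖f x‖ₑ ^ 2 ∂μ = eLpNorm f 2 μ ^ 2 := by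
  have := eLpNorm_nnreal_pow_eq_lintegral (μ := μ) (f := f) (p := 2) (by norm_num)
  simpa using this.symm

lemma lint_sq {α : Type*} [MeasurableSpace α] {μ : Measure α} {f : α → ℂ} (hf : Integrable (fun x => ‖f x‖ ^ 2) μ) :
    ∫⁻ x, ‖f x‖ₑ ^ 2 ∂μ = ENNReal.ofReal (∫ x, ‖f x‖ ^ 2 ∂μ) := by
  rw [ofReal_integral_eq_lintegral_ofReal hf (Filter.Eventually.of_forall fun x => by positivity)]
  congr 1; ext x
  rw [ENNReal.ofReal_pow (norm_nonneg _), ofReal_norm]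

lemma CS_w {α : Type*} [MeasureSpace α] {w : α → ℝ} (hw : ∀ t, 0 < w t) (hwm : Measurable w) {h : α → ℂ} (hh : AEMeasurable h) :
    (∫⁻ t, ‖h t‖ₑ) ^ 2 ≤ (∫⁻ t, ENNReal.ofReal (w t)⁻¹) * ∫⁻ t, ENNReal.ofReal (w t) * ‖h t‖ₑ ^ 2 := by
  have h2 : (2:ℝ).HolderConjugate 2 := Real.HolderConjugate.two_two
  have := ENNReal.lintegral_mul_le_Lp_mul_Lq volume h2
    (f := fun t => ENNReal.ofReal (Real.sqrt (w t)⁻¹)) (g := fun t => ENNReal.ofReal (Real.sqrt (w t)) * ‖h t‖ₑ)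
    (by fun_prop) (by fun_prop)
  simp only [Pi.mul_apply] at this
  have e1 : ∀ t, ENNReal.ofReal (Real.sqrt (w t)⁻¹) * (ENNReal.ofReal (Real.sqrt (w t)) * ‖h t‖ₑ) = ‖h t‖ₑ := fun t => by
    rw [← mul_assoc, ← ENNReal.ofReal_mul (Real.sqrt_nonneg _), ← Real.sqrt_mul (inv_nonneg.2 (hw t).le),
      inv_mul_cancel₀ (hw t).ne']
    simp
  have e2 : ∀ t, ENNReal.ofReal (Real.sqrt (w t)⁻¹) ^ (2:ℝ) = ENNReal.ofReal (w t)⁻¹ := fun t => by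
    rw [ENNReal.rpow_two, ← ENNReal.ofReal_pow (Real.sqrt_nonneg _), Real.sq_sqrt (inv_nonneg.2 (hw t).le)]
  have e3 : ∀ t, (ENNReal.ofReal (Real.sqrt (w t)) * ‖h t‖ₑ) ^ (2:ℝ) = ENNReal.ofReal (w t) * ‖h t‖ₑ ^ 2 := fun t => by
    rw [ENNReal.rpow_two, mul_pow, ← ENNReal.ofReal_pow (Real.sqrt_nonneg _), Real.sq_sqrt (hw t).le]
  simp only [e1, e2, e3] at this
  have h4 : ∀ x : ℝ≥0∞, (x ^ (1/2:ℝ)) ^ 2 = x := fun x => by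
    rw [← ENNReal.rpow_two, ← ENNReal.rpow_mul]; norm_num
  calc _ ≤ _ := pow_le_pow_left' this 2
    _ = _ := by rw [mul_pow, h4, h4]

lemma lint_pi (c : ℝ) : ∫⁻ t : ℝ, ENNReal.ofReal (1 + (c - t) ^ 2)⁻¹ = ENNReal.ofReal Real.pi := by
  rw [← ofReal_integral_eq_lintegral_ofReal (dec_int c) (Filter.Eventually.of_forall fun x => by positivity),
    integral_sub_left_eq_self (fun t : ℝ => (1 + t ^ 2)⁻¹) volume c, integral_univ_inv_one_add_sq]

lemma TT_L2 {n : ℕ} (hn : 2 ≤ n) {e a : EE n} (he : ‖e‖ = 1) (hea : inner ℝ e a = 0) {s : ℝ}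
    (hs : 1 ≤ s) (τ : ℝ) (φ : 𝓢(EE n, ℂ)) :
    ∫⁻ x, ‖TT e a s τ φ x‖ₑ ^ 2 ≤ ENNReal.ofReal (1600 / (s ^ 2 * (1 + |τ|)) * NN φ) := by
  have hs0 : 0 < s := by linarith
  have hI := KKφ_int e a hs0 τ (sint φ)
  have hsq : Integrable fun ξ => ‖(KK s ‖eta e a ξ‖ τ : ℂ) * φ ξ‖ ^ 2 := by
    refine (KK2_int e a hs0 τ φ).congr (Filter.Eventually.of_forall fun ξ => ?_)
    simp only [norm_mul, mul_pow, Complex.norm_real, Real.norm_eq_abs, sq_abs]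
  have hm : MemLp (fun ξ => (KK s ‖eta e a ξ‖ τ : ℂ) * φ ξ) 2 :=
    (memLp_two_iff_integrable_sq_norm hI.aestronglyMeasurable).2 hsq
  rw [eL2, TT_eq, plancherel_inv_le hI hm, ← eL2, lint_sq hsq]
  refine ENNReal.ofReal_le_ofReal (le_trans (le_of_eq ?_) (KK_L2 hn he hea hs τ φ))
  congr 1; ext ξ
  simp only [norm_mul, mul_pow, Complex.norm_real, Real.norm_eq_abs, sq_abs]

lemma peetre {δ : ℝ} (h1 : -1 < δ) (h0 : δ < 0) (y τ : ℝ) :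
    (1 + (y + τ) ^ 2) ^ δ ≤ 2 * (1 + τ ^ 2) ^ δ * (1 + y ^ 2) := by
  have e1 : 1 + τ ^ 2 ≤ (1 + (y + τ) ^ 2) * (2 * (1 + y ^ 2)) := by
    nlinarith [sq_nonneg (2 * y + τ), sq_nonneg (y * (y + τ))]
  have e2 : ((1 + (y + τ) ^ 2) * (2 * (1 + y ^ 2))) ^ δ ≤ (1 + τ ^ 2) ^ δ :=
    Real.rpow_le_rpow_of_nonpos (by positivity) e1 h0.le
  rw [Real.mul_rpow (by positivity) (by positivity)] at e2
  have e3 : (2 * (1 + y ^ 2)) ^ (-1:ℝ) ≤ (2 * (1 + y ^ 2)) ^ δ :=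
    Real.rpow_le_rpow_of_exponent_le (by nlinarith [sq_nonneg y]) h1.le
  rw [Real.rpow_neg_one] at e3
  have e4 : 0 ≤ (1 + (y + τ) ^ 2) ^ δ := by positivity
  have e5 := (mul_le_mul_of_nonneg_left e3 e4).trans e2
  rw [← div_eq_mul_inv, div_le_iff₀ (by positivity)] at e5
  linarith

lemma J_int {δ : ℝ} (h0 : δ < 0) : Integrable fun τ : ℝ => (1 + τ ^ 2) ^ δ * (1 + |τ|)⁻¹ := by
  have h1 := integrable_one_add_norm (E := ℝ) (μ := volume) (r := 1 - 2 * δ) (by simp; linarith)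
  have hc : Continuous fun τ : ℝ => (1 + τ ^ 2) ^ δ * (1 + |τ|)⁻¹ := by
    refine Continuous.mul (Continuous.rpow_const (by fun_prop) fun τ => Or.inl (by positivity))
      (Continuous.inv₀ (by fun_prop) fun τ => by positivity)
  refine (h1.const_mul ((2:ℝ) ^ (-δ))).mono' hc.aestronglyMeasurable (Filter.Eventually.of_forall fun τ => ?_)
  rw [Real.norm_of_nonneg (by positivity), Real.norm_eq_abs]
  have e1 : (1 + |τ|) ^ 2 / 2 ≤ 1 + τ ^ 2 := by nlinarith [sq_abs τ, sq_nonneg (1 - |τ|)]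
  have e2 : (1 + τ ^ 2) ^ δ ≤ ((1 + |τ|) ^ 2 / 2) ^ δ := Real.rpow_le_rpow_of_nonpos (by positivity) e1 h0.le
  have e3 : ((1 + |τ|) ^ 2 / 2) ^ δ = 2 ^ (-δ) * (1 + |τ|) ^ (2 * δ) := by
    rw [Real.div_rpow (by positivity) (by positivity), ← Real.rpow_natCast, ← Real.rpow_mul (by positivity), Real.rpow_neg (by positivity)]
    push_cast; field_simp
  have e4 : (1 + |τ|) ^ (-(1 - 2 * δ)) = (1 + |τ|) ^ (2 * δ) * (1 + |τ|)⁻¹ := by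
    rw [← Real.rpow_neg_one, ← Real.rpow_add (by positivity)]; ring_nf
  rw [e4, ← mul_assoc, ← e3]
  gcongr

lemma wt_le {n : ℕ} {e : EE n} (he : ‖e‖ = 1) {δ : ℝ} (h0 : δ < 0) (x : EE n) :
    (1 + ‖x‖ ^ 2) ^ δ ≤ (1 + (inner ℝ x e) ^ 2) ^ δ := by
  refine Real.rpow_le_rpow_of_nonpos (by positivity) ?_ h0.le
  have := abs_real_inner_le_norm x e
  rw [he, mul_one] at this
  have := sq_le_sq' (by linarith [abs_nonneg (inner ℝ x e), norm_nonneg x]) this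
  rw [sq_abs] at this
  linarith

/-- weighted square norm -/
noncomputable def WN {n : ℕ} (δ : ℝ) (f : EE n → ℂ) : ℝ≥0∞ :=
  ∫⁻ x, ENNReal.ofReal ((1 + ‖x‖ ^ 2) ^ δ) * ‖f x‖ₑ ^ 2

lemma GG_pt {n : ℕ} {e a : EE n} (he : ‖e‖ = 1) {s : ℝ} (hs : 0 < s) {δ : ℝ} (h1 : -1 < δ) (h0 : δ < 0)
    (f : 𝓢(EE n, ℂ)) (x : EE n) :
    ENNReal.ofReal ((1 + ‖x‖ ^ 2) ^ δ) * ‖GG e a s f x‖ₑ ^ 2 ≤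
      ∫⁻ τ : ℝ, ENNReal.ofReal (2 * Real.pi * (1 + τ ^ 2) ^ δ) * ‖TT e a s τ (FF (MM e f)) (x - τ • e)‖ₑ ^ 2 := by
  have e1 : ‖GG e a s f x‖ₑ ^ 2 ≤ (∫⁻ τ : ℝ, ‖TT e a s τ (FF f) (x - τ • e)‖ₑ) ^ 2 := by
    gcongr; exact enorm_integral_le_lintegral_enorm _
  have hm := (TTx_meas e a s f x).measurable
  have e2 := CS_w (w := fun τ => 1 + (inner ℝ x e - τ) ^ 2) (fun τ => by positivity) (by fun_prop)
    hm.aemeasurable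
  rw [lint_pi] at e2
  have e3 := e1.trans e2
  refine (mul_le_mul_right e3 _).trans ?_
  rw [← mul_assoc, ← lintegral_const_mul]
  swap
  · fun_prop
  refine lintegral_mono fun τ => ?_
  simp only
  rw [TT_MM he hs, inner_shift he, enorm_mul, mul_pow, ← mul_assoc, ← mul_assoc]
  refine mul_le_mul' ?_ le_rfl
  rw [← ofReal_norm (((1 + (inner ℝ x e - τ) ^ 2 : ℝ) : ℂ)), Complex.norm_real, Real.norm_of_nonneg (by positivity),
    ← ENNReal.ofReal_pow (by positivity), ← ENNReal.ofReal_mul (by positivity), ← ENNReal.ofReal_mul (by positivity),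
    ← ENNReal.ofReal_mul (by positivity)]
  apply ENNReal.ofReal_le_ofReal
  have h5 := (wt_le he h0 x).trans (le_of_eq (by ring_nf : _ = (1 + ((inner ℝ x e - τ) + τ) ^ 2) ^ δ))
  have h6 := h5.trans (peetre h1 h0 (inner ℝ x e - τ) τ)
  have hpi := Real.pi_pos
  calc _ ≤ 2 * (1 + τ ^ 2) ^ δ * (1 + (inner ℝ x e - τ) ^ 2) * Real.pi * (1 + (inner ℝ x e - τ) ^ 2) := by gcongr
    _ = _ := by ring

/-- the time integral -/
noncomputable def JJ (δ : ℝ) : ℝ := ∫ τ : ℝ, (1 + τ ^ 2) ^ δ * (1 + |τ|)⁻¹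

lemma JJ_nonneg (δ : ℝ) : 0 ≤ JJ δ := integral_nonneg fun τ => by positivity

lemma NN_nonneg {n : ℕ} (φ : 𝓢(EE n, ℂ)) : 0 ≤ NN φ :=
  add_nonneg (integral_nonneg fun ξ => by positivity) (integral_nonneg fun ξ => by positivity)

lemma GG_est {n : ℕ} (hn : 2 ≤ n) {e a : EE n} (he : ‖e‖ = 1) (hea : inner ℝ e a = 0) {s : ℝ} (hs : 1 ≤ s) {δ : ℝ} (h1 : -1 < δ) (h0 : δ < 0)
    (f : 𝓢(EE n, ℂ)) :
    WN δ (GG e a s f) ≤ ENNReal.ofReal (3200 * Real.pi * JJ δ / s ^ 2 * NN (FF (MM e f))) := by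
  have hs0 : 0 < s := by linarith
  unfold WN
  refine (lintegral_mono fun x => GG_pt he hs0 h1 h0 f x).trans ?_
  have hm := (TT_meas e a s (φ := fun ξ => FF (MM e f) ξ) (FF (MM e f)).continuous.measurable).measurable
  have hmw : Measurable fun τ : ℝ => ENNReal.ofReal (2 * Real.pi * (1 + τ ^ 2) ^ δ) := by fun_prop
  rw [lintegral_lintegral_swap]
  swap
  · exact ((hmw.comp measurable_snd).mul (hm.enorm.pow_const 2)).aemeasurable
  have hN := NN_nonneg (FF (MM e f))
  have step : ∀ τ : ℝ, ∫⁻ x, ENNReal.ofReal (2 * Real.pi * (1 + τ ^ 2) ^ δ) * ‖TT e a s τ (FF (MM e f)) (x - τ • e)‖ₑ ^ 2 ≤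
      ENNReal.ofReal (3200 * Real.pi / s ^ 2 * NN (FF (MM e f)) * ((1 + τ ^ 2) ^ δ * (1 + |τ|)⁻¹)) := fun τ => by
    rw [lintegral_const_mul' _ _ ENNReal.ofReal_ne_top,
      lintegral_sub_right_eq_self (fun x => ‖TT e a s τ (FF (MM e f)) x‖ₑ ^ 2) (τ • e)]
    refine (mul_le_mul_right (TT_L2 hn he hea hs τ (FF (MM e f))) _).trans ?_
    rw [← ENNReal.ofReal_mul (by positivity)]
    apply le_of_eq
    congr 1
    field_simp
    ring
  refine (lintegral_mono step).trans ?_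
  rw [← ofReal_integral_eq_lintegral_ofReal ((J_int h0).const_mul _) (Filter.Eventually.of_forall fun τ => by positivity),
    integral_const_mul]
  apply le_of_eq
  unfold JJ
  congr 1
  ring

end CGO

namespace CGO
open scoped FourierTransform SchwartzMap ENNReal ContDiff LineDeriv

/-- L2 norm -/
noncomputable def nn {n : ℕ} (f : 𝓢(EE n, ℂ)) : ℝ := ‖f.toLp 2 (volume : Measure (EE n))‖

lemma nn_nonneg {n : ℕ} (f : 𝓢(EE n, ℂ)) : 0 ≤ nn f := norm_nonneg _

lemma nn_eL {n : ℕ} (f : 𝓢(EE n, ℂ)) : ENNReal.ofReal (nn f) = eLpNorm f 2 volume := by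
  rw [nn, SchwartzMap.norm_toLp, ENNReal.ofReal_toReal (f.memLp 2 volume).2.ne]

lemma nn_sq {n : ℕ} (f : 𝓢(EE n, ℂ)) : nn f ^ 2 = ∫ x, ‖f x‖ ^ 2 := by
  have h1 : ENNReal.ofReal (nn f ^ 2) = ENNReal.ofReal (∫ x, ‖f x‖ ^ 2) := by
    rw [ENNReal.ofReal_pow (nn_nonneg f), nn_eL, ← eL2,
      ofReal_integral_eq_lintegral_ofReal (sq_int f) (Filter.Eventually.of_forall fun τ => by positivity)]
    congr 1; ext x
    rw [← ofReal_norm, ENNReal.ofReal_pow (norm_nonneg _)]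
  exact (ENNReal.ofReal_eq_ofReal_iff (by positivity) (integral_nonneg fun x => by positivity)).1 h1

lemma nn_add {n : ℕ} (f g : 𝓢(EE n, ℂ)) : nn (f + g) ≤ nn f + nn g := by
  unfold nn
  have : (f + g).toLp 2 (volume : Measure (EE n)) = f.toLp 2 volume + g.toLp 2 volume := rfl
  rw [this]; exact norm_add_le _ _

lemma nn_mul {n : ℕ} (f g : 𝓢(EE n, ℂ)) {c : ℝ} (hc : 0 ≤ c) (h : ∀ x, ‖f x‖ ≤ c * ‖g x‖) : nn f ≤ c * nn g := by
  have := nn_nonneg g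
  refine le_of_sq_le_sq ?_ (by positivity)
  rw [mul_pow, nn_sq, nn_sq, ← integral_const_mul]
  refine integral_mono (sq_int f) ((sq_int g).const_mul _) fun x => ?_
  simp only
  rw [← mul_pow]
  gcongr
  exact h x

lemma nn_FF {n : ℕ} (f : 𝓢(EE n, ℂ)) : nn (FF f) = nn f := by
  have : nn (FF f) ^ 2 = nn f ^ 2 := by
    rw [nn_sq, nn_sq]; exact SchwartzMap.integral_norm_sq_fourier f
  exact (sq_eq_sq₀ (nn_nonneg _) (nn_nonneg _)).1 this

/-- support in a ball -/
def Sup {n : ℕ} (ρ : ℝ) (f : EE n → ℂ) : Prop := ∀ x, ρ < ‖x‖ → f x = 0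

lemma Sup_pd {n : ℕ} {ρ : ℝ} {f : 𝓢(EE n, ℂ)} (h : Sup ρ f) (j : Fin n) : Sup ρ (pd j f) := by
  intro x hx
  have h1 : (f : EE n → ℂ) =ᶠ[nhds x] fun _ => 0 := by
    have : IsOpen {x : EE n | ρ < ‖x‖} := isOpen_lt continuous_const continuous_norm
    filter_upwards [this.mem_nhds hx] with y hy using h y hy
  rw [SchwartzMap.lineDerivOp_apply_eq_fderiv, h1.fderiv_eq]
  simp

lemma L_DD {n : ℕ} (L : EE n →L[ℝ] ℂ) : L = DD fun j => L (bb j) := by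
  ext v
  rw [DD_apply]
  have : v = ∑ j, v j • bb j := by
    ext i
    simp [Finset.sum_apply, Pi.single_apply]
  conv_lhs => rw [this]
  simp [map_sum]

lemma mm_bd {n : ℕ} {ρ : ℝ} {f : 𝓢(EE n, ℂ)} (h : Sup ρ f) (hρ : 0 ≤ ρ) (v x : EE n) :
    ‖mm v f x‖ ≤ (ρ * ‖v‖) * ‖f x‖ := by
  rw [mm_apply, norm_mul, Complex.norm_real]
  by_cases hx : ρ < ‖x‖
  · rw [h x hx]; simp
  · gcongr
    refine (norm_inner_le_norm _ _).trans ?_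
    gcongr
    linarith

lemma Sup_mm {n : ℕ} {ρ : ℝ} {f : 𝓢(EE n, ℂ)} (h : Sup ρ f) (v : EE n) : Sup ρ (mm v f) := fun x hx => by
  rw [mm_apply, h x hx, mul_zero]

lemma Sup_MM {n : ℕ} {ρ : ℝ} {f : 𝓢(EE n, ℂ)} (h : Sup ρ f) (v : EE n) : Sup ρ (MM v f) := fun x hx => by
  rw [MM_apply, h x hx, mul_zero]

lemma nn_mm {n : ℕ} {ρ : ℝ} {f : 𝓢(EE n, ℂ)} (h : Sup ρ f) (hρ : 0 ≤ ρ) {v : EE n} (hv : ‖v‖ = 1) :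
    nn (mm v f) ≤ ρ * nn f :=
  nn_mul _ _ hρ fun x => by simpa [hv] using mm_bd h hρ v x

lemma nn_MM {n : ℕ} {ρ : ℝ} {f : 𝓢(EE n, ℂ)} (h : Sup ρ f) (hρ : 0 ≤ ρ) {v : EE n} (hv : ‖v‖ = 1) :
    nn (MM v f) ≤ (1 + ρ ^ 2) * nn f := by
  have h1 := nn_add f (mm v (mm v f))
  have h2 := nn_mm (Sup_mm h v) hρ hv
  have h3 := mul_le_mul_of_nonneg_left (nn_mm h hρ hv) hρ
  unfold MM
  linarith

lemma NN_FF {n : ℕ} {ρ : ℝ} {g : 𝓢(EE n, ℂ)} (h : Sup ρ g) (hρ : 0 ≤ ρ) :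
    NN (FF g) ≤ (2 + n ^ 2 * (2 * Real.pi * ρ) ^ 2) * nn g ^ 2 := by
  refine (NN_le (FF g)).trans ?_
  rw [← nn_sq, nn_FF, add_mul]
  refine add_le_add le_rfl ?_
  have hb : ∀ j : Fin n, ‖(bb j : EE n)‖ = 1 := fun j => by simp
  have e1 : ∀ ξ, ‖fderiv ℝ (FF g) ξ‖ ^ 2 ≤ ∑ j : Fin n, n * (2 * Real.pi) ^ 2 * ‖FF (mm (bb j) g) ξ‖ ^ 2 := fun ξ => by
    rw [L_DD (fderiv ℝ (FF g) ξ)]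
    calc _ ≤ (∑ j, ‖fderiv ℝ (FF g) ξ (bb j)‖) ^ 2 := by gcongr; exact DD_norm _
      _ ≤ n * ∑ j, ‖fderiv ℝ (FF g) ξ (bb j)‖ ^ 2 := by
        simpa using sq_sum_le_card_mul_sum_sq (s := (Finset.univ : Finset (Fin n))) (f := fun j => ‖fderiv ℝ (FF g) ξ (bb j)‖)
      _ = _ := by
        rw [Finset.mul_sum]
        refine Finset.sum_congr rfl fun j _ => ?_
        rw [ld_fourier]
        simp [abs_of_pos Real.pi_pos]
        ring
  have hi : ∀ j : Fin n, Integrable fun ξ => n * (2 * Real.pi) ^ 2 * ‖FF (mm (bb j) g) ξ‖ ^ 2 := fun j =>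
    (sq_int _).const_mul _
  refine (integral_mono (fd_sq_int _) (integrable_finsetSum _ fun j _ => hi j) e1).trans ?_
  rw [integral_finsetSum _ fun j _ => hi j]
  calc _ ≤ ∑ j : Fin n, n * (2 * Real.pi) ^ 2 * (ρ * nn g) ^ 2 := by
        refine Finset.sum_le_sum fun j _ => ?_
        rw [integral_const_mul, ← nn_sq, nn_FF]
        have := nn_mm h hρ (hb j)
        have := nn_nonneg (mm (bb j) g)
        gcongr
    _ = _ := by simp; ring

/-- constant -/
noncomputable def Kc (n : ℕ) (δ ρ : ℝ) : ℝ :=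
  Real.sqrt (3200 * Real.pi * JJ δ * ((2 + n ^ 2 * (2 * Real.pi * ρ) ^ 2) * (1 + ρ ^ 2) ^ 2))

lemma Kc_nonneg (n : ℕ) (δ ρ : ℝ) : 0 ≤ Kc n δ ρ := Real.sqrt_nonneg _

lemma GG_est2 {n : ℕ} (hn : 2 ≤ n) {e a : EE n} (he : ‖e‖ = 1) (hea : inner ℝ e a = 0) {s : ℝ} (hs : 1 ≤ s) {δ : ℝ} (h1 : -1 < δ) (h0 : δ < 0)
    {ρ : ℝ} (hρ : 0 ≤ ρ) (f : 𝓢(EE n, ℂ)) (hf : Sup ρ f) :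
    WN δ (GG e a s f) ≤ ENNReal.ofReal ((Kc n δ ρ / s * nn f) ^ 2) := by
  refine (GG_est hn he hea hs h1 h0 f).trans (ENNReal.ofReal_le_ofReal ?_)
  have hJ := JJ_nonneg δ
  have hpi := Real.pi_pos
  have h2 := NN_FF (Sup_MM hf e) hρ
  have h3 := nn_MM hf hρ he
  have h4 := nn_nonneg (MM e f)
  rw [mul_pow, div_pow, Kc, Real.sq_sqrt (by positivity)]
  calc _ ≤ 3200 * Real.pi * JJ δ / s ^ 2 * ((2 + n ^ 2 * (2 * Real.pi * ρ) ^ 2) * nn (MM e f) ^ 2) := by gcongr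
    _ ≤ 3200 * Real.pi * JJ δ / s ^ 2 * ((2 + n ^ 2 * (2 * Real.pi * ρ) ^ 2) * ((1 + ρ ^ 2) * nn f) ^ 2) := by gcongr
    _ = _ := by ring
end CGO

namespace CGO
open scoped FourierTransform SchwartzMap ENNReal ContDiff LineDeriv

lemma exp_half (c1 c2 k1 k2 : ℂ) (l u : ℝ) :
    ∫ τ in l..u, (k1 * (c1 * Complex.exp (c1 * (τ : ℂ))) + k2 * (c2 * Complex.exp (c2 * (τ : ℂ)))) =
      (k1 * Complex.exp (c1 * u) + k2 * Complex.exp (c2 * u)) - (k1 * Complex.exp (c1 * l) + k2 * Complex.exp (c2 * l)) := by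
  have hd : ∀ (c : ℂ) (x : ℝ), HasDerivAt (fun τ : ℝ => Complex.exp (c * (τ : ℂ))) (c * Complex.exp (c * (x : ℂ))) x := fun c x => by
    have h1 : HasDerivAt (fun z : ℂ => Complex.exp (c * z)) (Complex.exp (c * (x : ℂ)) * (c * 1)) (x : ℂ) :=
      ((hasDerivAt_id (x : ℂ)).const_mul c).cexp
    exact h1.comp_ofReal.congr_deriv (by ring)
  refine intervalIntegral.integral_eq_sub_of_hasDerivAt
    (f := fun τ : ℝ => k1 * Complex.exp (c1 * (τ : ℂ)) + k2 * Complex.exp (c2 * (τ : ℂ))) (fun x _ => ?_)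
    (Continuous.intervalIntegrable (by fun_prop) _ _)
  exact ((hd c1 x).const_mul k1).add ((hd c2 x).const_mul k2)

/-- symbol in terms of `y, r` -/
noncomputable def ps (s r y : ℝ) : ℂ := (Complex.I * y - (s + r : ℝ)) * (Complex.I * y - (s - r : ℝ))

/-- truncated multiplier -/
noncomputable def mN (s r y N : ℝ) : ℂ :=
  1 + (Complex.I * y - (s - r : ℝ)) * (Complex.exp (Complex.I * y * N) * (KK s r (-N) : ℂ))
    - (Complex.I * y - (s + r : ℝ)) * (Complex.exp (-(Complex.I * y * N)) * (KK s r N : ℂ))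
    - (if r < s then Complex.exp (-((s - r : ℝ) - Complex.I * y) * N) else 0)

lemma KK_intervalInt {s r : ℝ} (hs : 0 < s) (hr : 0 < r) (y l u : ℝ) :
    IntervalIntegrable (fun τ : ℝ => ps s r y * (Complex.exp (-(Complex.I * y * τ)) * (KK s r τ : ℂ))) volume l u := by
  refine IntervalIntegrable.const_mul ?_ _
  have hm : Measurable fun τ : ℝ => (KK s r τ : ℂ) :=
    Complex.measurable_ofReal.comp ((KK_measurable s).comp (measurable_const.prodMk measurable_id))
  have hc : Continuous fun τ : ℝ => Complex.exp (-(Complex.I * y * τ)) := by fun_prop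
  rw [intervalIntegrable_iff]
  refine Measure.integrableOn_of_bounded (M := 4 / s) (by simp) (hc.measurable.mul hm).aestronglyMeasurable
    (Filter.Eventually.of_forall fun τ => ?_)
  rw [norm_mul, Complex.norm_exp, Complex.norm_real]
  simpa using KK_bound' hs hr.le τ

lemma mN_eq {s r : ℝ} (hs : 0 < s) (hr : 0 < r) (y : ℝ) {N : ℝ} (hN : 0 < N) :
    ∫ τ in (-N)..N, ps s r y * (Complex.exp (-(Complex.I * y * τ)) * (KK s r τ : ℂ)) = mN s r y N := by
  rw [← intervalIntegral.integral_add_adjacent_intervals (KK_intervalInt hs hr y (-N) 0) (KK_intervalInt hs hr y 0 N)]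
  have hr' : (r : ℂ) ≠ 0 := by exact_mod_cast hr.ne'
  have sp : ∀ (α τ : ℝ), Complex.exp (((α : ℂ) - Complex.I * y) * τ) = Complex.exp (-(Complex.I * y * τ)) * Complex.exp ((α : ℂ) * τ) := fun α τ => by
    rw [← Complex.exp_add]; congr 1; ring
  have hNN : (-N : ℝ) < 0 := by linarith
  by_cases h : r < s
  · rw [intervalIntegral.integral_congr_Ioo_of_le (g := fun τ : ℝ =>
      ((Complex.I * y - (s - r : ℝ)) / (2 * r)) * ((((s + r : ℝ) : ℂ) - Complex.I * y) * Complex.exp ((((s + r : ℝ) : ℂ) - Complex.I * y) * (τ : ℂ))) +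
      (-(Complex.I * y - (s + r : ℝ)) / (2 * r)) * ((((s - r : ℝ) : ℂ) - Complex.I * y) * Complex.exp ((((s - r : ℝ) : ℂ) - Complex.I * y) * (τ : ℂ))))
      hNN.le, exp_half]
    · rw [intervalIntegral.integral_congr_Ioo_of_le (g := fun τ : ℝ => 0) hN.le]
      · rw [sp, sp, sp, sp, mN, if_pos h]
        have e3 : Complex.exp (-(((s - r : ℝ) : ℂ) - Complex.I * y) * N) = Complex.exp ((((s - r : ℝ) : ℂ) - Complex.I * y) * ((-N : ℝ) : ℂ)) := by
          congr 1; push_cast; ring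
        rw [e3, sp]
        simp only [KK, if_pos h, if_pos hNN, if_neg hN.not_gt]
        push_cast
        have e4 : -(Complex.I * (y : ℂ) * -(N : ℂ)) = Complex.I * y * N := by ring
        simp only [e4]
        simp only [mul_zero, neg_zero, Complex.exp_zero, intervalIntegral.integral_zero]
        field_simp
        ring
      · intro τ hτ
        simp [KK, h, hτ.1.not_gt]
    · intro τ hτ
      simp only
      rw [sp, sp]
      simp only [KK, if_pos hτ.2, if_pos h, ps]
      push_cast
      field_simp
      ring
  · have h' : s ≤ r := not_lt.1 h
    rw [intervalIntegral.integral_congr_Ioo_of_le (g := fun τ : ℝ =>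
      ((Complex.I * y - (s - r : ℝ)) / (2 * r)) * ((((s + r : ℝ) : ℂ) - Complex.I * y) * Complex.exp ((((s + r : ℝ) : ℂ) - Complex.I * y) * (τ : ℂ))) +
      0 * ((((s - r : ℝ) : ℂ) - Complex.I * y) * Complex.exp ((((s - r : ℝ) : ℂ) - Complex.I * y) * (τ : ℂ))))
      hNN.le, exp_half]
    · rw [intervalIntegral.integral_congr_Ioo_of_le (g := fun τ : ℝ =>
        0 * ((((s + r : ℝ) : ℂ) - Complex.I * y) * Complex.exp ((((s + r : ℝ) : ℂ) - Complex.I * y) * (τ : ℂ))) +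
        ((Complex.I * y - (s + r : ℝ)) / (2 * r)) * ((((s - r : ℝ) : ℂ) - Complex.I * y) * Complex.exp ((((s - r : ℝ) : ℂ) - Complex.I * y) * (τ : ℂ))))
        hN.le, exp_half]
      · simp only [sp]
        rw [mN, if_neg h]
        simp only [KK, if_neg h, if_pos hNN, if_neg hN.not_gt]
        push_cast
        have e4 : -(Complex.I * (y : ℂ) * -(N : ℂ)) = Complex.I * y * N := by ring
        simp only [e4]
        simp only [mul_zero, neg_zero, Complex.exp_zero]
        field_simp
        ring
      · intro τ hτ
        simp only
        rw [sp, sp]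
        simp only [KK, if_neg hτ.1.not_gt, if_neg h, ps]
        push_cast
        field_simp
        ring
    · intro τ hτ
      simp only
      rw [sp, sp]
      simp only [KK, if_pos hτ.2, if_neg h, ps]
      push_cast
      field_simp
      ring

lemma exn (y N : ℝ) : ‖Complex.exp (Complex.I * y * N)‖ = 1 := by
  rw [Complex.norm_exp]; simp
lemma exn' (y N : ℝ) : ‖Complex.exp (-(Complex.I * y * N))‖ = 1 := by
  rw [Complex.norm_exp]; simp

lemma lin_bd {s r : ℝ} (hs : 0 < s) (hr : 0 < r) (y c : ℝ) (hc : |c| ≤ s + r) : ‖Complex.I * y - (c : ℂ)‖ ≤ |y| + s + r := by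
  refine (norm_sub_le _ _).trans ?_
  simp only [norm_mul, Complex.norm_I, Complex.norm_real, one_mul, Real.norm_eq_abs]
  linarith

lemma mN_sub {s r : ℝ} (hs : 0 < s) (hr : 0 < r) (y : ℝ) {N : ℝ} (hN : 0 < N) :
    ‖mN s r y N - 1‖ ≤ ((|y| + s + r) * (8 / s) + 1) * Real.exp (-(|s - r| * N / 2)) := by
  have k1 := KK_bound hs hr.le (-N)
  have k2 := KK_bound hs hr.le N
  rw [abs_neg] at k1
  rw [abs_of_pos hN] at k1 k2
  have l1 := lin_bd hs hr y (s - r) (by rw [abs_le]; constructor <;> linarith)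
  have l2 := lin_bd hs hr y (s + r) (by rw [abs_of_pos]; linarith)
  have t3 : ‖(if r < s then Complex.exp (-((s - r : ℝ) - Complex.I * y) * N) else 0)‖ ≤ Real.exp (-(|s - r| * N / 2)) := by
    split_ifs with h
    · rw [Complex.norm_exp]
      apply Real.exp_le_exp.2
      rw [abs_of_pos (by linarith)]
      simp
      nlinarith
    · simp; positivity
  have hE := Real.exp_pos (-(|s - r| * N / 2))
  set E := Real.exp (-(|s - r| * N / 2)) with hEd
  unfold mN
  have eq : ∀ A B C : ℂ, 1 + A - B - C - 1 = A - B - C := fun A B C => by ring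
  rw [eq]
  refine (norm_sub_le _ _).trans ?_
  rw [add_mul, one_mul]
  refine add_le_add ?_ t3
  refine (norm_sub_le _ _).trans ?_
  rw [norm_mul, norm_mul, norm_mul, norm_mul, exn, exn', one_mul, one_mul, Complex.norm_real, Complex.norm_real]
  rw [Real.norm_eq_abs, Real.norm_eq_abs]
  have hy := abs_nonneg y
  calc _ ≤ (|y| + s + r) * (4 / s * E) + (|y| + s + r) * (4 / s * E) := by gcongr
    _ = _ := by ring

lemma mN_bdd {s r : ℝ} (hs : 0 < s) (hr : 0 < r) (y : ℝ) {N : ℝ} (hN : 0 < N) :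
    ‖mN s r y N‖ ≤ (|y| + s + r) * (8 / s) + 2 := by
  have h := mN_sub hs hr y hN
  have h1 : Real.exp (-(|s - r| * N / 2)) ≤ 1 := Real.exp_le_one_iff.2 (by have := abs_nonneg (s - r); nlinarith)
  have h2 : ‖mN s r y N‖ ≤ ‖mN s r y N - 1‖ + 1 := by
    have := norm_add_le (mN s r y N - 1) 1
    simpa using this
  have hy := abs_nonneg y
  have h3 : 0 ≤ (|y| + s + r) * (8 / s) + 1 := by positivity
  nlinarith

lemma mN_lim {s r : ℝ} (hs : 0 < s) (hr : 0 < r) (hne : r ≠ s) (y : ℝ) :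
    Filter.Tendsto (fun N : ℕ => mN s r y (N + 1)) Filter.atTop (nhds 1) := by
  rw [tendsto_iff_norm_sub_tendsto_zero]
  refine squeeze_zero (fun _ => norm_nonneg _) (fun N => ?_) (g := fun N : ℕ => ((|y| + s + r) * (8 / s) + 1) * Real.exp (-(|s - r| * ((N : ℝ) + 1) / 2))) ?_
  · exact mN_sub hs hr y (by positivity)
  · rw [show (0 : ℝ) = ((|y| + s + r) * (8 / s) + 1) * 0 by ring]
    refine Filter.Tendsto.const_mul _ (Real.tendsto_exp_neg_atTop_nhds_zero.comp ?_)
    have hp : 0 < |s - r| := abs_pos.2 (sub_ne_zero.2 (Ne.symm hne))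
    refine Filter.Tendsto.atTop_div_const (by norm_num) (Filter.Tendsto.const_mul_atTop hp ?_)
    exact Filter.tendsto_atTop_add_const_right _ _ tendsto_natCast_atTop_atTop
end CGO

namespace CGO
open scoped FourierTransform SchwartzMap ENNReal ContDiff LineDeriv

lemma eta_convex {n : ℕ} (e a : EE n) (ρ : ℝ) : Convex ℝ {ξ | ‖eta e a ξ‖ ≤ ρ} := by
  intro x hx y hy t u ht hu htu
  simp only [Set.mem_ofPred_eq] at *
  have : eta e a (t • x + u • y) = t • eta e a x + u • eta e a y := by
    unfold eta
    rw [inner_add_right, inner_smul_right, inner_smul_right]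
    have ha : a = t • a + u • a := by rw [← add_smul, htu, one_smul]
    conv_lhs => rw [ha]
    module
  rw [this]
  calc _ ≤ ‖t • eta e a x‖ + ‖u • eta e a y‖ := norm_add_le _ _
    _ = t * ‖eta e a x‖ + u * ‖eta e a y‖ := by rw [norm_smul, norm_smul, Real.norm_of_nonneg ht, Real.norm_of_nonneg hu]
    _ ≤ t * ρ + u * ρ := by gcongr
    _ = ρ := by rw [← add_mul, htu, one_mul]

lemma eta_null {n : ℕ} {e a : EE n} (he : ‖e‖ = 1) (hea : inner ℝ e a = 0) (ha : a ≠ 0) (ρ : ℝ) :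
    ∀ᵐ ξ : EE n, ‖eta e a ξ‖ ≠ ρ := by
  rw [ae_iff]
  refine measure_mono_null ?_ ((eta_convex e a ρ).addHaar_frontier volume)
  intro ξ hξ
  simp only [ne_eq, not_not, Set.mem_ofPred_eq] at hξ
  refine ⟨subset_closure hξ.le, fun hint => ?_⟩
  obtain ⟨v, hv, hgt⟩ : ∃ v : EE n, inner ℝ e v = 0 ∧ ∀ t : ℝ, 0 < t → ρ < ‖eta e a ξ + t • ((2 * Real.pi) • v)‖ := by
    have hp := Real.pi_pos
    by_cases h0 : eta e a ξ = 0
    · refine ⟨a, hea, fun t ht => ?_⟩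
      rw [← hξ, h0, zero_add, norm_zero, norm_pos_iff, smul_smul]
      exact smul_ne_zero (by positivity) ha
    · refine ⟨eta e a ξ, eta_perp he hea ξ, fun t ht => ?_⟩
      have : eta e a ξ + t • ((2 * Real.pi) • eta e a ξ) = (1 + t * (2 * Real.pi)) • eta e a ξ := by module
      rw [this, norm_smul, Real.norm_of_nonneg (by positivity), ← hξ]
      have := norm_pos_iff.2 h0
      have : 0 < t * (2 * Real.pi) := by positivity
      nlinarith
  have hc : Filter.Tendsto (fun t : ℝ => ξ + t • v) (nhdsWithin 0 (Set.Ioi 0)) (nhds ξ) := by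
    have : Continuous fun t : ℝ => ξ + t • v := by fun_prop
    have := this.tendsto 0
    simp only [zero_smul, add_zero] at this
    exact this.mono_left nhdsWithin_le_nhds
  have h1 := hc.eventually (mem_interior_iff_mem_nhds.1 hint)
  obtain ⟨t, ht, ht2⟩ := (h1.and self_mem_nhdsWithin).exists
  have := hgt t ht2
  have h3 : ‖eta e a (ξ + t • v)‖ ≤ ρ := ht
  rw [eta_line, hv, mul_zero, zero_smul, sub_zero] at h3
  linarith

/-- conjugated Laplacian -/
noncomputable def PP {n : ℕ} (e a : EE n) (s : ℝ) (f : 𝓢(EE n, ℂ)) : 𝓢(EE n, ℂ) :=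
  (∑ j, pd j (pd j f)) + ∑ j, (2 * Complex.I * ((a j : ℂ) + Complex.I * s * (e j : ℂ))) • pd j f

lemma FF_add {n : ℕ} (f g : 𝓢(EE n, ℂ)) : FF (f + g) = FF f + FF g := FourierTransform.fourier_add f g
lemma FF_smul {n : ℕ} (c : ℂ) (f : 𝓢(EE n, ℂ)) : FF (c • f) = c • FF f := FourierTransform.fourier_smul c f
lemma FF_sum {n : ℕ} {ι : Type*} (S : Finset ι) (f : ι → 𝓢(EE n, ℂ)) : FF (∑ i ∈ S, f i) = ∑ i ∈ S, FF (f i) :=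
  map_sum (FourierTransform.fourierCLE ℂ 𝓢(EE n, ℂ)) f S

lemma eta_sq {n : ℕ} {e a : EE n} (he : ‖e‖ = 1) (hea : inner ℝ e a = 0) (ξ : EE n) :
    ‖eta e a ξ‖ ^ 2 = 4 * Real.pi ^ 2 * ‖ξ‖ ^ 2 + 4 * Real.pi * inner ℝ a ξ + ‖a‖ ^ 2 - (2 * Real.pi * inner ℝ e ξ) ^ 2 := by
  unfold eta
  rw [norm_sub_sq_real, norm_add_sq_real, norm_smul, norm_smul, he, inner_add_left, real_inner_smul_left, real_inner_smul_right,
    real_inner_smul_right, real_inner_smul_left, Real.norm_eq_abs, Real.norm_eq_abs, mul_pow, mul_pow, sq_abs, sq_abs, real_inner_comm e a, hea,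
    real_inner_comm a ξ, real_inner_comm e ξ]
  ring

lemma inner_bb {n : ℕ} (ξ : EE n) (j : Fin n) : inner ℝ ξ (bb j) = ξ j := by simp [EuclideanSpace.inner_single_right]

lemma inner_sum {n : ℕ} (x y : EE n) : inner ℝ x y = ∑ j, x j * y j := by
  simp [PiLp.inner_apply, mul_comm]

lemma FF_PP {n : ℕ} {e a : EE n} (he : ‖e‖ = 1) (hea : inner ℝ e a = 0) {s : ℝ} (has : ‖a‖ = s) (f : 𝓢(EE n, ℂ)) (ξ : EE n) :
    FF (PP e a s f) ξ = ps s ‖eta e a ξ‖ (2 * Real.pi * inner ℝ e ξ) * FF f ξ := by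
  rw [PP, FF_add, FF_sum, FF_sum, add_apply, sum_apply, sum_apply]
  simp only [FF_smul, smul_apply, pd, fourier_ld, inner_bb, smul_eq_mul]
  have e1 : ps s ‖eta e a ξ‖ (2 * Real.pi * inner ℝ e ξ) = -(4 * Real.pi ^ 2 * (‖ξ‖ ^ 2 : ℝ) + 4 * Real.pi * (inner ℝ a ξ : ℝ)
      + 4 * Real.pi * Complex.I * s * (inner ℝ e ξ : ℝ)) := by
    have h := congrArg (fun x : ℝ => (x : ℂ)) (eta_sq he hea ξ)
    simp only [has] at h
    push_cast at h
    unfold ps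
    push_cast
    linear_combination (-1 : ℂ) * h + (4 * Real.pi ^ 2 * (inner ℝ e ξ : ℝ) ^ 2 : ℂ) * Complex.I_sq
  rw [e1, ← real_inner_self_eq_norm_sq, inner_sum, inner_sum, inner_sum]
  push_cast
  simp only [Finset.mul_sum, ← Finset.sum_add_distrib, ← Finset.sum_neg_distrib, Finset.sum_mul]
  refine Finset.sum_congr rfl fun j _ => ?_
  linear_combination (4 * Real.pi ^ 2 * (ξ j) ^ 2 + 4 * Real.pi * (a j + Complex.I * s * e j) * ξ j : ℂ) * (FF f ξ) * Complex.I_sq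

lemma ex_shift {n : ℕ} (e ξ x : EE n) (τ : ℝ) :
    ex ξ (x - τ • e) = ex ξ x * Complex.exp (-(Complex.I * (2 * Real.pi * inner ℝ e ξ : ℝ) * τ)) := by
  unfold ex
  rw [← Complex.exp_add, inner_sub_right, inner_smul_right, real_inner_comm e ξ]
  congr 1
  push_cast
  ring

lemma ex_inv {n : ℕ} (f : 𝓢(EE n, ℂ)) (x : EE n) : ∫ ξ, ex ξ x * FF f ξ = f x := by
  have h1 : 𝓕⁻ (FF f) = f := FourierTransform.fourierInv_fourier_eq f
  conv_rhs => rw [← h1]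
  rw [SchwartzMap.fourierInv_coe, Real.fourierInv_eq']
  rfl

lemma mN_meas {n : ℕ} (e a : EE n) (s N : ℝ) :
    Measurable fun ξ : EE n => mN s ‖eta e a ξ‖ (2 * Real.pi * inner ℝ e ξ) N := by
  unfold mN
  have hc := eta_cont e a
  have h1 := KKeta_measC e a s N
  have h2 := KKeta_measC e a s (-N)
  have h3 : Measurable fun ξ : EE n => (if ‖eta e a ξ‖ < s then
      Complex.exp (-((s - ‖eta e a ξ‖ : ℝ) - Complex.I * (2 * Real.pi * inner ℝ e ξ : ℝ)) * N) else 0) := by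
    refine Measurable.ite (measurableSet_lt hc.norm.measurable measurable_const) ?_ measurable_const
    exact Continuous.measurable (by fun_prop)
  refine Measurable.sub (Measurable.sub (Measurable.add measurable_const (Measurable.mul ?_ (Measurable.mul ?_ h2)))
    (Measurable.mul ?_ (Measurable.mul ?_ h1))) h3
  all_goals exact Continuous.measurable (by fun_prop)

lemma GG_PP {n : ℕ} {e a : EE n} (he : ‖e‖ = 1) (hea : inner ℝ e a = 0) {s : ℝ} (hs : 0 < s) (has : ‖a‖ = s) (f : 𝓢(EE n, ℂ)) (x : EE n) :
    GG e a s (PP e a s f) x = f x := by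
  have ha : a ≠ 0 := by rw [← norm_pos_iff, has]; exact hs
  have hT : Filter.Tendsto (fun N : ℕ => (N : ℝ) + 1) Filter.atTop Filter.atTop :=
    Filter.tendsto_atTop_add_const_right _ _ tendsto_natCast_atTop_atTop
  have L1 := intervalIntegral_tendsto_integral (μ := volume) (GG_int (a := a) he hs (PP e a s f) x)
    (Filter.tendsto_neg_atTop_atBot.comp hT) hT
  set y : EE n → ℝ := fun ξ => 2 * Real.pi * inner ℝ e ξ with hy
  have L2 : Filter.Tendsto (fun N : ℕ => ∫ ξ, ex ξ x * FF f ξ * mN s ‖eta e a ξ‖ (y ξ) (N + 1)) Filter.atTop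
      (nhds (∫ ξ, ex ξ x * FF f ξ * 1)) := by
    have hpi := Real.pi_pos
    have hcf := (FF f).continuous
    have hce : Continuous fun ξ : EE n => ex ξ x := by fun_prop
    have hb := (schwartz_int (FF f) 1).const_mul ((6 * Real.pi + 2 * s) * (8 / s) + 2)
    refine tendsto_integral_of_dominated_convergence _ (fun N => ?_) hb (fun N => ?_) ?_
    · exact ((hce.mul hcf).measurable.mul (mN_meas e a s (N + 1))).aestronglyMeasurable
    · filter_upwards [eta_null he hea ha 0] with ξ hξ
      have hr : 0 < ‖eta e a ξ‖ := lt_of_le_of_ne (norm_nonneg _) (Ne.symm hξ)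
      have h1 := mN_bdd hs hr (y ξ) (by positivity : 0 < (N : ℝ) + 1)
      have h2 : ‖eta e a ξ‖ ≤ (4 * Real.pi + ‖a‖) * (1 + ‖ξ‖) := eta_norm_le he ξ
      have h3 : |y ξ| ≤ 2 * Real.pi * ‖ξ‖ := by
        rw [hy]
        simp only
        rw [abs_mul, abs_of_pos (by positivity)]
        have := abs_real_inner_le_norm e ξ
        rw [he, one_mul] at this
        gcongr
      rw [norm_mul, norm_mul, ex_norm, one_mul, pow_one, mul_comm ‖FF f ξ‖, ← mul_assoc]
      refine mul_le_mul_of_nonneg_right (h1.trans ?_) (norm_nonneg _)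
      have h4 : |y ξ| + s + ‖eta e a ξ‖ ≤ (6 * Real.pi + 2 * s) * (1 + ‖ξ‖) := by
        rw [has] at h2
        have := norm_nonneg ξ
        have : 0 ≤ s * ‖ξ‖ := by positivity
        nlinarith
      have h5 : (|y ξ| + s + ‖eta e a ξ‖) * (8 / s) ≤ (6 * Real.pi + 2 * s) * (1 + ‖ξ‖) * (8 / s) := by gcongr
      have := norm_nonneg ξ
      linarith
    · filter_upwards [eta_null he hea ha 0, eta_null he hea ha s] with ξ hξ hξ2
      have hr : 0 < ‖eta e a ξ‖ := lt_of_le_of_ne (norm_nonneg _) (Ne.symm hξ)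
      exact (mN_lim hs hr hξ2 (y ξ)).const_mul _
  have L3 : ∀ N : ℕ, ∫ τ in (-((N : ℝ) + 1))..((N : ℝ) + 1), TT e a s τ (FF (PP e a s f)) (x - τ • e) =
      ∫ ξ, ex ξ x * FF f ξ * mN s ‖eta e a ξ‖ (y ξ) (N + 1) := by
    intro N
    unfold TT
    rw [intervalIntegral_integral_swap]
    · refine integral_congr_ae ?_
      filter_upwards [eta_null he hea ha 0] with ξ hξ
      have hr : 0 < ‖eta e a ξ‖ := lt_of_le_of_ne (norm_nonneg _) (Ne.symm hξ)
      rw [← mN_eq hs hr (y ξ) (by positivity : 0 < (N : ℝ) + 1), ← intervalIntegral.integral_const_mul]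
      congr 1
      ext τ
      rw [FF_PP he hea has, ex_shift]
      ring
    · have hfm : IsFiniteMeasure (volume.restrict (Set.uIoc (-((N : ℝ) + 1)) ((N : ℝ) + 1))) := by
        unfold Set.uIoc; infer_instance
      have hb : Integrable (fun p : ℝ × EE n => (4 / s) * ‖FF (PP e a s f) p.2‖)
          ((volume.restrict (Set.uIoc (-((N : ℝ) + 1)) ((N : ℝ) + 1))).prod volume) :=
        Integrable.mul_prod (f := fun _ : ℝ => 4 / s) (g := fun ξ => ‖FF (PP e a s f) ξ‖) (integrable_const _) (sint _).norm
      refine hb.mono' ?_ (Filter.Eventually.of_forall fun p => ?_)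
      · have h1 : Measurable fun p : ℝ × EE n => ex p.2 (x - p.1 • e) :=
          (by fun_prop : Continuous fun p : ℝ × EE n => ex p.2 (x - p.1 • e)).measurable
        have h2 : Measurable fun p : ℝ × EE n => (KK s ‖eta e a p.2‖ p.1 : ℂ) := by
          have hc := eta_cont e a
          refine Complex.measurable_ofReal.comp ((KK_measurable s).comp (?_ : Measurable fun p : ℝ × EE n => ((‖eta e a p.2‖, p.1) : ℝ × ℝ)))
          exact (by fun_prop : Continuous fun p : ℝ × EE n => ((‖eta e a p.2‖, p.1) : ℝ × ℝ)).measurable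
        exact (h1.mul (h2.mul ((FF (PP e a s f)).continuous.measurable.comp measurable_snd))).aestronglyMeasurable
      · simp only [Function.uncurry]
        rw [norm_mul, norm_mul, ex_norm, one_mul]
        gcongr
        exact KK_normC e a hs _ _
  have L4 := L2.congr fun N => (L3 N).symm
  have := tendsto_nhds_unique L1 L4
  rw [GG, this]
  simpa using ex_inv f x
end CGO

namespace CGO
open scoped FourierTransform SchwartzMap ENNReal ContDiff LineDeriv

lemma pd_apply {n : ℕ} (j : Fin n) (f : 𝓢(EE n, ℂ)) (x : EE n) : pd j f x = fderiv ℝ f x (bb j) :=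
  SchwartzMap.lineDerivOp_apply_eq_fderiv _ _ _

lemma pd_add {n : ℕ} (j : Fin n) (f g : 𝓢(EE n, ℂ)) : pd j (f + g) = pd j f + pd j g := LineDeriv.lineDerivOp_add _ f g
lemma pd_smul {n : ℕ} (j : Fin n) (c : ℂ) (f : 𝓢(EE n, ℂ)) : pd j (c • f) = c • pd j f := LineDeriv.lineDerivOp_smul _ c f

/-- Sobolev norm -/
noncomputable def Sob {n : ℕ} : ℕ → 𝓢(EE n, ℂ) → ℝ
  | 0, f => nn f
  | k + 1, f => Sob k f + ∑ j, Sob k (pd j f)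

lemma Sob_nonneg {n : ℕ} (k : ℕ) : ∀ f : 𝓢(EE n, ℂ), 0 ≤ Sob k f := by
  induction k with
  | zero => exact nn_nonneg
  | succ k ih => exact fun f => add_nonneg (ih f) (Finset.sum_nonneg fun j _ => ih _)

lemma Sob_add {n : ℕ} (k : ℕ) : ∀ f g : 𝓢(EE n, ℂ), Sob k (f + g) ≤ Sob k f + Sob k g := by
  induction k with
  | zero => exact nn_add
  | succ k ih =>
    intro f g
    simp only [Sob, pd_add]
    have h1 := ih f g
    have h2 : ∑ j, Sob k (pd j f + pd j g) ≤ ∑ j, (Sob k (pd j f) + Sob k (pd j g)) := Finset.sum_le_sum fun j _ => ih _ _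
    rw [Finset.sum_add_distrib] at h2
    linarith

lemma Sob_smul {n : ℕ} (k : ℕ) (c : ℂ) : ∀ f : 𝓢(EE n, ℂ), Sob k (c • f) ≤ ‖c‖ * Sob k f := by
  induction k with
  | zero => exact fun f => nn_mul _ _ (norm_nonneg c) fun x => by rw [smul_apply, norm_smul]
  | succ k ih =>
    intro f
    simp only [Sob, pd_smul]
    rw [mul_add, Finset.mul_sum]
    exact add_le_add (ih f) (Finset.sum_le_sum fun j _ => ih _)

lemma pd_mm {n : ℕ} (j : Fin n) (v : EE n) (f : 𝓢(EE n, ℂ)) : pd j (mm v f) = (v j : ℂ) • f + mm v (pd j f) := by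
  ext x
  rw [pd_apply, add_apply, smul_apply, mm_apply, pd_apply]
  have h0 : ⇑(mm v f) = fun x => ((inner ℝ x v : ℝ) : ℂ) * f x := by ext x; exact mm_apply v f x
  have h1 : HasFDerivAt (fun x : EE n => inner ℝ x v) ((innerSL ℝ).flip v) x := ((innerSL ℝ).flip v).hasFDerivAt
  have h2 : HasFDerivAt (fun x : EE n => ((inner ℝ x v : ℝ) : ℂ)) (Complex.ofRealCLM.comp ((innerSL ℝ).flip v)) x :=
    Complex.ofRealCLM.hasFDerivAt.comp x h1
  have h3 := h2.mul (f.differentiableAt (x := x)).hasFDerivAt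
  rw [h0, show (fun x => ((inner ℝ x v : ℝ) : ℂ) * f x) = (fun x : EE n => ((inner ℝ x v : ℝ) : ℂ)) * ⇑f from rfl, h3.fderiv]
  simp
  rw [innerSL_apply_apply, inner_bb]
  ring

lemma Sob_mm {n : ℕ} {ρ : ℝ} (hρ : 0 ≤ ρ) {v : EE n} (hv : ‖v‖ = 1) (k : ℕ) :
    ∀ f : 𝓢(EE n, ℂ), Sup ρ f → Sob k (mm v f) ≤ (ρ + k * n) * Sob k f := by
  induction k with
  | zero => intro f hf; simpa [Sob] using nn_mm hf hρ hv
  | succ k ih =>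
    intro f hf
    simp only [Sob, pd_mm]
    have h1 := ih f hf
    have h2 : ∀ j, Sob k ((v j : ℂ) • f + mm v (pd j f)) ≤ Sob k f + (ρ + k * n) * Sob k (pd j f) := fun j => by
      refine (Sob_add k _ _).trans (add_le_add ?_ (ih _ (Sup_pd hf j)))
      refine (Sob_smul k _ _).trans ?_
      refine mul_le_of_le_one_left (Sob_nonneg k f) ?_
      rw [Complex.norm_real, ← hv]
      exact PiLp.norm_apply_le v j
    have h3 := Finset.sum_le_sum (s := Finset.univ) fun j _ => h2 j
    rw [Finset.sum_add_distrib, ← Finset.mul_sum] at h3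
    simp only [Finset.sum_const, Finset.card_univ, Fintype.card_fin, nsmul_eq_mul] at h3
    have h4 : 0 ≤ ∑ j, Sob k (pd j f) := Finset.sum_nonneg fun j _ => Sob_nonneg k _
    push_cast
    have h5 : 0 ≤ (n : ℝ) * ∑ j, Sob k (pd j f) := by positivity
    nlinarith

lemma Sob_MM {n : ℕ} {ρ : ℝ} (hρ : 0 ≤ ρ) {v : EE n} (hv : ‖v‖ = 1) (k : ℕ) (f : 𝓢(EE n, ℂ)) (hf : Sup ρ f) :
    Sob k (MM v f) ≤ (1 + (ρ + k * n) ^ 2) * Sob k f := by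
  have h1 := Sob_add k f (mm v (mm v f))
  have h2 := Sob_mm hρ hv k _ (Sup_mm hf v)
  have h3 := mul_le_mul_of_nonneg_left (Sob_mm hρ hv k f hf) (by positivity : 0 ≤ ρ + k * n)
  unfold MM
  linarith

lemma sob_w {n : ℕ} (k : ℕ) : ∀ f : 𝓢(EE n, ℂ),
    eLpNorm (fun ξ => (1 + ‖ξ‖) ^ k * ‖FF f ξ‖) 2 volume ≤ ENNReal.ofReal (Sob k f) := by
  induction k with
  | zero =>
    intro f
    simp only [pow_zero, one_mul, Sob]
    rw [eLpNorm_norm, ← nn_eL, nn_FF]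
  | succ k ih =>
    intro f
    have hc : ∀ g : 𝓢(EE n, ℂ), AEStronglyMeasurable (fun ξ => (1 + ‖ξ‖) ^ k * ‖FF g ξ‖) volume := fun g => by
      have := (FF g).continuous
      exact Continuous.aestronglyMeasurable (by fun_prop)
    have h1 : eLpNorm (fun ξ => (1 + ‖ξ‖) ^ (k + 1) * ‖FF f ξ‖) 2 volume ≤
        eLpNorm ((fun ξ => (1 + ‖ξ‖) ^ k * ‖FF f ξ‖) + ∑ j, fun ξ => (1 + ‖ξ‖) ^ k * ‖FF (pd j f) ξ‖) 2 volume := by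
      refine eLpNorm_mono_real fun ξ => ?_
      rw [Real.norm_of_nonneg (by positivity)]
      simp only [Pi.add_apply, Finset.sum_apply]
      rw [← Finset.mul_sum, ← mul_add, pow_succ, mul_assoc]
      refine mul_le_mul_of_nonneg_left ?_ (by positivity)
      rw [add_mul, one_mul]
      refine add_le_add le_rfl ?_
      have h2 : ‖ξ‖ ≤ ∑ j, ‖ξ j‖ := by
        rw [EuclideanSpace.norm_eq]
        refine Real.sqrt_le_iff.2 ⟨by positivity, ?_⟩
        exact Finset.sum_sq_le_sq_sum_of_nonneg (fun i _ => norm_nonneg _)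
      refine (mul_le_mul_of_nonneg_right h2 (norm_nonneg _)).trans ?_
      rw [Finset.sum_mul]
      refine Finset.sum_le_sum fun j _ => ?_
      rw [pd, fourier_ld, inner_bb, norm_mul]
      refine mul_le_mul_of_nonneg_right ?_ (norm_nonneg _)
      simp only [norm_mul, Complex.norm_real, Complex.norm_I, Complex.norm_ofNat, mul_one, Real.norm_eq_abs, abs_of_pos Real.pi_pos]
      have := abs_nonneg (ξ j)
      nlinarith [Real.pi_gt_three]
    refine h1.trans ((eLpNorm_add_le (hc f) (Finset.aestronglyMeasurable_sum _ fun j _ => hc _) (by norm_num)).trans ?_)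
    simp only [Sob]
    rw [ENNReal.ofReal_add (Sob_nonneg k f) (Finset.sum_nonneg fun j _ => Sob_nonneg k _)]
    refine add_le_add (ih f) ?_
    rw [ENNReal.ofReal_sum_of_nonneg fun j _ => Sob_nonneg k _]
    exact (eLpNorm_sum_le (fun j _ => hc _) (by norm_num)).trans (Finset.sum_le_sum fun j _ => ih _)

/-- Sobolev constant -/
noncomputable def Cs (n : ℕ) : ℝ := Real.sqrt (∫ ξ : EE n, ((1 + ‖ξ‖) ^ (2 * (n + 1)))⁻¹)

lemma sob_L1 {n : ℕ} (f : 𝓢(EE n, ℂ)) : ∫ ξ, ‖FF f ξ‖ ≤ Cs n * Sob (n + 1) f := by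
  have hI : Integrable fun ξ : EE n => ((1 + ‖ξ‖) ^ (2 * (n + 1)))⁻¹ := by
    have := integrable_one_add_norm (E := EE n) (μ := volume) (r := (2 * (n + 1) : ℕ)) (by
      simp; linarith)
    refine this.congr (Filter.Eventually.of_forall fun ξ => ?_)
    simp only
    rw [Real.rpow_neg (by positivity), Real.rpow_natCast]
  have h := CS_w (α := EE n) (w := fun ξ => (1 + ‖ξ‖) ^ (2 * (n + 1))) (fun ξ => by positivity) (by fun_prop)
    (h := fun ξ => FF f ξ) (FF f).continuous.measurable.aemeasurable
  have hS := Sob_nonneg (n + 1) f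
  rw [← ofReal_integral_eq_lintegral_ofReal hI (Filter.Eventually.of_forall fun x => by positivity)] at h
  have h2 := sob_w (n + 1) f
  have h3 : ∫⁻ ξ, ENNReal.ofReal ((1 + ‖ξ‖) ^ (2 * (n + 1))) * ‖FF f ξ‖ₑ ^ 2 ≤ ENNReal.ofReal (Sob (n + 1) f ^ 2) := by
    rw [ENNReal.ofReal_pow hS]
    refine le_trans (le_of_eq ?_) (pow_le_pow_left' h2 2)
    have e1 := eLpNorm_norm (μ := volume) (p := 2) (fun ξ : EE n => (((1 + ‖ξ‖) ^ (n + 1) : ℝ) : ℂ) * FF f ξ)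
    have e2 : (fun ξ : EE n => ‖(((1 + ‖ξ‖) ^ (n + 1) : ℝ) : ℂ) * FF f ξ‖) = fun ξ => (1 + ‖ξ‖) ^ (n + 1) * ‖FF f ξ‖ := by
      ext ξ
      rw [norm_mul, Complex.norm_real, Real.norm_of_nonneg (by positivity)]
    rw [← e2, e1, ← eL2]
    congr 1; ext ξ
    rw [enorm_mul, mul_pow, ← ofReal_norm (((1 + ‖ξ‖) ^ (n + 1) : ℝ) : ℂ), Complex.norm_real, Real.norm_of_nonneg (by positivity),
      ← ENNReal.ofReal_pow (by positivity), ← pow_mul, mul_comm 2]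
  have h4 := h.trans (mul_le_mul_right h3 _)
  rw [← ofReal_integral_norm_eq_lintegral_enorm (sint (FF f)), ← ENNReal.ofReal_pow (integral_nonneg fun _ => norm_nonneg _),
    ← ENNReal.ofReal_mul (integral_nonneg fun _ => by positivity)] at h4
  have hnn : 0 ≤ ∫ ξ : EE n, ((1 + ‖ξ‖) ^ (2 * (n + 1)))⁻¹ := integral_nonneg fun _ => by positivity
  rw [ENNReal.ofReal_le_ofReal_iff (by positivity)] at h4
  refine le_of_sq_le_sq ?_ (mul_nonneg (Real.sqrt_nonneg _) hS)
  rw [mul_pow, Cs, Real.sq_sqrt hnn]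
  exact h4

lemma GG_sup {n : ℕ} {e a : EE n} (he : ‖e‖ = 1) {s : ℝ} (hs : 0 < s) {ρ : ℝ} (hρ : 0 ≤ ρ) :
    ∃ C : ℝ, 0 ≤ C ∧ ∀ f : 𝓢(EE n, ℂ), Sup ρ f → ∀ x, ‖GG e a s f x‖ ≤ C * Sob (n + 1) f := by
  have hC : 0 ≤ Cs n := Real.sqrt_nonneg _
  refine ⟨4 / s * (Cs n * (1 + (ρ + (n + 1 : ℕ) * n) ^ 2)) * Real.pi, by have := Real.pi_pos; positivity, fun f hf x => ?_⟩
  have h1 : ‖GG e a s f x‖ ≤ (4 / s * ∫ ξ, ‖(FF (MM e f)) ξ‖) * Real.pi := by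
    unfold GG
    refine (norm_integral_le_of_norm_le ((dec_int (inner ℝ x e)).const_mul _) (Filter.Eventually.of_forall fun τ => TT_decay' he hs τ f x)).trans ?_
    rw [integral_const_mul, integral_sub_left_eq_self (fun t : ℝ => (1 + t ^ 2)⁻¹) volume, integral_univ_inv_one_add_sq]
  have h2 := sob_L1 (MM e f)
  have h3 := mul_le_mul_of_nonneg_left (Sob_MM hρ he (n + 1) f hf) hC
  have hp := Real.pi_pos
  refine h1.trans ?_
  calc _ ≤ (4 / s * (Cs n * ((1 + (ρ + (n + 1 : ℕ) * n) ^ 2) * Sob (n + 1) f))) * Real.pi := by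
        gcongr; exact h2.trans h3
    _ = _ := by ring
end CGO

namespace CGO
open scoped FourierTransform SchwartzMap ENNReal ContDiff LineDeriv

open Classical in
/-- product of a Schwartz function and a smooth function -/
noncomputable def cMul {n : ℕ} (χ : 𝓢(EE n, ℂ)) (u : EE n → ℂ) : 𝓢(EE n, ℂ) :=
  if h : HasCompactSupport (fun x => χ x * u x) ∧ ContDiff ℝ ∞ (fun x => χ x * u x) then h.1.toSchwartzMap h.2 else 0

lemma Sup_cs {n : ℕ} {ρ : ℝ} {f : EE n → ℂ} (h : Sup ρ f) : HasCompactSupport f :=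
  HasCompactSupport.intro (isCompact_closedBall 0 ρ) fun x hx => h x (by simpa using hx)

lemma cMul_apply {n : ℕ} {ρ : ℝ} {χ : 𝓢(EE n, ℂ)} (hχ : Sup ρ χ) {u : EE n → ℂ} (hu : ContDiff ℝ ∞ u) (x : EE n) :
    cMul χ u x = χ x * u x := by
  have h : HasCompactSupport (fun x => χ x * u x) ∧ ContDiff ℝ ∞ (fun x => χ x * u x) :=
    ⟨(Sup_cs hχ).mul_right, (χ.smooth ⊤).mul hu⟩
  rw [cMul, dif_pos h]
  rfl

lemma Sup_cMul {n : ℕ} {ρ : ℝ} {χ : 𝓢(EE n, ℂ)} (hχ : Sup ρ χ) {u : EE n → ℂ} (hu : ContDiff ℝ ∞ u) : Sup ρ (cMul χ u) :=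
  fun x hx => by rw [cMul_apply hχ hu, hχ x hx, zero_mul]

/-- cut-off resolvent -/
noncomputable abbrev cG {n : ℕ} (e a : EE n) (s : ℝ) (χ f : 𝓢(EE n, ℂ)) : 𝓢(EE n, ℂ) := cMul χ (GG e a s f)

lemma pd_cG {n : ℕ} {e a : EE n} (he : ‖e‖ = 1) {s : ℝ} (hs : 0 < s) {ρ : ℝ} {χ : 𝓢(EE n, ℂ)} (hχ : Sup ρ χ)
    (f : 𝓢(EE n, ℂ)) (j : Fin n) :
    pd j (cG e a s χ f) = cG e a s χ (pd j f) + cG e a s (pd j χ) f := by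
  ext x
  have hG := fun f => GG_contDiff (a := a) he hs f
  rw [pd_apply, add_apply, cMul_apply hχ (hG _), cMul_apply (Sup_pd hχ j) (hG _), pd_apply]
  have h0 : ⇑(cG e a s χ f) = ⇑χ * GG e a s f := by ext x; exact cMul_apply hχ (hG _) x
  have h3 := (χ.differentiableAt (x := x)).hasFDerivAt.mul (GG_fderiv (a := a) he hs f x)
  rw [h0, h3.fderiv]
  simp [DD_bb]
  ring

/-- constant -/
noncomputable def Bc (n : ℕ) (δ ρ : ℝ) : ℝ := Real.sqrt ((1 + ρ ^ 2) ^ (-δ)) * Kc n δ ρ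

lemma Bc_nonneg (n : ℕ) (δ ρ : ℝ) : 0 ≤ Bc n δ ρ := mul_nonneg (Real.sqrt_nonneg _) (Kc_nonneg _ _ _)

lemma nn_cMul {n : ℕ} {δ ρ : ℝ} (h0 : δ < 0) {χ : 𝓢(EE n, ℂ)} (hχ : Sup ρ χ) {M : ℝ} (hM : ∀ x, ‖χ x‖ ≤ M) (hM0 : 0 ≤ M)
    {u : EE n → ℂ} (hu : ContDiff ℝ ∞ u) {A : ℝ} (hA : 0 ≤ A) (hW : WN δ u ≤ ENNReal.ofReal (A ^ 2)) :
    nn (cMul χ u) ≤ M * Real.sqrt ((1 + ρ ^ 2) ^ (-δ)) * A := by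
  have e1 : ENNReal.ofReal (nn (cMul χ u) ^ 2) ≤ ENNReal.ofReal ((M * Real.sqrt ((1 + ρ ^ 2) ^ (-δ)) * A) ^ 2) := by
    rw [mul_pow, mul_pow, Real.sq_sqrt (by positivity), ENNReal.ofReal_mul (by positivity)]
    refine le_trans ?_ (mul_le_mul_right hW _)
    rw [ENNReal.ofReal_pow (nn_nonneg _), nn_eL, ← eL2, WN, ← lintegral_const_mul' _ _ ENNReal.ofReal_ne_top]
    refine lintegral_mono fun x => ?_
    rw [cMul_apply hχ hu]
    by_cases hx : ρ < ‖x‖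
    · rw [hχ x hx]; simp
    · rw [enorm_mul, mul_pow, ← mul_assoc, ← ENNReal.ofReal_mul (by positivity)]
      gcongr
      rw [← ofReal_norm, ← ENNReal.ofReal_pow (norm_nonneg _)]
      refine ENNReal.ofReal_le_ofReal ?_
      push Not at hx
      have h1 : (1 + ρ ^ 2) ^ δ ≤ (1 + ‖x‖ ^ 2) ^ δ := Real.rpow_le_rpow_of_nonpos (by positivity)
        (by gcongr) h0.le
      have h2 : (1 + ρ ^ 2) ^ (-δ) * (1 + ρ ^ 2) ^ δ = 1 := by
        rw [← Real.rpow_add (by positivity)]; simp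
      have h3 : 1 ≤ (1 + ρ ^ 2) ^ (-δ) * (1 + ‖x‖ ^ 2) ^ δ := h2.ge.trans
        (mul_le_mul_of_nonneg_left h1 (Real.rpow_nonneg (by positivity) _))
      calc ‖χ x‖ ^ 2 ≤ M ^ 2 := by gcongr; exact hM x
        _ ≤ M ^ 2 * ((1 + ρ ^ 2) ^ (-δ) * (1 + ‖x‖ ^ 2) ^ δ) := le_mul_of_one_le_right (by positivity) h3
        _ = _ := by ring
  rw [ENNReal.ofReal_le_ofReal_iff (by positivity)] at e1
  exact (sq_le_sq₀ (nn_nonneg _) (by positivity)).1 e1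

lemma summ_rec {a b : ℕ → ℝ} (ha : ∀ j, 0 ≤ a j) (hb : ∀ j, 0 ≤ b j) (h : ∀ j, a (j + 1) ≤ 1 / 2 * a j + b j)
    (hs : Summable b) : Summable a := by
  have key : ∀ N, ∑ j ∈ Finset.range N, a j ≤ 2 * (a 0 + ∑' j, b j) := fun N => by
    have hB : 0 ≤ ∑' j, b j := tsum_nonneg hb
    induction N with
    | zero => simp; linarith [ha 0]
    | succ N ih =>
      rw [Finset.sum_range_succ']
      have h1 : ∑ j ∈ Finset.range N, a (j + 1) ≤ ∑ j ∈ Finset.range N, (1 / 2 * a j + b j) := Finset.sum_le_sum fun j _ => h j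
      rw [Finset.sum_add_distrib, ← Finset.mul_sum] at h1
      have h2 := hs.sum_le_tsum (Finset.range N) fun j _ => hb j
      linarith
  exact summable_of_sum_range_le ha key

/-- summability in Sobolev norms -/
def Summ {n : ℕ} (k : ℕ) (g : ℕ → 𝓢(EE n, ℂ)) : Prop := Summable fun j => Sob k (g j)

lemma Summ_succ {n k : ℕ} {g : ℕ → 𝓢(EE n, ℂ)} : Summ (k + 1) g ↔ Summ k g ∧ ∀ i, Summ k fun j => pd i (g j) := by
  constructor
  · intro h
    refine ⟨h.of_nonneg_of_le (fun j => Sob_nonneg _ _) fun j => ?_, fun i => h.of_nonneg_of_le (fun j => Sob_nonneg _ _) fun j => ?_⟩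
    · simp only [Sob]
      exact le_add_of_nonneg_right (Finset.sum_nonneg fun j _ => Sob_nonneg _ _)
    · simp only [Sob]
      exact (Finset.single_le_sum (f := fun i => Sob k (pd i (g j))) (fun _ _ => Sob_nonneg _ _) (Finset.mem_univ i)).trans
        (le_add_of_nonneg_left (Sob_nonneg _ _))
  · rintro ⟨h1, h2⟩
    exact Summable.add h1 (summable_sum fun i _ => h2 i)

lemma Summ_add {n k : ℕ} {f g : ℕ → 𝓢(EE n, ℂ)} (hf : Summ k f) (hg : Summ k g) : Summ k fun j => f j + g j :=
  (Summable.add hf hg).of_nonneg_of_le (fun j => Sob_nonneg _ _) fun j => Sob_add _ _ _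

section
variable {n : ℕ} (hn : 2 ≤ n) {e a : EE n} (he : ‖e‖ = 1) (hea : inner ℝ e a = 0) {s : ℝ} (hs : 1 ≤ s) {δ : ℝ} (h1 : -1 < δ) (h0 : δ < 0)
    {ρ : ℝ} (hρ : 0 ≤ ρ)

lemma nn_cG (hn : 2 ≤ n) (he : ‖e‖ = 1) (hea : inner ℝ e a = 0) (hs : 1 ≤ s) (h1 : -1 < δ) (h0 : δ < 0) (hρ : 0 ≤ ρ)
    {χ : 𝓢(EE n, ℂ)} (hχ : Sup ρ χ) {M : ℝ} (hM : ∀ x, ‖χ x‖ ≤ M) (hM0 : 0 ≤ M) (f : 𝓢(EE n, ℂ)) (hf : Sup ρ f) :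
    nn (cG e a s χ f) ≤ M * Bc n δ ρ / s * nn f := by
  have h5 := nn_nonneg f
  have h6 := Kc_nonneg n δ ρ
  refine (nn_cMul h0 hχ hM hM0 (GG_contDiff he (by linarith) f) (by positivity) (GG_est2 hn he hea hs h1 h0 hρ f hf)).trans (le_of_eq ?_)
  rw [Bc]; ring

lemma Summ_cG (hn : 2 ≤ n) (he : ‖e‖ = 1) (hea : inner ℝ e a = 0) (hs : 1 ≤ s) (h1 : -1 < δ) (h0 : δ < 0) (hρ : 0 ≤ ρ) (k : ℕ) :
    ∀ (χ : 𝓢(EE n, ℂ)) (g : ℕ → 𝓢(EE n, ℂ)), Sup ρ χ → (∀ j, Sup ρ (g j)) → Summ k g → Summ k fun j => cG e a s χ (g j) := by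
  induction k with
  | zero =>
    intro χ g hχ hg hS
    obtain ⟨M, hM0, hM⟩ := schwartz_bdd χ
    exact (Summable.mul_left (M * Bc n δ ρ / s) hS).of_nonneg_of_le (fun j => Sob_nonneg _ _)
      fun j => nn_cG hn he hea hs h1 h0 hρ hχ hM hM0.le _ (hg j)
  | succ k ih =>
    intro χ g hχ hg hS
    obtain ⟨hS1, hS2⟩ := Summ_succ.1 hS
    refine Summ_succ.2 ⟨ih _ _ hχ hg hS1, fun i => ?_⟩
    simp only [pd_cG he (by linarith : 0 < s) hχ]
    exact Summ_add (ih _ _ hχ (fun j => Sup_pd (hg j) i) (hS2 i)) (ih _ _ (Sup_pd hχ i) hg hS1)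

lemma Summ_rec (hn : 2 ≤ n) (he : ‖e‖ = 1) (hea : inner ℝ e a = 0) (hs : 1 ≤ s) (h1 : -1 < δ) (h0 : δ < 0) (hρ : 0 ≤ ρ)
    {p : 𝓢(EE n, ℂ)} (hp : Sup ρ p) {M : ℝ} (hM : ∀ x, ‖p x‖ ≤ M) (hM0 : 0 ≤ M) (hMs : M * Bc n δ ρ / s ≤ 1 / 2) (k : ℕ) :
    ∀ (g r : ℕ → 𝓢(EE n, ℂ)), (∀ j, Sup ρ (g j)) → (∀ j, g (j + 1) = cG e a s p (g j) + r j) → Summ k r → Summ k g := by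
  induction k with
  | zero =>
    intro g r hg hr hS
    refine summ_rec (fun j => Sob_nonneg _ _) (fun j => Sob_nonneg 0 (r j)) (fun j => ?_) hS
    rw [hr]
    refine (Sob_add 0 _ _).trans (add_le_add ?_ le_rfl)
    exact (nn_cG hn he hea hs h1 h0 hρ hp hM hM0 _ (hg j)).trans (mul_le_mul_of_nonneg_right hMs (nn_nonneg _))
  | succ k ih =>
    intro g r hg hr hS
    obtain ⟨hS1, hS2⟩ := Summ_succ.1 hS
    have h3 := ih g r hg hr hS1
    refine Summ_succ.2 ⟨h3, fun i => ?_⟩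
    refine ih _ (fun j => cG e a s (pd i p) (g j) + pd i (r j)) (fun j => Sup_pd (hg j) i) (fun j => ?_)
      (Summ_add (Summ_cG hn he hea hs h1 h0 hρ k _ _ (Sup_pd hp i) hg h3) (hS2 i))
    rw [hr, pd_add, pd_cG he (by linarith : 0 < s) hp, add_assoc]

end
end CGO

namespace CGO
open scoped FourierTransform SchwartzMap ENNReal ContDiff LineDeriv

/-- partial derivative of a function -/
noncomputable def DJ {n : ℕ} (j : Fin n) (u : EE n → ℂ) (x : EE n) : ℂ := fderiv ℝ u x (bb j)

/-- conjugated Laplacian -/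
noncomputable def Pf {n : ℕ} (e a : EE n) (s : ℝ) (u : EE n → ℂ) (x : EE n) : ℂ :=
  (∑ j, DJ j (DJ j u) x) + ∑ j, (2 * Complex.I * ((a j : ℂ) + Complex.I * s * (e j : ℂ))) * DJ j u x

/-- good sequences -/
def Good {n : ℕ} (ρ : ℝ) (g : ℕ → 𝓢(EE n, ℂ)) : Prop := (∀ k, Summ k g) ∧ ∀ j, Sup ρ (g j)

lemma Good_pd {n : ℕ} {ρ : ℝ} {g : ℕ → 𝓢(EE n, ℂ)} (h : Good ρ g) (i : Fin n) : Good ρ fun j => pd i (g j) :=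
  ⟨fun k => (Summ_succ.1 (h.1 (k + 1))).2 i, fun j => Sup_pd (h.2 j) i⟩

/-- the series -/
noncomputable def PS {n : ℕ} (e a : EE n) (s : ℝ) (g : ℕ → 𝓢(EE n, ℂ)) (x : EE n) : ℂ := ∑' j, GG e a s (g j) x

section
variable {n : ℕ} {e a : EE n} {s ρ : ℝ} {g : ℕ → 𝓢(EE n, ℂ)}

lemma PS_bd (he : ‖e‖ = 1) (hs : 0 < s) (hρ : 0 ≤ ρ) (hg : Good ρ g) :
    ∃ u : ℕ → ℝ, Summable u ∧ ∀ j x, ‖GG e a s (g j) x‖ ≤ u j := by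
  obtain ⟨C, hC, h⟩ := GG_sup (a := a) he hs hρ
  exact ⟨fun j => C * Sob (n + 1) (g j), (hg.1 (n + 1)).mul_left C, fun j x => h _ (hg.2 j) x⟩

lemma PS_summable (he : ‖e‖ = 1) (hs : 0 < s) (hρ : 0 ≤ ρ) (hg : Good ρ g) (x : EE n) :
    Summable fun j => GG e a s (g j) x := by
  obtain ⟨u, hu, h⟩ := PS_bd (a := a) he hs hρ hg
  exact hu.of_norm_bounded fun j => h j x

lemma PS_fderiv (he : ‖e‖ = 1) (hs : 0 < s) (hρ : 0 ≤ ρ) (hg : Good ρ g) (x : EE n) :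
    HasFDerivAt (PS e a s g) (DD fun i => PS e a s (fun j => pd i (g j)) x) x := by
  choose u hu h using fun i => PS_bd (a := a) he hs hρ (Good_pd hg i)
  have h1 : Summable fun j => ∑ i, u i j := summable_sum fun i _ => hu i
  have h2 : ∀ j x, ‖(DD fun i => GG e a s (pd i (g j)) x : EE n →L[ℝ] ℂ)‖ ≤ ∑ i, u i j := fun j x =>
    (DD_norm _).trans (Finset.sum_le_sum fun i _ => h i j x)
  have h3 := hasFDerivAt_tsum h1 (fun j x => GG_fderiv (a := a) he hs (g j) x) h2 (PS_summable he hs hρ hg x) x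
  refine h3.congr_fderiv ?_
  have h4 : Summable fun j => fun i => GG e a s (pd i (g j)) x :=
    Pi.summable.2 fun i => PS_summable he hs hρ (Good_pd hg i) x
  have h5 := DD.map_tsum h4
  rw [← h5]
  congr 1
  ext i
  rw [tsum_apply h4]
  rfl

lemma PS_DJ (he : ‖e‖ = 1) (hs : 0 < s) (hρ : 0 ≤ ρ) (hg : Good ρ g) (i : Fin n) :
    DJ i (PS e a s g) = PS e a s fun j => pd i (g j) := by
  ext x
  rw [DJ, (PS_fderiv he hs hρ hg x).fderiv, DD_bb]

lemma PS_contDiff (he : ‖e‖ = 1) (hs : 0 < s) (hρ : 0 ≤ ρ) (hg : Good ρ g) : ContDiff ℝ ∞ (PS e a s g) := by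
  have key : ∀ k : ℕ, ∀ g : ℕ → 𝓢(EE n, ℂ), Good ρ g → ContDiff ℝ k (PS e a s g) := by
    intro k
    induction k with
    | zero =>
      intro g hg
      exact contDiff_zero.2 (continuous_iff_continuousAt.2 fun x => (PS_fderiv he hs hρ hg x).continuousAt)
    | succ k ih =>
      intro g hg
      push_cast
      refine contDiff_succ_iff_fderiv.2 ⟨fun x => (PS_fderiv he hs hρ hg x).differentiableAt, by simp, ?_⟩
      have : fderiv ℝ (PS e a s g) = fun x => DD fun i => PS e a s (fun j => pd i (g j)) x := by
        ext1 x; exact (PS_fderiv he hs hρ hg x).fderiv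
      rw [this]
      exact DD.contDiff.comp (contDiff_pi.2 fun j => ih _ (Good_pd hg j))
  exact contDiff_infty.2 fun k => key k g hg

lemma GG_PP' (he : ‖e‖ = 1) (hea : inner ℝ e a = 0) (hs : 0 < s) (has : ‖a‖ = s) (f : 𝓢(EE n, ℂ)) (x : EE n) :
    (∑ j, GG e a s (pd j (pd j f)) x) + ∑ j, (2 * Complex.I * ((a j : ℂ) + Complex.I * s * (e j : ℂ))) * GG e a s (pd j f) x = f x := by
  conv_rhs => rw [← GG_PP he hea hs has f x]
  rw [PP, GG_add he hs, GG_sum he hs, GG_sum he hs]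
  simp only [GG_smul]

lemma GG_DJ (he : ‖e‖ = 1) (hs : 0 < s) (f : 𝓢(EE n, ℂ)) (i : Fin n) :
    DJ i (GG e a s f) = GG e a s (pd i f) := by
  ext x; exact GG_fderiv_apply he hs f x i

lemma GG_Pf (he : ‖e‖ = 1) (hea : inner ℝ e a = 0) (hs : 0 < s) (has : ‖a‖ = s) (f : 𝓢(EE n, ℂ)) (x : EE n) :
    Pf e a s (GG e a s f) x = f x := by
  rw [Pf]
  simp only [GG_DJ he hs]
  exact GG_PP' he hea hs has f x

lemma PS_Pf (he : ‖e‖ = 1) (hea : inner ℝ e a = 0) (hs : 0 < s) (has : ‖a‖ = s) (hρ : 0 ≤ ρ) (hg : Good ρ g) (x : EE n) :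
    HasSum (fun j => g j x) (Pf e a s (PS e a s g) x) := by
  have h1 : ∀ i, PS e a s (fun j => pd i (g j)) x = ∑' j, GG e a s (pd i (g j)) x := fun i => rfl
  have hS := fun {g} (hg : Good ρ g) => (PS_summable (a := a) he hs hρ hg x).hasSum
  rw [Pf]
  simp only [PS_DJ he hs hρ hg]
  have h2 : ∀ i, DJ i (PS e a s fun j => pd i (g j)) = PS e a s fun j => pd i (pd i (g j)) := fun i =>
    PS_DJ he hs hρ (Good_pd hg i) i
  simp only [h2]
  have h3 := (hasSum_sum (s := Finset.univ) fun i _ => hS (Good_pd (Good_pd hg i) i)).add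
    (hasSum_sum (s := Finset.univ) fun i _ => (hS (Good_pd hg i)).mul_left (2 * Complex.I * ((a i : ℂ) + Complex.I * s * (e i : ℂ))))
  convert h3 using 1
  · ext j
    exact (GG_PP' he hea hs has (g j) x).symm
  · rfl

/-- Neumann iterates -/
noncomputable def hh (e a : EE n) (s : ℝ) (p : 𝓢(EE n, ℂ)) : ℕ → 𝓢(EE n, ℂ)
  | 0 => p
  | j + 1 => cG e a s p (hh e a s p j)


lemma hh_Sup {p : 𝓢(EE n, ℂ)} (he : ‖e‖ = 1) (hs : 0 < s) (hp : Sup ρ p) (j : ℕ) : Sup ρ (hh e a s p j) := by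
  cases j with
  | zero => exact hp
  | succ j => exact Sup_cMul hp (GG_contDiff he hs _)

lemma Sob_zero (k : ℕ) : Sob k (0 : 𝓢(EE n, ℂ)) = 0 := by
  refine le_antisymm ?_ (Sob_nonneg k _)
  have := Sob_smul k 0 (0 : 𝓢(EE n, ℂ))
  simpa using this

lemma hh_Good (hn : 2 ≤ n) (he : ‖e‖ = 1) (hea : inner ℝ e a = 0) (hs : 1 ≤ s) {δ : ℝ} (h1 : -1 < δ) (h0 : δ < 0) (hρ : 0 ≤ ρ)
    {p : 𝓢(EE n, ℂ)} (hp : Sup ρ p) {M : ℝ} (hM : ∀ x, ‖p x‖ ≤ M) (hM0 : 0 ≤ M) (hMs : M * Bc n δ ρ / s ≤ 1 / 2) :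
    Good ρ (hh e a s p) := by
  have hS := fun j => hh_Sup (a := a) he (by linarith : 0 < s) hp j
  refine ⟨fun k => Summ_rec hn he hea hs h1 h0 hρ hp hM hM0 hMs k _ (fun _ => 0) hS (fun j => ?_) ?_, hS⟩
  · simp [hh]
  · simp only [Summ, Sob_zero]; exact summable_zero

lemma hh_nn (hn : 2 ≤ n) (he : ‖e‖ = 1) (hea : inner ℝ e a = 0) (hs : 1 ≤ s) {δ : ℝ} (h1 : -1 < δ) (h0 : δ < 0) (hρ : 0 ≤ ρ)
    {p : 𝓢(EE n, ℂ)} (hp : Sup ρ p) {M : ℝ} (hM : ∀ x, ‖p x‖ ≤ M) (hM0 : 0 ≤ M) (hMs : M * Bc n δ ρ / s ≤ 1 / 2) (j : ℕ) :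
    nn (hh e a s p j) ≤ (1 / 2) ^ j * nn p := by
  induction j with
  | zero => simp [hh]
  | succ j ih =>
    rw [hh]
    refine (nn_cG hn he hea hs h1 h0 hρ hp hM hM0 _ (hh_Sup he (by linarith : 0 < s) hp j)).trans ?_
    refine (mul_le_mul hMs ih (nn_nonneg _) (by norm_num)).trans (le_of_eq ?_)
    ring

/-- weighted measure -/
noncomputable def mW (n : ℕ) (δ : ℝ) : Measure (EE n) := volume.withDensity fun x => ENNReal.ofReal ((1 + ‖x‖ ^ 2) ^ δ)

lemma w_cont (n : ℕ) (δ : ℝ) : Continuous fun x : EE n => (1 + ‖x‖ ^ 2) ^ δ :=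
  Continuous.rpow_const (by fun_prop) fun x => Or.inl (by positivity)

lemma WN_eq {δ : ℝ} (f : EE n → ℂ) : WN δ f = eLpNorm f 2 (mW n δ) ^ 2 := by
  rw [← eL2, mW, lintegral_withDensity_eq_lintegral_mul_non_measurable _ (w_cont n δ).measurable.ennreal_ofReal
    (Filter.Eventually.of_forall fun x => ENNReal.ofReal_lt_top)]
  rfl

lemma WN_le_iff {δ A : ℝ} (hA : 0 ≤ A) (f : EE n → ℂ) : WN δ f ≤ ENNReal.ofReal (A ^ 2) ↔ eLpNorm f 2 (mW n δ) ≤ ENNReal.ofReal A := by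
  rw [WN_eq, ENNReal.ofReal_pow hA, ENNReal.pow_le_pow_left_iff (by norm_num)]

lemma PS_WN (hn : 2 ≤ n) (he : ‖e‖ = 1) (hea : inner ℝ e a = 0) (hs : 1 ≤ s) {δ : ℝ} (h1 : -1 < δ) (h0 : δ < 0) (hρ : 0 ≤ ρ)
    (hg : Good ρ g) {A : ℝ} (hA : ∀ N, ∑ j ∈ Finset.range N, nn (g j) ≤ A) :
    WN δ (PS e a s g) ≤ ENNReal.ofReal ((Kc n δ ρ / s * A) ^ 2) := by
  have hs0 : 0 < s := by linarith
  have hA0 : 0 ≤ A := by simpa using hA 0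
  have hK := Kc_nonneg n δ ρ
  rw [WN_le_iff (by positivity)]
  have hm : ∀ j, AEStronglyMeasurable (GG e a s (g j)) (mW n δ) := fun j => (GG_meas e a s (g j)).aestronglyMeasurable
  have hb : ∀ N, eLpNorm (∑ j ∈ Finset.range N, GG e a s (g j)) 2 (mW n δ) ≤ ENNReal.ofReal (Kc n δ ρ / s * A) := fun N => by
    refine (eLpNorm_sum_le (fun j _ => hm j) (by norm_num)).trans ?_
    calc _ ≤ ∑ j ∈ Finset.range N, ENNReal.ofReal (Kc n δ ρ / s * nn (g j)) := by
          refine Finset.sum_le_sum fun j _ => ?_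
          have := nn_nonneg (g j)
          exact (WN_le_iff (by positivity) _).1 (GG_est2 hn he hea hs h1 h0 hρ _ (hg.2 j))
      _ = ENNReal.ofReal (Kc n δ ρ / s * ∑ j ∈ Finset.range N, nn (g j)) := by
          rw [Finset.mul_sum, ENNReal.ofReal_sum_of_nonneg]
          intro j _
          have := nn_nonneg (g j)
          positivity
      _ ≤ _ := by
          refine ENNReal.ofReal_le_ofReal ?_
          have := hA N
          gcongr
  refine (Lp.eLpNorm_lim_le_liminf_eLpNorm (f := fun N => ∑ j ∈ Finset.range N, GG e a s (g j))
    (fun N => Finset.aestronglyMeasurable_sum _ fun j _ => hm j) _ (Filter.Eventually.of_forall fun x => ?_)).trans ?_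
  · simp only [Finset.sum_apply]
    exact (PS_summable he hs0 hρ hg x).hasSum.tendsto_sum_nat
  · refine (Filter.liminf_le_liminf (Filter.Eventually.of_forall hb)).trans ?_
    simp

/-- existence -/
lemma exist (hn : 2 ≤ n) (he : ‖e‖ = 1) (hea : inner ℝ e a = 0) (hs : 1 ≤ s) (has : ‖a‖ = s) {δ : ℝ} (h1 : -1 < δ) (h0 : δ < 0) (hρ : 0 ≤ ρ)
    {p : 𝓢(EE n, ℂ)} (hp : Sup ρ p) {M : ℝ} (hM : ∀ x, ‖p x‖ ≤ M) (hM0 : 0 ≤ M) (hMs : M * Bc n δ ρ / s ≤ 1 / 2) :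
    ∃ ψ : EE n → ℂ, ContDiff ℝ ∞ ψ ∧ WN δ ψ ≤ ENNReal.ofReal ((2 * Kc n δ ρ / s * nn p) ^ 2) ∧
      ∀ x, Pf e a s ψ x = p x + p x * ψ x := by
  have hs0 : 0 < s := by linarith
  have hg := hh_Good hn he hea hs h1 h0 hρ hp hM hM0 hMs
  refine ⟨PS e a s (hh e a s p), PS_contDiff he hs0 hρ hg, ?_, fun x => ?_⟩
  · have := PS_WN hn he hea hs h1 h0 hρ hg (A := 2 * nn p) fun N => by
      refine (Finset.sum_le_sum fun j _ => hh_nn hn he hea hs h1 h0 hρ hp hM hM0 hMs j).trans ?_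
      rw [← Finset.sum_mul]
      refine mul_le_mul_of_nonneg_right ?_ (nn_nonneg _)
      exact (Summable.sum_le_tsum _ (fun j _ => by positivity) summable_geometric_two).trans tsum_geometric_two.le
    refine this.trans (le_of_eq ?_)
    congr 2; ring
  · have h2 := PS_Pf he hea hs0 has hρ hg x
    have h3 : HasSum (fun j => hh e a s p j x) (p x + p x * PS e a s (hh e a s p) x) := by
      have h4 := (PS_summable (a := a) he hs0 hρ hg x).hasSum.mul_left (p x)
      refine (hasSum_nat_add_iff' 1).1 ?_
      have e1 : (fun j => hh e a s p (j + 1) x) = fun j => p x * GG e a s (hh e a s p j) x := by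
        ext j; rw [hh, cMul_apply hp (GG_contDiff he hs0 _)]
      have e2 : p x + p x * PS e a s (hh e a s p) x - ∑ i ∈ Finset.range 1, hh e a s p i x = p x * ∑' j, GG e a s (hh e a s p j) x := by
        simp [hh, PS]
      rw [e1, e2]
      exact h4
    exact h2.unique h3

end
end CGO

namespace CGO
open scoped FourierTransform SchwartzMap ENNReal ContDiff LineDeriv

/-- dilation -/
noncomputable def dil {n : ℕ} (c : ℝˣ) (f : 𝓢(EE n, ℂ)) : 𝓢(EE n, ℂ) :=
  SchwartzMap.compCLMOfContinuousLinearEquiv ℝ (ContinuousLinearEquiv.smulLeft c) f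

lemma dil_apply {n : ℕ} (c : ℝˣ) (f : 𝓢(EE n, ℂ)) (x : EE n) : dil c f x = f ((c : ℝ) • x) := rfl

lemma pd_dil {n : ℕ} (c : ℝˣ) (f : 𝓢(EE n, ℂ)) (j : Fin n) : pd j (dil c f) = ((c : ℝ) : ℂ) • dil c (pd j f) := by
  ext x
  have h1 : HasFDerivAt (fun x : EE n => (c : ℝ) • x) ((c : ℝ) • ContinuousLinearMap.id ℝ (EE n)) x :=
    (hasFDerivAt_id x).const_smul (c : ℝ)
  have h2 : HasFDerivAt (dil c f) _ x := (f.differentiableAt (x := (c : ℝ) • x)).hasFDerivAt.comp x h1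
  rw [pd_apply, h2.fderiv, smul_apply, dil_apply, pd_apply]
  simp

/-- cutoffs -/
lemma cutoffs (n : ℕ) : ∃ (M : ℝ) (χ : ℕ → 𝓢(EE n, ℂ)), 0 < M ∧ (∀ N : ℕ, Sup (2 * ((N : ℝ) + 1)) (χ N)) ∧
    (∀ N x, ‖χ N x‖ ≤ M) ∧ (∀ x, Filter.Tendsto (fun N => χ N x) Filter.atTop (nhds 1)) ∧
    (∀ j N x, ‖pd j (χ N) x‖ ≤ M / (N + 1)) ∧ (∀ j N x, ‖pd j (pd j (χ N)) x‖ ≤ M / (N + 1)) := by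
  let b : ContDiffBump (0 : EE n) := ⟨1, 2, by norm_num, by norm_num⟩
  have hb1 : HasCompactSupport fun x => ((b x : ℝ) : ℂ) := b.hasCompactSupport.comp_left (g := fun r : ℝ => (r : ℂ)) (by simp)
  have hb2 : ContDiff ℝ ∞ fun x => ((b x : ℝ) : ℂ) := Complex.ofRealCLM.contDiff.comp b.contDiff
  let f : 𝓢(EE n, ℂ) := hb1.toSchwartzMap hb2
  have hf : ∀ x, f x = ((b x : ℝ) : ℂ) := fun x => rfl
  have hfS : Sup 2 f := fun x hx => by
    rw [hf, b.zero_of_le_dist]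
    · simp
    · simpa [b] using hx.le
  obtain ⟨M0, hM0, h0⟩ := schwartz_bdd f
  choose M1 hM1 h1 using fun j => schwartz_bdd (pd j f)
  choose M2 hM2 h2 using fun j => schwartz_bdd (pd j (pd j f))
  have hM1' : 0 ≤ ∑ j, M1 j := Finset.sum_nonneg fun j _ => (hM1 j).le
  have hM2' : 0 ≤ ∑ j, M2 j := Finset.sum_nonneg fun j _ => (hM2 j).le
  have hs1 : ∀ j, M1 j ≤ ∑ j, M1 j := fun j => Finset.single_le_sum (f := M1) (fun j _ => (hM1 j).le) (Finset.mem_univ j)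
  have hs2 : ∀ j, M2 j ≤ ∑ j, M2 j := fun j => Finset.single_le_sum (f := M2) (fun j _ => (hM2 j).le) (Finset.mem_univ j)
  let c : ℕ → ℝˣ := fun N => Units.mk0 (((N : ℝ) + 1)⁻¹) (by positivity)
  have hc : ∀ N, ((c N : ℝˣ) : ℝ) = ((N : ℝ) + 1)⁻¹ := fun N => rfl
  have hc0 : ∀ N, 0 < ((c N : ℝˣ) : ℝ) := fun N => by rw [hc]; positivity
  have hc1 : ∀ N, ((c N : ℝˣ) : ℝ) ≤ 1 := fun N => by rw [hc]; exact inv_le_one_of_one_le₀ (by linarith [Nat.cast_nonneg (α := ℝ) N])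
  refine ⟨M0 + ∑ j, M1 j + ∑ j, M2 j, fun N => dil (c N) f, by positivity, fun N x hx => ?_, fun N x => ?_, fun x => ?_, fun j N x => ?_, fun j N x => ?_⟩
  · rw [dil_apply]
    refine hfS _ ?_
    rw [norm_smul, Real.norm_of_nonneg (hc0 N).le, hc, inv_mul_eq_div, lt_div_iff₀ (by positivity)]
    exact hx
  · rw [dil_apply]
    linarith [h0 ((c N : ℝ) • x)]
  · refine tendsto_const_nhds.congr' ?_
    obtain ⟨N0, hN0⟩ := exists_nat_ge ‖x‖
    filter_upwards [Filter.eventually_ge_atTop N0] with N hN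
    rw [dil_apply, hf, b.one_of_mem_closedBall]
    · simp
    · have : (N0 : ℝ) ≤ N := by exact_mod_cast hN
      simp only [mem_closedBall_zero_iff, b]
      rw [norm_smul, Real.norm_of_nonneg (hc0 N).le, hc, inv_mul_eq_div, div_le_one (by positivity)]
      linarith
  · rw [pd_dil, smul_apply, norm_smul, Complex.norm_real, Real.norm_of_nonneg (hc0 N).le, dil_apply, div_eq_inv_mul, hc]
    gcongr
    linarith [h1 j (((N:ℝ)+1)⁻¹ • x), hs1 j]
  · rw [pd_dil, pd_smul, pd_dil, smul_apply, smul_apply, norm_smul, norm_smul, Complex.norm_real, Real.norm_of_nonneg (hc0 N).le, dil_apply, div_eq_inv_mul]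
    have e1 : (c N : ℝ) * ‖pd j (pd j f) ((c N : ℝ) • x)‖ ≤ ‖pd j (pd j f) ((c N : ℝ) • x)‖ := mul_le_of_le_one_left (norm_nonneg _) (hc1 N)
    rw [← hc N]
    refine mul_le_mul_of_nonneg_left ?_ (hc0 N).le
    linarith [h2 j ((c N : ℝ) • x), hs2 j]

lemma DJ_contDiff {n : ℕ} {u : EE n → ℂ} (hu : ContDiff ℝ ∞ u) (j : Fin n) : ContDiff ℝ ∞ (DJ j u) :=
  (hu.fderiv_right (m := ∞) (by simp)).clm_apply contDiff_const

lemma int_cs {n : ℕ} {ρ : ℝ} {w : EE n → ℂ} (hw : Continuous w) {φ : 𝓢(EE n, ℂ)} (h : Sup ρ φ) : Integrable fun x => w x * φ x :=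
  (hw.mul φ.continuous).integrable_of_hasCompactSupport (Sup_cs h).mul_left

lemma ibp {n : ℕ} {ρ : ℝ} {w : EE n → ℂ} (hw : ContDiff ℝ ∞ w) {φ : 𝓢(EE n, ℂ)} (h : Sup ρ φ) (j : Fin n) :
    ∫ x, w x * pd j φ x = - ∫ x, DJ j w x * φ x := by
  simp only [pd_apply, DJ]
  refine integral_mul_fderiv_eq_neg_fderiv_mul_of_integrable ?_ ?_ ?_ ?_ ?_
  · exact int_cs (DJ_contDiff hw j).continuous h
  · simp only [← pd_apply]; exact int_cs hw.continuous (Sup_pd h j)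
  · exact int_cs hw.continuous h
  · exact fun x _ => hw.differentiable (by simp) x
  · exact fun x _ => φ.differentiableAt

lemma PP_apply {n : ℕ} (e a : EE n) (s : ℝ) (f : 𝓢(EE n, ℂ)) (x : EE n) :
    PP e a s f x = (∑ j, pd j (pd j f) x) + ∑ j, (2 * Complex.I * ((a j : ℂ) + Complex.I * s * (e j : ℂ))) * pd j f x := by
  rw [PP, add_apply, sum_apply, sum_apply]
  rfl

lemma transp {n : ℕ} {e a : EE n} {s ρ : ℝ} {w : EE n → ℂ} (hw : ContDiff ℝ ∞ w) {φ : 𝓢(EE n, ℂ)} (h : Sup ρ φ) :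
    ∫ x, w x * PP (-e) (-a) s φ x = ∫ x, Pf e a s w x * φ x := by
  have i1 : ∀ j, Integrable fun x => w x * pd j (pd j φ) x := fun j => int_cs hw.continuous (Sup_pd (Sup_pd h j) j)
  have i2 : ∀ j, Integrable fun x => w x * pd j φ x := fun j => int_cs hw.continuous (Sup_pd h j)
  have i3 : ∀ j, Integrable fun x => DJ j (DJ j w) x * φ x := fun j => int_cs (DJ_contDiff (DJ_contDiff hw j) j).continuous h
  have i4 : ∀ j, Integrable fun x => DJ j w x * φ x := fun j => int_cs (DJ_contDiff hw j).continuous h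
  let c : Fin n → ℂ := fun j => 2 * Complex.I * ((a j : ℂ) + Complex.I * s * (e j : ℂ))
  have e1 : ∀ x, w x * PP (-e) (-a) s φ x = (∑ j, w x * pd j (pd j φ) x) + ∑ j, (-c j) * (w x * pd j φ x) := fun x => by
    rw [PP_apply, mul_add, Finset.mul_sum, Finset.mul_sum]
    congr 1
    refine Finset.sum_congr rfl fun j _ => ?_
    simp [c]; ring
  have e2 : ∀ x, Pf e a s w x * φ x = (∑ j, DJ j (DJ j w) x * φ x) + ∑ j, c j * (DJ j w x * φ x) := fun x => by
    rw [Pf, add_mul, Finset.sum_mul, Finset.sum_mul]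
    congr 1
    refine Finset.sum_congr rfl fun j _ => ?_
    simp [c]; ring
  simp only [e1, e2]
  rw [integral_add (integrable_finsetSum _ fun j _ => i1 j) (integrable_finsetSum _ fun j _ => (i2 j).const_mul _),
    integral_add (integrable_finsetSum _ fun j _ => i3 j) (integrable_finsetSum _ fun j _ => (i4 j).const_mul _),
    integral_finsetSum _ fun j _ => i1 j, integral_finsetSum _ fun j _ => i3 j,
    integral_finsetSum _ fun j _ => (i2 j).const_mul _, integral_finsetSum _ fun j _ => (i4 j).const_mul _]
  congr 1
  · refine Finset.sum_congr rfl fun j _ => ?_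
    rw [ibp hw (Sup_pd h j) j, ibp (DJ_contDiff hw j) h j, neg_neg]
  · refine Finset.sum_congr rfl fun j _ => ?_
    rw [integral_const_mul, integral_const_mul, ibp hw h j]
    ring

end CGO

namespace CGO
open scoped FourierTransform SchwartzMap ENNReal ContDiff LineDeriv

section
variable {n : ℕ}

lemma WN_int {δ : ℝ} {w : EE n → ℂ} (hw : Continuous w) (h : WN δ w < ⊤) : Integrable fun x => (1 + ‖x‖ ^ 2) ^ δ * ‖w x‖ ^ 2 := by
  refine ⟨((w_cont n δ).mul (hw.norm.pow 2)).aestronglyMeasurable, ?_⟩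
  rw [hasFiniteIntegral_iff_ofReal (Filter.Eventually.of_forall fun x => by positivity)]
  refine lt_of_eq_of_lt ?_ h
  refine lintegral_congr fun x => ?_
  rw [ENNReal.ofReal_mul (by positivity), ENNReal.ofReal_pow (norm_nonneg _), ofReal_norm]

lemma wv_int {δ : ℝ} {w v : EE n → ℂ} (hw : Continuous w) (hv : Continuous v) (h : WN δ w < ⊤) (h' : WN (-1 - δ) v < ⊤) :
    Integrable fun x => (1 + ‖x‖)⁻¹ * (‖w x‖ * ‖v x‖) := by
  have hc : Continuous fun x : EE n => (1 + ‖x‖)⁻¹ * (‖w x‖ * ‖v x‖) :=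
    (Continuous.inv₀ (by fun_prop) fun x => by positivity).mul (hw.norm.mul hv.norm)
  refine ((WN_int hw h).add (WN_int hv h')).mono' hc.aestronglyMeasurable (Filter.Eventually.of_forall fun x => ?_)
  rw [Real.norm_of_nonneg (by positivity), Pi.add_apply]
  set t := 1 + ‖x‖ ^ 2 with ht
  have ht0 : 0 < t := by positivity
  have e1 : (1 + ‖x‖)⁻¹ ≤ t ^ (δ / 2) * t ^ ((-1 - δ) / 2) := by
    rw [← Real.rpow_add ht0, show δ / 2 + (-1 - δ) / 2 = -(1 / 2) by ring, Real.rpow_neg ht0.le, ← Real.sqrt_eq_rpow]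
    refine inv_anti₀ (Real.sqrt_pos.2 ht0) ?_
    rw [Real.sqrt_le_left (by positivity)]
    nlinarith [norm_nonneg x]
  have e2 : ∀ r : ℝ, t ^ r = (t ^ (r / 2)) ^ 2 := fun r => by
    rw [← Real.rpow_natCast, ← Real.rpow_mul ht0.le]; congr 1; push_cast; ring
  rw [e2 δ, e2 (-1 - δ)]
  calc _ ≤ t ^ (δ / 2) * t ^ ((-1 - δ) / 2) * (‖w x‖ * ‖v x‖) := by gcongr
    _ ≤ _ := by nlinarith [sq_nonneg (t ^ (δ / 2) * ‖w x‖ - t ^ ((-1 - δ) / 2) * ‖v x‖), sq_nonneg (t ^ (δ / 2) * ‖w x‖), sq_nonneg (t ^ ((-1 - δ) / 2) * ‖v x‖)]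

lemma PP_cG {e a : EE n} (he : ‖e‖ = 1) (hea : inner ℝ e a = 0) {s : ℝ} (hs : 0 < s) (has : ‖a‖ = s) {ρ : ℝ} {χ : 𝓢(EE n, ℂ)} (hχ : Sup ρ χ)
    (g : 𝓢(EE n, ℂ)) (x : EE n) : PP e a s (cG e a s χ g) x = χ x * g x +
      ((∑ j, (2 * pd j χ x * GG e a s (pd j g) x + pd j (pd j χ) x * GG e a s g x)) +
        ∑ j, (2 * Complex.I * ((a j : ℂ) + Complex.I * s * (e j : ℂ))) * (pd j χ x * GG e a s g x)) := by
  have hG := fun f => GG_contDiff (a := a) he hs f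
  rw [PP_apply]
  have h1 : ∀ j, pd j (cG e a s χ g) x = χ x * GG e a s (pd j g) x + pd j χ x * GG e a s g x := fun j => by
    rw [pd_cG he hs hχ, add_apply, cMul_apply hχ (hG _), cMul_apply (Sup_pd hχ j) (hG _)]
  have h2 : ∀ j, pd j (pd j (cG e a s χ g)) x = χ x * GG e a s (pd j (pd j g)) x +
      (2 * pd j χ x * GG e a s (pd j g) x + pd j (pd j χ) x * GG e a s g x) := fun j => by
    rw [pd_cG he hs hχ, pd_add, pd_cG he hs hχ, pd_cG he hs (Sup_pd hχ j), add_apply, add_apply, add_apply, cMul_apply hχ (hG _),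
      cMul_apply (Sup_pd hχ j) (hG _), cMul_apply (Sup_pd (Sup_pd hχ j) j) (hG _)]
    ring
  simp only [h1, h2]
  conv_rhs => rw [← GG_PP' he hea hs has g x]
  rw [mul_add, Finset.mul_sum, Finset.mul_sum]
  simp only [← Finset.sum_add_distrib]
  refine Finset.sum_congr rfl fun j _ => ?_
  ring

lemma homog (hn : 2 ≤ n) {e a : EE n} (he : ‖e‖ = 1) (hea : inner ℝ e a = 0) {s : ℝ} (hs : 1 ≤ s) (has : ‖a‖ = s) {δ : ℝ} (h1 : -1 < δ) (h0 : δ < 0)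
    {w : EE n → ℂ} (hw : ContDiff ℝ ∞ w) (hW : WN δ w < ⊤) (hP : ∀ x, Pf e a s w x = 0) {ρ : ℝ} (hρ : 0 ≤ ρ) (g : 𝓢(EE n, ℂ)) (hg : Sup ρ g) :
    ∫ x, w x * g x = 0 := by
  have hs0 : 0 < s := by linarith
  have he' : ‖-e‖ = 1 := by rwa [norm_neg]
  have hea' : inner ℝ (-e) (-a) = 0 := by rwa [inner_neg_neg]
  have has' : ‖-a‖ = s := by rwa [norm_neg]
  obtain ⟨M, χ, hM, hχS, hχb, hχ1, hχd, hχdd⟩ := cutoffs n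
  let v := GG (-e) (-a) s g
  let V := fun j => GG (-e) (-a) s (pd j g)
  let c : Fin n → ℂ := fun j => 2 * Complex.I * (((-a) j : ℂ) + Complex.I * s * ((-e) j : ℂ))
  let RN := fun (N : ℕ) x => (∑ j, (2 * pd j (χ N) x * V j x + pd j (pd j (χ N)) x * v x)) + ∑ j, c j * (pd j (χ N) x * v x)
  let B := fun x => (∑ j, (2 * ‖V j x‖ + ‖v x‖)) + ∑ j, ‖c j‖ * ‖v x‖
  have hB0 : ∀ x, 0 ≤ B x := fun x => by positivity
  have hv : ContDiff ℝ ∞ v := GG_contDiff he' hs0 g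
  have hV : ∀ j, ContDiff ℝ ∞ (V j) := fun j => GG_contDiff he' hs0 _
  have hWv : WN (-1 - δ) v < ⊤ :=
    (GG_est2 hn he' hea' hs (by linarith) (by linarith) hρ g hg).trans_lt ENNReal.ofReal_lt_top
  have hWV : ∀ j, WN (-1 - δ) (V j) < ⊤ := fun j =>
    (GG_est2 hn he' hea' hs (by linarith) (by linarith) hρ _ (Sup_pd hg j)).trans_lt ENNReal.ofReal_lt_top
  have hBi : Integrable fun x => (1 + ‖x‖)⁻¹ * (‖w x‖ * B x) := by
    have i1 := wv_int hw.continuous hv.continuous hW hWv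
    have i2 := fun j => wv_int hw.continuous (hV j).continuous hW (hWV j)
    have i3 := (integrable_finsetSum (Finset.univ : Finset (Fin n)) fun j _ => ((i2 j).const_mul 2).add i1).add
      (integrable_finsetSum (Finset.univ : Finset (Fin n)) fun j _ => i1.const_mul ‖c j‖)
    refine i3.congr (Filter.Eventually.of_forall fun x => ?_)
    simp only [Pi.add_apply, B, mul_add, Finset.mul_sum]
    congr 1
    · exact Finset.sum_congr rfl fun j _ => by ring
    · exact Finset.sum_congr rfl fun j _ => by ring
  have hR1 : ∀ (N : ℕ) x, ‖RN N x‖ ≤ M / (N + 1) * B x := fun N x => by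
    refine (norm_add_le _ _).trans ?_
    simp only [B, mul_add, Finset.mul_sum]
    refine add_le_add ((norm_sum_le _ _).trans (Finset.sum_le_sum fun j _ => ?_)) ((norm_sum_le _ _).trans (Finset.sum_le_sum fun j _ => ?_))
    · refine (norm_add_le _ _).trans ?_
      rw [norm_mul, norm_mul, norm_mul, Complex.norm_ofNat]
      have := hχd j N x
      have := hχdd j N x
      have e1 : 2 * ‖pd j (χ N) x‖ * ‖V j x‖ ≤ 2 * (M / (N + 1)) * ‖V j x‖ := by gcongr
      have e2 : ‖pd j (pd j (χ N)) x‖ * ‖v x‖ ≤ M / (N + 1) * ‖v x‖ := by gcongr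
      linarith
    · have := hχd j N x
      rw [norm_mul (c j), norm_mul (pd j (χ N) x)]
      calc _ ≤ ‖c j‖ * (M / (N + 1) * ‖v x‖) := by gcongr
        _ = _ := by ring
  have hR2 : ∀ (N : ℕ) x, ‖RN N x‖ ≤ 3 * M * ((1 + ‖x‖)⁻¹ * B x) := fun N x => by
    have hB := hB0 x
    by_cases hx : 2 * ((N : ℝ) + 1) < ‖x‖
    · have : RN N x = 0 := by
        simp only [RN, Sup_pd (hχS N) _ x hx, Sup_pd (Sup_pd (hχS N) _) _ x hx]
        simp
      rw [this, norm_zero]; positivity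
    · push Not at hx
      refine (hR1 N x).trans ?_
      have : M / (N + 1) ≤ 3 * M * (1 + ‖x‖)⁻¹ := by
        rw [← div_eq_mul_inv, div_le_div_iff₀ (by positivity) (by positivity)]
        nlinarith [Nat.cast_nonneg (α := ℝ) N]
      calc _ ≤ 3 * M * (1 + ‖x‖)⁻¹ * B x := by gcongr
        _ = _ := by ring
  have hRc : ∀ N, Continuous (RN N) := fun N => by
    have h2 := hv.continuous
    have h3 := fun j => (hV j).continuous
    refine Continuous.add (continuous_finsetSum _ fun j _ => ?_) (continuous_finsetSum _ fun j _ => ?_)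
    · exact ((continuous_const.mul (pd j (χ N)).continuous).mul (h3 j)).add ((pd j (pd j (χ N))).continuous.mul h2)
    · exact continuous_const.mul ((pd j (χ N)).continuous.mul h2)
  have hbd : ∀ N x, ‖w x * RN N x‖ ≤ 3 * M * ((1 + ‖x‖)⁻¹ * (‖w x‖ * B x)) := fun N x => by
    rw [norm_mul]
    calc _ ≤ ‖w x‖ * (3 * M * ((1 + ‖x‖)⁻¹ * B x)) := by gcongr; exact hR2 N x
      _ = _ := by ring
  have T1 : Filter.Tendsto (fun N => ∫ x, w x * RN N x) Filter.atTop (nhds (∫ x : EE n, (0:ℂ))) := by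
    refine tendsto_integral_of_dominated_convergence _ (fun N => (hw.continuous.mul (hRc N)).aestronglyMeasurable) (hBi.const_mul (3 * M))
      (fun N => Filter.Eventually.of_forall (hbd N)) (Filter.Eventually.of_forall fun x => ?_)
    have t1 : Filter.Tendsto (fun N : ℕ => M / ((N : ℝ) + 1)) Filter.atTop (nhds 0) := by
      have := (tendsto_one_div_add_atTop_nhds_zero_nat (𝕜 := ℝ)).const_mul M
      simpa [div_eq_mul_inv] using this
    have t2 : Filter.Tendsto (fun N : ℕ => M / ((N : ℝ) + 1) * B x) Filter.atTop (nhds 0) := by simpa using t1.mul_const (B x)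
    have t3 : Filter.Tendsto (fun N : ℕ => RN N x) Filter.atTop (nhds 0) := squeeze_zero_norm (fun N => hR1 N x) t2
    simpa using t3.const_mul (w x)
  have T2 : Filter.Tendsto (fun N => ∫ x, w x * (χ N x * g x)) Filter.atTop (nhds (∫ x, w x * (1 * g x))) := by
    refine tendsto_integral_of_dominated_convergence (fun x => M * ‖w x * g x‖)
      (fun N => (hw.continuous.mul ((χ N).continuous.mul g.continuous)).aestronglyMeasurable) ((int_cs hw.continuous hg).norm.const_mul M)
      (fun N => Filter.Eventually.of_forall fun x => ?_) (Filter.Eventually.of_forall fun x => ((hχ1 x).mul_const _).const_mul _)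
    rw [norm_mul, norm_mul, norm_mul]
    calc _ ≤ ‖w x‖ * (M * ‖g x‖) := by gcongr; exact hχb N x
      _ = _ := by ring
  have hE : ∀ N, ∫ x, w x * (χ N x * g x) = - ∫ x, w x * RN N x := fun N => by
    have hφS := Sup_cMul (hχS N) hv
    have h3 := transp (e := e) (a := a) (s := s) hw hφS
    simp only [hP, zero_mul, integral_zero] at h3
    have h4 : ∀ x, PP (-e) (-a) s (cMul (χ N) v) x = χ N x * g x + RN N x := fun x => PP_cG he' hea' hs0 has' (hχS N) g x
    simp only [h4, mul_add] at h3
    rw [integral_add] at h3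
    · exact eq_neg_of_add_eq_zero_left h3
    · have := int_cs (hw.continuous.mul (χ N).continuous) hg
      simpa [mul_assoc] using this
    · exact (hBi.const_mul (3 * M)).mono' (hw.continuous.mul (hRc N)).aestronglyMeasurable (Filter.Eventually.of_forall (hbd N))
  simp only [hE, one_mul] at T2
  have T3 := tendsto_nhds_unique T2 T1.neg
  simpa using T3

lemma homog0 (hn : 2 ≤ n) {e a : EE n} (he : ‖e‖ = 1) (hea : inner ℝ e a = 0) {s : ℝ} (hs : 1 ≤ s) (has : ‖a‖ = s) {δ : ℝ} (h1 : -1 < δ) (h0 : δ < 0)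
    {w : EE n → ℂ} (hw : ContDiff ℝ ∞ w) (hW : WN δ w < ⊤) (hP : ∀ x, Pf e a s w x = 0) : w = 0 := by
  refine (Continuous.ae_eq_iff_eq volume hw.continuous continuous_const).1 ?_
  refine ae_eq_zero_of_integral_contDiff_smul_eq_zero hw.continuous.locallyIntegrable fun g hg hgc => ?_
  have hb1 : HasCompactSupport fun x => ((g x : ℝ) : ℂ) := hgc.comp_left (g := fun r : ℝ => (r : ℂ)) (by simp)
  have hb2 : ContDiff ℝ ∞ fun x => ((g x : ℝ) : ℂ) := Complex.ofRealCLM.contDiff.comp hg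
  obtain ⟨ρ, hρ⟩ := hb1.isCompact.isBounded.subset_closedBall 0
  have hS : Sup (max ρ 0) (hb1.toSchwartzMap hb2) := fun x hx => by
    change (fun x => ((g x : ℝ) : ℂ)) x = 0
    refine image_eq_zero_of_notMem_tsupport (f := fun x => ((g x : ℝ) : ℂ)) fun h => ?_
    have := hρ h
    rw [mem_closedBall_zero_iff] at this
    exact absurd ((le_max_left ρ 0).trans_lt hx) (not_lt.2 this)
  have := homog hn he hea hs has h1 h0 hw hW hP (le_max_right ρ 0) _ hS
  rw [← this]
  refine integral_congr_ae (Filter.Eventually.of_forall fun x => ?_)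
  change g x • w x = w x * (g x : ℂ)
  rw [Complex.real_smul, mul_comm]

lemma Pf_sub {e a : EE n} {s : ℝ} {u v : EE n → ℂ} (hu : ContDiff ℝ ∞ u) (hv : ContDiff ℝ ∞ v) (x : EE n) :
    Pf e a s (u - v) x = Pf e a s u x - Pf e a s v x := by
  have h : ∀ {u v : EE n → ℂ}, ContDiff ℝ ∞ u → ContDiff ℝ ∞ v → ∀ j, DJ j (u - v) = DJ j u - DJ j v := fun hu hv j => by
    ext x
    rw [DJ, fderiv_sub (hu.differentiable (by simp) x) (hv.differentiable (by simp) x)]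
    rfl
  simp only [Pf, h hu hv, h (DJ_contDiff hu _) (DJ_contDiff hv _), Pi.sub_apply, mul_sub, Finset.sum_sub_distrib]
  ring

lemma WN_sub {δ : ℝ} {u v : EE n → ℂ} (hu : Continuous u) (hv : Continuous v) (h1 : WN δ u < ⊤) (h2 : WN δ v < ⊤) : WN δ (u - v) < ⊤ := by
  rw [WN_eq] at *
  have h3 : ∀ x : ℝ≥0∞, x ^ 2 < ⊤ → x < ⊤ := fun x hx => by
    by_contra h
    simp only [not_lt, top_le_iff] at h
    simp [h] at hx
  refine ENNReal.pow_lt_top ?_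
  exact (eLpNorm_sub_le hu.aestronglyMeasurable hv.aestronglyMeasurable (by norm_num)).trans_lt
    (ENNReal.add_lt_top.2 ⟨h3 _ h1, h3 _ h2⟩)

/-- uniqueness -/
lemma uniq (hn : 2 ≤ n) {e a : EE n} (he : ‖e‖ = 1) (hea : inner ℝ e a = 0) {s : ℝ} (hs : 1 ≤ s) (has : ‖a‖ = s) {δ : ℝ} (h1 : -1 < δ) (h0 : δ < 0)
    {ρ : ℝ} (hρ : 0 ≤ ρ)
    {p : 𝓢(EE n, ℂ)} (hp : Sup ρ p) {M : ℝ} (hM : ∀ x, ‖p x‖ ≤ M) (hM0 : 0 ≤ M) (hMs : M * Bc n δ ρ / s ≤ 1 / 2)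
    {ψ₁ ψ₂ : EE n → ℂ} (hc1 : ContDiff ℝ ∞ ψ₁) (hc2 : ContDiff ℝ ∞ ψ₂) (hW1 : WN δ ψ₁ < ⊤) (hW2 : WN δ ψ₂ < ⊤)
    (hP1 : ∀ x, Pf e a s ψ₁ x = p x + p x * ψ₁ x) (hP2 : ∀ x, Pf e a s ψ₂ x = p x + p x * ψ₂ x) : ψ₁ = ψ₂ := by
  have hs0 : 0 < s := by linarith
  set w := ψ₁ - ψ₂ with hw
  have hwc : ContDiff ℝ ∞ w := hc1.sub hc2
  have hwW : WN δ w < ⊤ := WN_sub hc1.continuous hc2.continuous hW1 hW2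
  have hwP : ∀ x, Pf e a s w x = p x * w x := fun x => by
    rw [hw, Pf_sub hc1 hc2, hP1, hP2, Pi.sub_apply]; ring
  set f := cMul p w with hf
  have hfS : Sup ρ f := Sup_cMul hp hwc
  have hGc := GG_contDiff (a := a) he hs0 f
  have hu : w - GG e a s f = 0 := by
    refine homog0 hn he hea hs has h1 h0 (hwc.sub hGc) (WN_sub hwc.continuous hGc.continuous hwW
      ((GG_est2 hn he hea hs h1 h0 hρ f hfS).trans_lt ENNReal.ofReal_lt_top)) fun x => ?_
    rw [Pf_sub hwc hGc, hwP, GG_Pf he hea hs0 has, hf, cMul_apply hp hwc, sub_self]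
  have hwG : w = GG e a s f := sub_eq_zero.1 hu
  have hnf : nn f ≤ 1 / 2 * nn f := by
    have h5 := nn_cG hn he hea hs h1 h0 hρ hp hM hM0 f hfS
    rw [cG, ← hwG] at h5
    exact h5.trans (mul_le_mul_of_nonneg_right hMs (nn_nonneg _))
  have hn0 : nn f = 0 := le_antisymm (by linarith) (nn_nonneg f)
  have hf0 : f = 0 := by
    refine SchwartzMap.injective_toLp 2 volume ?_
    have h6 : f.toLp 2 volume = 0 := norm_eq_zero.1 hn0
    have h7 : (0 : 𝓢(EE n, ℂ)).toLp 2 volume = 0 := by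
      refine norm_eq_zero.1 ?_
      exact Sob_zero 0
    simp only [h6, h7]
  rw [hf0] at hwG
  refine sub_eq_zero.1 ?_
  rw [← hw, hwG]
  ext x
  exact GG_zero e a s x

end
end CGO

namespace CGO
open scoped FourierTransform SchwartzMap ENNReal ContDiff LineDeriv

/-- identification -/
noncomputable abbrev LL (n : ℕ) : EE n ≃L[ℝ] (Fin n → ℝ) := EuclideanSpace.equiv (Fin n) ℝ

section
variable {n : ℕ}

lemma LL_apply (x : EE n) (i : Fin n) : LL n x i = x i := rfl

lemma pdC_LL (f : (Fin n → ℝ) → ℂ) (i : Fin n) : pdC f i ∘ LL n = DJ i (f ∘ LL n) := by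
  ext x
  rw [DJ, (LL n).comp_right_fderiv]
  simp only [Function.comp, pdC, ContinuousLinearMap.comp_apply, ContinuousLinearEquiv.coe_coe]
  congr 1

lemma lapC_LL (f : (Fin n → ℝ) → ℂ) (x : EE n) : lapC f (LL n x) = ∑ i, DJ i (DJ i (f ∘ LL n)) x := by
  rw [lapC]
  refine Finset.sum_congr rfl fun i _ => ?_
  rw [← pdC_LL, ← pdC_LL]
  rfl

/-- exponential -/
noncomputable def EX (ζ : Fin n → ℂ) (x : EE n) : ℂ := Complex.exp (Complex.I * ∑ i, ζ i * (x i : ℂ))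

lemma EX_fderiv (ζ : Fin n → ℂ) (x : EE n) : HasFDerivAt (EX ζ) (DD fun j => Complex.I * ζ j * EX ζ x) x := by
  have h1 : HasFDerivAt (fun x : EE n => Complex.I * ∑ i, ζ i * (x i : ℂ)) (DD fun j => Complex.I * ζ j) x := by
    have : (fun x : EE n => Complex.I * ∑ i, ζ i * (x i : ℂ)) = DD fun j => Complex.I * ζ j := by
      ext x; rw [DD_apply, Finset.mul_sum]; exact Finset.sum_congr rfl fun j _ => by ring
    rw [this]; exact ContinuousLinearMap.hasFDerivAt _
  refine h1.cexp.congr_fderiv ?_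
  ext v
  simp only [smul_apply, DD_apply, smul_eq_mul, Finset.mul_sum, EX]
  exact Finset.sum_congr rfl fun j _ => by ring

lemma EX_contDiff (ζ : Fin n → ℂ) : ContDiff ℝ ∞ (EX ζ) := by
  have : (fun x : EE n => Complex.I * ∑ i, ζ i * (x i : ℂ)) = DD fun j => Complex.I * ζ j := by
    ext x; rw [DD_apply, Finset.mul_sum]; exact Finset.sum_congr rfl fun j _ => by ring
  have h : ContDiff ℝ ∞ (fun x : EE n => Complex.I * ∑ i, ζ i * (x i : ℂ)) := by rw [this]; exact ContinuousLinearMap.contDiff _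
  exact h.cexp

lemma DJ_EX (ζ : Fin n → ℂ) {u : EE n → ℂ} (hu : ContDiff ℝ ∞ u) (j : Fin n) :
    DJ j (EX ζ * u) = EX ζ * (fun x => Complex.I * ζ j * u x + DJ j u x) := by
  ext x
  rw [DJ, ((EX_fderiv ζ x).mul (hu.differentiable (by simp) x).hasFDerivAt).fderiv]
  simp only [add_apply, smul_apply, DD_bb, smul_eq_mul, Pi.mul_apply, DJ]
  ring

lemma DJ_lin {u : EE n → ℂ} (hu : ContDiff ℝ ∞ u) (c : ℂ) (j : Fin n) (x : EE n) :
    DJ j (fun x => c * u x + DJ j u x) x = c * DJ j u x + DJ j (DJ j u) x := by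
  have h1 := ((hu.differentiable (by simp) x).hasFDerivAt.const_mul c).add ((DJ_contDiff hu j).differentiable (by simp) x).hasFDerivAt
  rw [DJ]
  have h2 := h1.fderiv
  change fderiv ℝ (fun x => c * u x + DJ j u x) x = _ at h2
  rw [h2]
  rfl

lemma DJ_one {u : EE n → ℂ} (j : Fin n) : DJ j (fun x => 1 + u x) = DJ j u := by
  ext x
  rw [DJ, fderiv_const_add]
  rfl

lemma cgo_eq {ζ : Fin n → ℂ} (hζ : ∑ i, ζ i ^ 2 = 0) {e a : EE n} {s : ℝ} (hz : ∀ j, ζ j = (a j : ℂ) + Complex.I * s * (e j : ℂ))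
    {ψ : (Fin n → ℝ) → ℂ} (hψ : ContDiff ℝ ∞ ψ) (q : (Fin n → ℝ) → ℂ) (x : EE n) :
    lapC (cgoSol ζ ψ) (LL n x) + q (LL n x) * cgoSol ζ ψ (LL n x) =
      EX ζ x * (Pf e a s (ψ ∘ LL n) x + q (LL n x) * (1 + ψ (LL n x))) := by
  have hu : ContDiff ℝ ∞ (ψ ∘ LL n) := hψ.comp (LL n).contDiff
  have hu1 : ContDiff ℝ ∞ (fun x => 1 + (ψ ∘ LL n) x) := contDiff_const.add hu
  have e0 : cgoSol ζ ψ ∘ LL n = EX ζ * (fun x => 1 + (ψ ∘ LL n) x) := rfl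
  rw [lapC_LL, e0]
  have e1 : ∀ j, DJ j (DJ j (EX ζ * fun x => 1 + (ψ ∘ LL n) x)) x =
      EX ζ x * (- (ζ j ^ 2) * (1 + ψ (LL n x)) + (2 * Complex.I * ζ j * DJ j (ψ ∘ LL n) x + DJ j (DJ j (ψ ∘ LL n)) x)) := fun j => by
    rw [DJ_EX ζ hu1, DJ_EX ζ ((contDiff_const.mul hu1).add (DJ_contDiff hu1 j))]
    simp only [Pi.mul_apply]
    rw [DJ_lin hu1, DJ_one]
    simp only [Function.comp]
    linear_combination (EX ζ x * ζ j ^ 2 * (1 + ψ (LL n x))) * Complex.I_sq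
  have e2 : cgoSol ζ ψ (LL n x) = EX ζ x * (1 + ψ (LL n x)) := rfl
  simp only [e1]
  rw [e2, ← Finset.mul_sum, Finset.sum_add_distrib, ← Finset.sum_mul, Finset.sum_neg_distrib, hζ, Finset.sum_add_distrib, Pf]
  simp only [← hz]
  ring

lemma LL_vol : MeasurePreserving (LL n) volume volume := PiLp.volume_preserving_ofLp (Fin n)

lemma LL_norm (x : EE n) : ‖x‖ ^ 2 = ∑ i, (LL n x i) ^ 2 := by
  rw [EuclideanSpace.real_norm_sq_eq]
  rfl

lemma LL_emb : MeasurableEmbedding (LL n) := (LL n).toHomeomorph.measurableEmbedding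

lemma WN_LL (δ : ℝ) (ψ : (Fin n → ℝ) → ℂ) :
    ∫⁻ x : Fin n → ℝ, ENNReal.ofReal ((1 + ∑ i, x i ^ 2) ^ δ * ‖ψ x‖ ^ 2) = WN δ (ψ ∘ LL n) := by
  rw [← LL_vol.lintegral_comp_emb LL_emb, WN]
  refine lintegral_congr fun x => ?_
  rw [← LL_norm, ENNReal.ofReal_mul (by positivity), ENNReal.ofReal_pow (norm_nonneg _), ofReal_norm]
  rfl

lemma int_LL (δ : ℝ) (ψ : (Fin n → ℝ) → ℂ) :
    ∫ x : Fin n → ℝ, (1 + ∑ i, x i ^ 2) ^ δ * ‖ψ x‖ ^ 2 = ∫ x : EE n, (1 + ‖x‖ ^ 2) ^ δ * ‖ψ (LL n x)‖ ^ 2 := by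
  rw [← LL_vol.integral_comp LL_emb]
  refine integral_congr_ae (Filter.Eventually.of_forall fun x => ?_)
  simp only [LL_norm]

lemma int_WN {δ : ℝ} {u : EE n → ℂ} (hu : Continuous u) {A : ℝ} (hA : 0 ≤ A) (h : WN δ u ≤ ENNReal.ofReal (A ^ 2)) :
    Real.sqrt (∫ x : EE n, (1 + ‖x‖ ^ 2) ^ δ * ‖u x‖ ^ 2) ≤ A := by
  refine Real.sqrt_le_iff.2 ⟨hA, ?_⟩
  have hi := WN_int hu (h.trans_lt ENNReal.ofReal_lt_top)
  rw [← ENNReal.ofReal_le_ofReal_iff (by positivity), ofReal_integral_eq_lintegral_ofReal hi (Filter.Eventually.of_forall fun x => by positivity)]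
  refine le_trans (le_of_eq ?_) h
  refine lintegral_congr fun x => ?_
  rw [ENNReal.ofReal_mul (by positivity), ENNReal.ofReal_pow (norm_nonneg _), ofReal_norm]

lemma nn_le_w {δ ρ : ℝ} (h1 : -1 < δ) {p : 𝓢(EE n, ℂ)} (hp : Sup ρ p) :
    nn p ≤ Real.sqrt (∫ x : EE n, (1 + ‖x‖ ^ 2) ^ (δ + 1) * ‖p x‖ ^ 2) := by
  refine Real.le_sqrt_of_sq_le ?_
  rw [nn_sq]
  have hc : HasCompactSupport fun x : EE n => (1 + ‖x‖ ^ 2) ^ (δ + 1) * ‖p x‖ ^ 2 := by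
    refine HasCompactSupport.intro (isCompact_closedBall 0 ρ) fun x hx => ?_
    rw [hp x (by simpa using hx)]; simp
  refine integral_mono (sq_int p) (((w_cont n (δ + 1)).mul (p.continuous.norm.pow 2)).integrable_of_hasCompactSupport hc) fun x => ?_
  exact le_mul_of_one_le_left (by positivity) (Real.one_le_rpow (by nlinarith [sq_nonneg ‖x‖]) (by linarith))

lemma zeta_dec {ζ : Fin n → ℂ} (hζ : ∑ i, ζ i ^ 2 = 0) {R : ℝ} (hR0 : 0 < R) (hR : R ≤ Real.sqrt (∑ i, ‖ζ i‖ ^ 2)) :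
    ∃ (e a : EE n) (s : ℝ), 0 < s ∧ ‖e‖ = 1 ∧ inner ℝ e a = 0 ∧ ‖a‖ = s ∧ (∀ j, ζ j = (a j : ℂ) + Complex.I * s * (e j : ℂ)) ∧
      Real.sqrt (∑ i, ‖ζ i‖ ^ 2) = Real.sqrt 2 * s := by
  let a : EE n := WithLp.toLp 2 fun j => (ζ j).re
  let b : EE n := WithLp.toLp 2 fun j => (ζ j).im
  have ha : ∀ j, a j = (ζ j).re := fun j => rfl
  have hb : ∀ j, b j = (ζ j).im := fun j => rfl
  have hre := congrArg Complex.re hζ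
  have him := congrArg Complex.im hζ
  rw [Complex.re_sum] at hre
  rw [Complex.im_sum] at him
  simp only [sq, Complex.mul_re, Complex.mul_im, Complex.zero_re, Complex.zero_im] at hre him
  have na : ‖a‖ ^ 2 = ∑ j, (ζ j).re * (ζ j).re := by
    rw [EuclideanSpace.real_norm_sq_eq]; simp only [ha, sq]
  have nb : ‖b‖ ^ 2 = ∑ j, (ζ j).im * (ζ j).im := by
    rw [EuclideanSpace.real_norm_sq_eq]; simp only [hb, sq]
  rw [Finset.sum_sub_distrib] at hre
  have hab : ‖a‖ = ‖b‖ := by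
    rw [← sq_eq_sq₀ (norm_nonneg _) (norm_nonneg _), na, nb]; linarith
  have hin : inner ℝ b a = 0 := by
    rw [inner_sum]; simp only [ha, hb]
    have : ∑ i, ((ζ i).re * (ζ i).im + (ζ i).im * (ζ i).re) = 2 * ∑ i, (ζ i).im * (ζ i).re := by
      rw [Finset.mul_sum]; exact Finset.sum_congr rfl fun j _ => by ring
    linarith
  have hsum : ∑ i, ‖ζ i‖ ^ 2 = 2 * ‖b‖ ^ 2 := by
    have : ∑ i, ‖ζ i‖ ^ 2 = ‖a‖ ^ 2 + ‖b‖ ^ 2 := by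
      rw [na, nb, ← Finset.sum_add_distrib]
      refine Finset.sum_congr rfl fun j _ => ?_
      rw [Complex.sq_norm, Complex.normSq_apply]
    rw [this, hab]; ring
  have hsq : Real.sqrt (∑ i, ‖ζ i‖ ^ 2) = Real.sqrt 2 * ‖b‖ := by
    rw [hsum, Real.sqrt_mul (by norm_num), Real.sqrt_sq (norm_nonneg _)]
  have hb0 : 0 < ‖b‖ := by
    rcases (norm_nonneg b).eq_or_lt with h | h
    · rw [hsq, ← h, mul_zero] at hR; linarith
    · exact h
  refine ⟨‖b‖⁻¹ • b, a, ‖b‖, hb0, ?_, ?_, hab, fun j => ?_, hsq⟩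
  · rw [norm_smul, norm_inv, norm_norm, inv_mul_cancel₀ hb0.ne']
  · rw [real_inner_smul_left, hin, mul_zero]
  · have : ((‖b‖⁻¹ • b) j : ℝ) = ‖b‖⁻¹ * (ζ j).im := by simp [hb]
    rw [this, ha]
    have hb0' : ((‖b‖ : ℝ) : ℂ) ≠ 0 := by exact_mod_cast hb0.ne'
    push_cast
    field_simp
    rw [mul_comm Complex.I]
    exact (Complex.re_add_im _).symm

end
end CGO

open CGO

/-- Sylvester–Uhlmann: existence, uniqueness and the `L²_δ` estimate for the remainder of
complex geometrical optics solutions to `Δu + qu = 0`. -/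
theorem cgo_existence_uniqueness {n : ℕ} (hn : 2 ≤ n)
    (Ω : Set (Fin n → ℝ)) (hΩo : IsOpen Ω) (hΩb : Bornology.IsBounded Ω)
    (q : (Fin n → ℝ) → ℂ) (hq : ContDiff ℝ (⊤ : ℕ∞) q)
    (hqc : HasCompactSupport q) (hqΩ : tsupport q ⊆ Ω)
    (δ : ℝ) (hδ : δ ∈ Set.Ioo (-1 : ℝ) 0) :
    ∃ C > (0 : ℝ), ∃ R > (0 : ℝ), ∀ ζ : Fin n → ℂ,
      (∑ i, ζ i ^ 2) = 0 → R ≤ Real.sqrt (∑ i, ‖ζ i‖ ^ 2) →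
      ∃ ψ : (Fin n → ℝ) → ℂ,
        (ContDiff ℝ (⊤ : ℕ∞) ψ
          ∧ (∫⁻ x : Fin n → ℝ,
              ENNReal.ofReal ((1 + ∑ i, x i ^ 2) ^ δ * ‖ψ x‖ ^ 2)) < ⊤
          ∧ ∀ x, lapC (cgoSol ζ ψ) x + q x * cgoSol ζ ψ x = 0)
        ∧ (Real.sqrt (∫ x : Fin n → ℝ, (1 + ∑ i, x i ^ 2) ^ δ * ‖ψ x‖ ^ 2)
            ≤ C / Real.sqrt (∑ i, ‖ζ i‖ ^ 2)
              * Real.sqrt (∫ x : Fin n → ℝ, (1 + ∑ i, x i ^ 2) ^ (δ + 1) * ‖q x‖ ^ 2))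
        ∧ ∀ ψ' : (Fin n → ℝ) → ℂ,
            (ContDiff ℝ (⊤ : ℕ∞) ψ'
              ∧ (∫⁻ x : Fin n → ℝ,
                  ENNReal.ofReal ((1 + ∑ i, x i ^ 2) ^ δ * ‖ψ' x‖ ^ 2)) < ⊤
              ∧ ∀ x, lapC (cgoSol ζ ψ') x + q x * cgoSol ζ ψ' x = 0)
            → ψ' = ψ := by
  obtain ⟨h1, h0⟩ := hδ
  have hb1 : HasCompactSupport fun x : EE n => -q (LL n x) :=
    (hqc.comp_homeomorph (LL n).toHomeomorph).comp_left (g := fun z : ℂ => -z) (by simp)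
  have hb2 : ContDiff ℝ (⊤ : ℕ∞) fun x : EE n => -q (LL n x) := (hq.comp (LL n).contDiff).neg
  obtain ⟨p, hp⟩ : ∃ p : SchwartzMap (EE n) ℂ, ∀ x, p x = -q (LL n x) := ⟨hb1.toSchwartzMap hb2, fun x => rfl⟩
  obtain ⟨ρ', hρ'⟩ := hb1.isCompact.isBounded.subset_closedBall 0
  obtain ⟨ρ, hρ, hpS⟩ : ∃ ρ : ℝ, 0 ≤ ρ ∧ Sup ρ p := by
    refine ⟨max ρ' 0, le_max_right _ _, fun x hx => ?_⟩
    rw [hp]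
    refine image_eq_zero_of_notMem_tsupport (f := fun x : EE n => -q (LL n x)) fun h => ?_
    have := hρ' h
    rw [mem_closedBall_zero_iff] at this
    exact absurd ((le_max_left ρ' 0).trans_lt hx) (not_lt.2 this)
  obtain ⟨M, hM0, hM⟩ := schwartz_bdd p
  have hB := Bc_nonneg n δ ρ
  have hK := Kc_nonneg n δ ρ
  have h2 : 0 < Real.sqrt 2 := by positivity
  refine ⟨2 * Real.sqrt 2 * (Kc n δ ρ + 1), by positivity, Real.sqrt 2 * (1 + 2 * M * Bc n δ ρ), by positivity, fun ζ hζ hR => ?_⟩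
  obtain ⟨e, a, s, hs0, he, hea, has, hz, hsq⟩ := zeta_dec hζ (by positivity) hR
  rw [hsq] at hR ⊢
  have hs' : 1 + 2 * M * Bc n δ ρ ≤ s := le_of_mul_le_mul_left hR h2
  have hMB : 0 ≤ 2 * M * Bc n δ ρ := by positivity
  have hs : 1 ≤ s := by linarith
  have hMs : M * Bc n δ ρ / s ≤ 1 / 2 := by
    rw [div_le_iff₀ hs0]; linarith
  have heq : ∀ ψ : (Fin n → ℝ) → ℂ, ContDiff ℝ (⊤ : ℕ∞) ψ → ((∀ x, lapC (cgoSol ζ ψ) x + q x * cgoSol ζ ψ x = 0) ↔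
      ∀ x, Pf e a s (ψ ∘ LL n) x = p x + p x * (ψ ∘ LL n) x) := fun ψ hψ => by
    rw [(LL n).surjective.forall]
    refine forall_congr' fun x => ?_
    rw [cgo_eq hζ hz hψ, mul_eq_zero, or_iff_right (show EX ζ x ≠ 0 from Complex.exp_ne_zero _), hp]
    simp only [Function.comp_apply]
    constructor <;> intro h <;> linear_combination h
  obtain ⟨u, hu, huW, huP⟩ := exist hn he hea hs has h1 h0 hρ hpS hM hM0.le hMs
  have hn0 := nn_nonneg p
  obtain ⟨ψ, hψu⟩ : ∃ ψ : (Fin n → ℝ) → ℂ, ψ ∘ LL n = u := ⟨u ∘ (LL n).symm, by ext x; simp⟩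
  have hψ : ContDiff ℝ (⊤ : ℕ∞) ψ := by
    have : ψ = u ∘ (LL n).symm := by rw [← hψu]; ext x; exact congrArg ψ ((LL n).apply_symm_apply x).symm
    rw [this]; exact hu.comp (LL n).symm.contDiff
  refine ⟨ψ, ⟨hψ, ?_, ?_⟩, ?_, ?_⟩
  · rw [WN_LL, hψu]; exact huW.trans_lt ENNReal.ofReal_lt_top
  · rw [heq ψ hψ, hψu]; exact huP
  · rw [int_LL, int_LL]
    have e1 : ∀ x, ψ (LL n x) = u x := fun x => congrFun hψu x
    have e2 : ∀ x, ‖q (LL n x)‖ = ‖p x‖ := fun x => by rw [hp, norm_neg]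
    simp only [e1, e2]
    refine (int_WN hu.continuous (by positivity) huW).trans ?_
    have h5 := nn_le_w h1 hpS
    calc 2 * Kc n δ ρ / s * nn p ≤ 2 * (Kc n δ ρ + 1) / s * nn p := by gcongr; linarith
      _ = 2 * Real.sqrt 2 * (Kc n δ ρ + 1) / (Real.sqrt 2 * s) * nn p := by
        field_simp
      _ ≤ _ := by gcongr
  · rintro ψ' ⟨hψ', hW', hP'⟩
    rw [WN_LL] at hW'
    rw [heq ψ' hψ'] at hP'
    have := uniq hn he hea hs has h1 h0 hρ hpS hM hM0.le hMs (hψ'.comp (LL n).contDiff) hu hW' (huW.trans_lt ENNReal.ofReal_lt_top) hP' huP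
    rw [← hψu] at this
    exact (LL n).surjective.injective_comp_right this
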